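/- Let μ be a probability measure on ℝ with mean 0 and variance 1 that is log-concave, i.e., μ has a density of the form e^{−φ} for some convex function φ : ℝ → (−∞,∞]. Let (d_n) be a sequence of positive integers with d_n/(n³·(ln d_n)²) → ∞ as n → ∞. Then TV(𝒲_{n,d_n}, 𝒢_n) → 0 as n → ∞. -/

import Mathlib

open MeasureTheory ProbabilityTheory Filter
open scoped BigOperators ENNReal Topology

/-- The total variation distance between two measures. -/
noncomputable def tvDist {Ω : Type*} [MeasurableSpace Ω] (μ ν : Measure Ω) : ℝ :=
  ⨆ A : {A : Set Ω // MeasurableSet A}, |(μ A).toReal - (ν A).toReal|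

/-- The law of `𝒲_{n,d} = (1/√d)(XXᵀ - diag(XXᵀ))`, the scaled Wishart matrix with zeroed
diagonal, where `X` is an `n × d` matrix with i.i.d. entries of law `μ`. -/
noncomputable def scaledWishartLaw (μ : Measure ℝ) (n d : ℕ) : Measure (Fin n → Fin n → ℝ) :=
  Measure.map
    (fun X : Fin n → Fin d → ℝ => fun i j =>
      if i = j then 0 else (∑ k, X i k * X j k) / Real.sqrt d)
    (Measure.pi fun _ : Fin n => Measure.pi fun _ : Fin d => μ)

/-- The law of `𝒢_n`: the symmetric `n × n` random matrix with zero diagonal and i.i.d.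
standard Gaussian entries above the diagonal (GOE with zeroed diagonal). -/
noncomputable def goeZeroDiagLaw (n : ℕ) : Measure (Fin n → Fin n → ℝ) :=
  Measure.map
    (fun u : {q : Fin n × Fin n // q.1 < q.2} → ℝ => fun i j =>
      if h : i < j then u ⟨(i, j), h⟩ else if h : j < i then u ⟨(j, i), h⟩ else 0)
    (Measure.pi fun _ : {q : Fin n × Fin n // q.1 < q.2} => gaussianReal 0 1)


namespace WG

/-- log-concavity of a density, as in the statement -/
def LC (f : ℝ → ℝ) : Prop := (∀ x, 0 ≤ f x) ∧ ∀ x y : ℝ, ∀ t ∈ Set.Icc (0 : ℝ) 1,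
        f x ^ t * f y ^ (1 - t) ≤ f (t * x + (1 - t) * y)

lemma LC.neg {f : ℝ → ℝ} (h : LC f) : LC (fun x => f (-x)) := by
  refine ⟨fun x => h.1 _, fun x y t ht => ?_⟩
  have := h.2 (-x) (-y) t ht
  refine this.trans (le_of_eq ?_)
  congr 1; ring

lemma LC.convex_gt {f : ℝ → ℝ} (h : LC f) (a : ℝ) : Convex ℝ {x | a < f x} := by
  intro x hx y hy t s ht hs hts
  simp only [Set.mem_ofPred_eq, smul_eq_mul] at *
  obtain rfl : s = 1 - t := by linarith
  have h1 := h.2 x y t ⟨ht, by linarith⟩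
  refine lt_of_lt_of_le ?_ h1
  set m := min (f x) (f y) with hm
  have ham : a < m := lt_min hx hy
  have hm0 : 0 ≤ m := le_min (h.1 x) (h.1 y)
  rcases eq_or_lt_of_le hm0 with h0 | h0
  · have ha : a < 0 := by rw [h0]; exact ham
    exact lt_of_lt_of_le ha (mul_nonneg (Real.rpow_nonneg (h.1 _) _) (Real.rpow_nonneg (h.1 _) _))
  · calc a < m := ham
      _ = m ^ t * m ^ (1 - t) := by rw [← Real.rpow_add h0]; simp
      _ ≤ _ := by
        have e1 : m ≤ f x := min_le_left _ _
        have e2 : m ≤ f y := min_le_right _ _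
        have e3 := Real.rpow_nonneg (h.1 x) t
        gcongr

lemma LC.measurable {f : ℝ → ℝ} (h : LC f) : Measurable f :=
  measurable_of_Ioi fun a => (h.convex_gt a).ordConnected.measurableSet

/-- one-sided exponential decay -/
lemma LC.decay {f : ℝ → ℝ} (h : LC f) (hfint : Integrable f) (hne : ∃ x, 0 < f x) :
    ∃ c K R : ℝ, 0 < c ∧ 0 ≤ K ∧ ∀ x, R ≤ x → f x ≤ K * Real.exp (-(c * x)) := by
  obtain ⟨x0, hx0⟩ := hne
  have hex : ∃ x1, x0 < x1 ∧ f x1 < f x0 := by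
    by_contra hcon
    push Not at hcon
    have : IntegrableOn (fun _ : ℝ => f x0) (Set.Ioi x0) := by
      refine Integrable.mono' (hfint.integrableOn) (by fun_prop) ?_
      refine (ae_restrict_iff' measurableSet_Ioi).2 (Eventually.of_forall fun x hx => ?_)
      rw [Real.norm_of_nonneg hx0.le]; exact hcon x hx
    rw [integrableOn_const_iff] at this
    rcases this with h1 | h1
    · exact hx0.ne' (by simpa using h1)
    · simp at h1
  obtain ⟨x1, h01, hlt⟩ := hex
  set r := (f x1 + f x0) / 2 / f x0 with hr
  have hr0 : 0 < r := by have := h.1 x1; positivity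
  have hr1 : r < 1 := by rw [hr, div_lt_one hx0]; linarith
  have hfr : f x1 ≤ r * f x0 := by rw [hr, div_mul_cancel₀ _ hx0.ne']; linarith
  have hlog : Real.log r < 0 := Real.log_neg hr0 hr1
  have hpos : 0 < x1 - x0 := by linarith
  refine ⟨-Real.log r / (x1 - x0), f x0 * Real.exp (-(Real.log r / (x1 - x0) * x0)), x1,
    div_pos (by linarith) hpos, by positivity, fun x hx => ?_⟩
  have hxx : 0 < x - x0 := by linarith
  set t := (x1 - x0) / (x - x0) with ht
  have ht0 : 0 < t := by positivity
  have ht1 : t ≤ 1 := by rw [ht, div_le_one hxx]; linarith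
  have h1 := h.2 x x0 t ⟨ht0.le, ht1⟩
  have hpt : t * x + (1 - t) * x0 = x1 := by
    have : t * (x - x0) = x1 - x0 := by rw [ht]; field_simp
    linarith
  rw [hpt] at h1
  have h2 : (f x / f x0) ^ t ≤ r := by
    have h3 : f x ^ t * f x0 ^ (1 - t) ≤ r * f x0 := h1.trans hfr
    rw [Real.rpow_sub hx0, Real.rpow_one] at h3
    rw [Real.div_rpow (h.1 x) hx0.le]
    have h4 : 0 < f x0 ^ t := Real.rpow_pos_of_pos hx0 t
    have h5 : f x ^ t * (f x0 / f x0 ^ t) = (f x ^ t / f x0 ^ t) * f x0 := by ring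
    rw [h5] at h3
    exact le_of_mul_le_mul_right h3 hx0
  have h3 : f x / f x0 ≤ r ^ (1 / t) := by
    have := Real.rpow_le_rpow (Real.rpow_nonneg (div_nonneg (h.1 x) hx0.le) t) h2
      (by positivity : 0 ≤ 1 / t)
    rwa [← Real.rpow_mul (div_nonneg (h.1 x) hx0.le), mul_one_div_cancel ht0.ne', Real.rpow_one]
      at this
  rw [div_le_iff₀ hx0] at h3
  refine h3.trans (le_of_eq ?_)
  rw [Real.rpow_def_of_pos hr0, mul_comm, mul_assoc, ← Real.exp_add]
  congr 2
  rw [ht]; field_simp; ring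

lemma integrable_exp_neg_mul_abs {c : ℝ} (hc : 0 < c) :
    Integrable (fun x : ℝ => Real.exp (-(c * |x|))) := by
  have h1 : IntegrableOn (fun x : ℝ => Real.exp (-(c * |x|))) (Set.Ioi 0) := by
    refine (integrableOn_congr_fun ?_ measurableSet_Ioi).1 (exp_neg_integrableOn_Ioi 0 hc)
    intro x hx; simp only [Set.mem_Ioi] at hx
    simp [abs_of_pos hx]
  have h2 : IntegrableOn (fun x : ℝ => Real.exp (-(c * |x|))) (Set.Iic 0) := by
    refine (integrableOn_congr_fun ?_ measurableSet_Iic).1 (integrableOn_exp_mul_Iic hc 0)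
    intro x hx; simp only [Set.mem_Iic] at hx
    simp [abs_of_nonpos hx]
  rw [← integrableOn_univ, ← Set.Iic_union_Ioi (a := (0:ℝ))]
  exact h2.union h1

lemma LC.exp_moment {f : ℝ → ℝ} (h : LC f) (hfint : Integrable f) (hne : ∃ x, 0 < f x) :
    ∃ c : ℝ, 0 < c ∧ Integrable (fun x => Real.exp (c * |x|) * f x) := by
  obtain ⟨c1, K1, R1, hc1, hK1, hb1⟩ := h.decay hfint hne
  obtain ⟨c2, K2, R2, hc2, hK2, hb2⟩ := h.neg.decay hfint.comp_neg
    (by obtain ⟨x, hx⟩ := hne; exact ⟨-x, by simpa using hx⟩)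
  set c := min c1 c2 / 2 with hc
  have hcp : 0 < c := by positivity
  have hcc1 : 2 * c ≤ c1 := by rw [hc]; linarith [min_le_left c1 c2]
  have hcc2 : 2 * c ≤ c2 := by rw [hc]; linarith [min_le_right c1 c2]
  set R := max (max |R1| |R2|) 0 with hR
  have hR1 : R1 ≤ R := (le_abs_self _).trans ((le_max_left _ _).trans (le_max_left _ _))
  have hR2 : R2 ≤ R := (le_abs_self _).trans ((le_max_right _ _).trans (le_max_left _ _))
  have hR0 : 0 ≤ R := le_max_right _ _
  refine ⟨c, hcp, ?_⟩
  have hdom : Integrable (fun x => Real.exp (c * R) * f x +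
      (K1 + K2) * Real.exp (-(c * |x|))) :=
    (hfint.const_mul _).add ((integrable_exp_neg_mul_abs hcp).const_mul _)
  have hm := h.measurable
  refine hdom.mono' (by fun_prop) (Eventually.of_forall fun x => ?_)
  rw [Real.norm_of_nonneg (mul_nonneg (Real.exp_pos _).le (h.1 x))]
  have e0 := (Real.exp_pos (-(c * |x|))).le
  by_cases hx : |x| ≤ R
  · have : Real.exp (c * |x|) * f x ≤ Real.exp (c * R) * f x := by
      have := h.1 x
      gcongr
    nlinarith
  · push Not at hx
    have hf : f x ≤ (K1 + K2) * Real.exp (-(2 * c * |x|)) := by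
      rcases le_total 0 x with h0 | h0
      · rw [abs_of_nonneg h0] at hx ⊢
        refine (hb1 x (by linarith)).trans ?_
        gcongr
        linarith
      · rw [abs_of_nonpos h0] at hx ⊢
        have := (hb2 (-x) (by linarith))
        simp only [neg_neg] at this
        refine this.trans ?_
        gcongr
        · linarith
        · linarith
    have : Real.exp (c * |x|) * f x ≤ (K1 + K2) * Real.exp (-(c * |x|)) := by
      calc Real.exp (c * |x|) * f x ≤ Real.exp (c * |x|) * ((K1 + K2) * Real.exp (-(2 * c * |x|))) := by
            gcongr
        _ = (K1 + K2) * (Real.exp (c * |x|) * Real.exp (-(2 * c * |x|))) := by ring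
        _ = _ := by rw [← Real.exp_add]; congr 2; ring
    have h3 := mul_nonneg (Real.exp_pos (c * R)).le (h.1 x)
    linarith

end WG


namespace WG

lemma LC.convexOn {f : ℝ → ℝ} (h : LC f) :
    ConvexOn ℝ {x | 0 < f x} (fun x => -Real.log (f x)) := by
  refine ⟨h.convex_gt 0, fun x hx y hy t s ht hs hts => ?_⟩
  simp only [Set.mem_ofPred_eq, smul_eq_mul] at *
  obtain rfl : s = 1 - t := by linarith
  have h1 := h.2 x y t ⟨ht, by linarith⟩
  have h2 : 0 < f x ^ t * f y ^ (1 - t) := by positivity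
  have h3 := Real.log_le_log h2 h1
  rw [Real.log_mul (by positivity) (by positivity), Real.log_rpow hx, Real.log_rpow hy] at h3
  linarith

/-- the interior of the support -/
def JJ (f : ℝ → ℝ) : Set ℝ := interior {x | 0 < f x}

/-- right slope of the potential -/
noncomputable def ss (f : ℝ → ℝ) (x : ℝ) : ℝ :=
  derivWithin (fun x => -Real.log (f x)) (Set.Ioi x) x

lemma JJ_pos {f : ℝ → ℝ} {x : ℝ} (hx : x ∈ JJ f) : 0 < f x :=
  interior_subset (s := {x | 0 < f x}) hx

lemma LC.hasDeriv {f : ℝ → ℝ} (h : LC f) {x : ℝ} (hx : x ∈ JJ f) :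
    HasDerivWithinAt f (-(ss f x) * f x) (Set.Ioi x) x := by
  have h1 := h.convexOn.hasDerivWithinAt_rightDeriv_of_mem_interior hx
  have h2 := (h1.neg).exp
  have hfx := JJ_pos hx
  have h3 : HasDerivWithinAt (fun y => Real.exp (- -Real.log (f y))) (-(ss f x) * f x)
      (Set.Ioi x) x := by
    have e : Real.exp ((-fun x => -Real.log (f x)) x) = f x := by simp [Real.exp_log hfx]
    rw [e] at h2
    have e2 : -(ss f x) * f x = f x * -derivWithin (fun x => -Real.log (f x)) (Set.Ioi x) x := by
      simp only [ss]; ring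
    rw [e2]; exact h2
  refine h3.congr_of_eventuallyEq ?_ ?_
  · have : ∀ᶠ y in 𝓝 x, y ∈ JJ f := isOpen_interior.mem_nhds hx
    filter_upwards [nhdsWithin_le_nhds this] with y hy
    rw [neg_neg, Real.exp_log (JJ_pos hy)]
  · rw [neg_neg, Real.exp_log hfx]

lemma LC.contAt {f : ℝ → ℝ} (h : LC f) {x : ℝ} (hx : x ∈ JJ f) : ContinuousAt f x := by
  have h1 := (h.convexOn.continuousOn_interior).continuousAt (isOpen_interior.mem_nhds hx)
  have h2 : ContinuousAt (fun y => Real.exp (- -Real.log (f y))) x := by fun_prop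
  refine h2.congr ?_
  have : ∀ᶠ y in 𝓝 x, y ∈ JJ f := isOpen_interior.mem_nhds hx
  filter_upwards [this] with y hy
  rw [neg_neg, Real.exp_log (JJ_pos hy)]

/-- supporting line -/
lemma LC.support {f : ℝ → ℝ} (h : LC f) {x : ℝ} (hx : x ∈ JJ f) (u : ℝ) :
    f u ≤ f x * Real.exp (-(ss f x * (u - x))) := by
  have hfx := JJ_pos hx
  rcases eq_or_lt_of_le (h.1 u) with h0 | h0
  · rw [← h0]; positivity
  have key : ss f x * (u - x) ≤ -Real.log (f u) - -Real.log (f x) := by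
    rcases lt_trichotomy u x with hux | rfl | hux
    · have h1 := h.convexOn.slope_le_leftDeriv_of_mem_interior (y := x) (x := u) h0 hx hux
      have h2 := h.convexOn.leftDeriv_le_rightDeriv_of_mem_interior hx
      have h3 := h1.trans h2
      rw [slope_def_field, div_le_iff₀ (by linarith)] at h3
      simp only [ss]
      linarith
    · simp
    · have h1 := h.convexOn.rightDeriv_le_slope_of_mem_interior hx (show u ∈ {x | 0 < f x} from h0) hux
      rw [slope_def_field, le_div_iff₀ (by linarith)] at h1
      simp only [ss]
      linarith
  have : Real.log (f u) ≤ Real.log (f x) + -(ss f x * (u - x)) := by linarith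
  calc f u = Real.exp (Real.log (f u)) := (Real.exp_log h0).symm
    _ ≤ Real.exp (Real.log (f x) + -(ss f x * (u - x))) := Real.exp_le_exp.2 this
    _ = _ := by rw [Real.exp_add, Real.exp_log hfx]

lemma LC.ae_zero {f : ℝ → ℝ} (h : LC f) : ∀ᵐ x, x ∉ JJ f → f x = 0 := by
  have h1 := (h.convex_gt 0).addHaar_frontier (volume : Measure ℝ)
  filter_upwards [measure_eq_zero_iff_ae_notMem.1 h1] with x hx hxJ
  by_contra hne
  have h0 : 0 < f x := lt_of_le_of_ne (h.1 x) (Ne.symm hne)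
  exact hx ⟨subset_closure h0, hxJ⟩

lemma integral_exp_abs {σ : ℝ} (hσ : 0 < σ) : ∫ u : ℝ, Real.exp (-(σ * |u|)) = 2 / σ := by
  have h := integral_comp_abs (f := fun r => Real.exp (-(σ * r)))
  rw [h]
  have : ∀ r : ℝ, Real.exp (-(σ * r)) = Real.exp (-σ * r) := fun r => by ring_nf
  simp_rw [this]
  rw [integral_exp_mul_Ioi (by linarith)]
  simp; ring

lemma abs_mul_exp_le {σ : ℝ} (hσ : 0 < σ) (x u : ℝ) :
    |u| * Real.exp (-(σ * |u - x|)) ≤ |x| * Real.exp (-(σ * |u - x|)) +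
      2 / σ * Real.exp (-(σ / 2 * |u - x|)) := by
  have h1 : |u| ≤ |x| + |u - x| := by
    have := abs_add_le x (u - x); simpa using this
  have h2 : |u - x| ≤ 2 / σ * Real.exp (σ / 2 * |u - x|) := by
    have := Real.add_one_le_exp (σ / 2 * |u - x|)
    calc |u - x| = 2 / σ * (σ / 2 * |u - x|) := by field_simp
      _ ≤ _ := by gcongr; linarith
  have h3 : Real.exp (σ / 2 * |u - x|) * Real.exp (-(σ * |u - x|)) =
      Real.exp (-(σ / 2 * |u - x|)) := by rw [← Real.exp_add]; congr 1; ring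
  have e := (Real.exp_pos (-(σ * |u - x|))).le
  calc |u| * Real.exp (-(σ * |u - x|)) ≤ (|x| + 2 / σ * Real.exp (σ / 2 * |u - x|)) *
        Real.exp (-(σ * |u - x|)) := by gcongr; linarith
    _ = _ := by rw [add_mul, mul_assoc (2 / σ), h3]

lemma integrable_aux {σ : ℝ} (hσ : 0 < σ) (x : ℝ) :
    Integrable (fun u => |x| * Real.exp (-(σ * |u - x|)) +
      2 / σ * Real.exp (-(σ / 2 * |u - x|))) := by
  have h1 := (integrable_exp_neg_mul_abs hσ).comp_sub_right x
  have h2 := (integrable_exp_neg_mul_abs (half_pos hσ)).comp_sub_right x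
  exact (h1.const_mul _).add (h2.const_mul _)

lemma integral_aux {σ : ℝ} (hσ : 0 < σ) (x : ℝ) :
    ∫ u, (|x| * Real.exp (-(σ * |u - x|)) +
      2 / σ * Real.exp (-(σ / 2 * |u - x|))) = 2 * |x| / σ + 8 / σ ^ 2 := by
  have h1 := (integrable_exp_neg_mul_abs hσ).comp_sub_right x
  have h2 := (integrable_exp_neg_mul_abs (half_pos hσ)).comp_sub_right x
  rw [integral_add (h1.const_mul _) (h2.const_mul _), integral_const_mul, integral_const_mul,
    integral_sub_right_eq_self (fun u => Real.exp (-(σ * |u|))),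
    integral_sub_right_eq_self (fun u => Real.exp (-(σ / 2 * |u|))),
    integral_exp_abs hσ, integral_exp_abs (half_pos hσ)]
  field_simp; ring

noncomputable def F1 (f : ℝ → ℝ) (x : ℝ) : ℝ := ∫ u in Set.Ioi x, u * f u

section
variable {f : ℝ → ℝ}

lemma F1_eq' (hi : Integrable (fun u => u * f u)) (hm : ∫ u, u * f u = 0)
    (x : ℝ) : F1 f x = - ∫ u in Set.Iic x, u * f u := by
  have := integral_add_compl (measurableSet_Iic (a := x)) hi
  rw [hm, Set.compl_Iic] at this
  simp only [F1]; linarith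

lemma F1_nonneg (h : LC f) (hi : Integrable (fun u => u * f u)) (hm : ∫ u, u * f u = 0)
    (x : ℝ) : 0 ≤ F1 f x := by
  rcases le_total 0 x with h0 | h0
  · refine setIntegral_nonneg measurableSet_Ioi fun u hu => ?_
    have : 0 < u := lt_of_le_of_lt h0 hu
    exact mul_nonneg this.le (h.1 u)
  · rw [F1_eq' hi hm, neg_nonneg]
    refine setIntegral_nonpos measurableSet_Iic fun u hu => ?_
    have : u ≤ 0 := le_trans hu h0
    exact mul_nonpos_of_nonpos_of_nonneg this (h.1 u)

lemma F1_le (h : LC f) (hi : Integrable (fun u => u * f u)) (hm : ∫ u, u * f u = 0)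
    (x : ℝ) : F1 f x ≤ ∫ u, |u| * f u := by
  have hi' : Integrable (fun u => |u| * f u) := by
    refine hi.abs.congr (Eventually.of_forall fun u => ?_)
    simp only [abs_mul, abs_of_nonneg (h.1 u)]
  have h1 : F1 f x ≤ ∫ u in Set.Ioi x, |u| * f u :=
    integral_mono hi.integrableOn hi'.integrableOn
      (fun u => mul_le_mul_of_nonneg_right (le_abs_self u) (h.1 u))
  exact h1.trans (setIntegral_le_integral hi'
    (Eventually.of_forall fun u => mul_nonneg (abs_nonneg u) (h.1 u)))

lemma F1_le_slope (h : LC f) (hi : Integrable (fun u => u * f u)) (hm : ∫ u, u * f u = 0)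
    {x : ℝ} (hx : x ∈ JJ f) (hs : ss f x ≠ 0) :
    F1 f x ≤ f x * (2 * |x| / |ss f x| + 8 / |ss f x| ^ 2) := by
  have hσ : 0 < |ss f x| := abs_pos.2 hs
  have hfint := (integrable_aux hσ x).const_mul (f x)
  have hfx := (JJ_pos hx).le
  have hnn : ∀ u, 0 ≤ f x * (|x| * Real.exp (-(|ss f x| * |u - x|)) +
      2 / |ss f x| * Real.exp (-(|ss f x| / 2 * |u - x|))) := fun u => by positivity
  rw [← integral_aux hσ x, ← integral_const_mul]
  have main : ∀ u, f u ≤ f x * Real.exp (-(|ss f x| * |u - x|)) →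
      |u| * f u ≤ f x * (|x| * Real.exp (-(|ss f x| * |u - x|)) +
      2 / |ss f x| * Real.exp (-(|ss f x| / 2 * |u - x|))) := fun u hu => by
    calc |u| * f u ≤ |u| * (f x * Real.exp (-(|ss f x| * |u - x|))) := by gcongr
      _ = f x * (|u| * Real.exp (-(|ss f x| * |u - x|))) := by ring
      _ ≤ _ := by gcongr; exact abs_mul_exp_le hσ x u
  rcases lt_or_gt_of_ne hs with h0 | h0
  · rw [F1_eq' hi hm, ← integral_neg]
    refine le_trans (setIntegral_mono_on hi.neg.integrableOn hfint.integrableOn measurableSet_Iic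
      fun u hu => ?_) (setIntegral_le_integral hfint (Eventually.of_forall hnn))
    refine le_trans ?_ (main u ?_)
    · have := neg_abs_le u; have := h.1 u; nlinarith
    · refine (h.support hx u).trans (le_of_eq ?_)
      have hux : u ≤ x := hu
      rw [abs_of_neg h0, abs_of_nonpos (by linarith)]; ring_nf
  · refine le_trans (setIntegral_mono_on hi.integrableOn hfint.integrableOn measurableSet_Ioi
      fun u hu => ?_) (setIntegral_le_integral hfint (Eventually.of_forall hnn))
    refine le_trans ?_ (main u ?_)
    · have := le_abs_self u; have := h.1 u; nlinarith
    · refine (h.support hx u).trans (le_of_eq ?_)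
      have hux : x < u := hu
      rw [abs_of_pos h0, abs_of_nonneg (by linarith)]

lemma F1_hasDerivAt (h : LC f) (hi : Integrable (fun u => u * f u)) (hm : ∫ u, u * f u = 0)
    {x : ℝ} (hx : x ∈ JJ f) : HasDerivAt (F1 f) (-(x * f x)) x := by
  have hfm := h.measurable
  have h1 : F1 f = fun y => F1 f x - ∫ u in x..y, u * f u := by
    funext y
    rcases le_total x y with hxy | hxy
    · rw [← intervalIntegral.integral_Ioi_sub_Ioi hi.integrableOn hxy]; simp [F1]
    · rw [intervalIntegral.integral_symm,
        ← intervalIntegral.integral_Ioi_sub_Ioi hi.integrableOn hxy]; simp [F1]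
  rw [h1]
  have h2 := intervalIntegral.integral_hasDerivAt_right (a := x) (b := x)
    (f := fun u => u * f u) (by simp)
    ((by fun_prop : StronglyMeasurable (fun u => u * f u)).stronglyMeasurableAtFilter)
    (continuousAt_id.mul (h.contAt hx))
  exact h2.const_sub _

end

end WG


namespace WG

/-- the Stein kernel -/
noncomputable def tau (f : ℝ → ℝ) : ℝ → ℝ := (JJ f).indicator (fun x => F1 f x / f x)

noncomputable def tau' (f : ℝ → ℝ) : ℝ → ℝ :=
  (JJ f).indicator (fun x => -x + F1 f x / f x * ss f x)

lemma F1_continuous {f : ℝ → ℝ} (hi : Integrable (fun u => u * f u)) : Continuous (F1 f) := by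
  have h1 : F1 f = fun y => F1 f 0 - ∫ u in (0:ℝ)..y, u * f u := by
    funext y
    rcases le_total 0 y with hxy | hxy
    · rw [← intervalIntegral.integral_Ioi_sub_Ioi hi.integrableOn hxy]; simp [F1]
    · rw [intervalIntegral.integral_symm,
        ← intervalIntegral.integral_Ioi_sub_Ioi hi.integrableOn hxy]; simp [F1]
  rw [h1]
  exact continuous_const.sub
    (intervalIntegral.continuous_primitive (fun a b => hi.intervalIntegrable) 0)

lemma tau_measurable {f : ℝ → ℝ} (h : LC f) (hi : Integrable (fun u => u * f u)) :
    Measurable (tau f) :=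
  ((F1_continuous hi).measurable.div h.measurable).indicator isOpen_interior.measurableSet

lemma ss_measurable {f : ℝ → ℝ} : Measurable (ss f) :=
  measurable_derivWithin_Ioi _

lemma tau'_measurable {f : ℝ → ℝ} (h : LC f) (hi : Integrable (fun u => u * f u)) :
    Measurable (tau' f) :=
  (measurable_id.neg.add (((F1_continuous hi).measurable.div h.measurable).mul
    ss_measurable)).indicator isOpen_interior.measurableSet

lemma tau_eventuallyEq {f : ℝ → ℝ} {x : ℝ} (hx : x ∈ JJ f) :
    tau f =ᶠ[𝓝 x] fun x => F1 f x / f x := by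
  have : ∀ᶠ y in 𝓝 x, y ∈ JJ f := isOpen_interior.mem_nhds hx
  filter_upwards [this] with y hy
  simp [tau, hy]

lemma tau_contAt {f : ℝ → ℝ} (h : LC f) (hi : Integrable (fun u => u * f u)) {x : ℝ}
    (hx : x ∈ JJ f) : ContinuousAt (tau f) x := by
  refine ContinuousAt.congr ?_ (tau_eventuallyEq hx).symm
  exact (F1_continuous hi).continuousAt.div (h.contAt hx) (JJ_pos hx).ne'

lemma tau_hasDeriv {f : ℝ → ℝ} (h : LC f) (hi : Integrable (fun u => u * f u))
    (hm : ∫ u, u * f u = 0) {x : ℝ}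
    (hx : x ∈ JJ f) : HasDerivWithinAt (tau f) (tau' f x) (Set.Ioi x) x := by
  have hfx := (JJ_pos hx).ne'
  have h1 := ((F1_hasDerivAt h hi hm hx).hasDerivWithinAt (s := Set.Ioi x)).div (h.hasDeriv hx) hfx
  refine HasDerivWithinAt.congr_of_eventuallyEq ?_ (nhdsWithin_le_nhds (tau_eventuallyEq hx))
    (tau_eventuallyEq hx).self_of_nhds
  have e : tau' f x = (-(x * f x) * f x - F1 f x * (-(ss f x) * f x)) / f x ^ 2 := by
    simp only [tau', Set.indicator_of_mem hx]
    field_simp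
    ring
  rw [e]; exact h1

lemma tau_nonneg {f : ℝ → ℝ} (h : LC f) (hi : Integrable (fun u => u * f u))
    (hm : ∫ u, u * f u = 0) (x : ℝ) : 0 ≤ tau f x := by
  refine Set.indicator_nonneg (fun x hx => ?_) x
  exact div_nonneg (F1_nonneg h hi hm x) (h.1 x)

lemma tau_mul {f : ℝ → ℝ} {x : ℝ} (hx : x ∈ JJ f) : tau f x * f x = F1 f x := by
  have := (JJ_pos hx).ne'
  simp only [tau, Set.indicator_of_mem hx]; field_simp

/-- bounds for small slopes -/
lemma tau_le_small {f : ℝ → ℝ} (h : LC f) (hf : Integrable f) (hi : Integrable (fun u => u * f u))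
    (hm : ∫ u, u * f u = 0) {s0 : ℝ} (hs0 : 0 < s0) (hD : 0 < ∫ u, f u * Real.exp (-(2 * s0 * |u|)))
    {x : ℝ} (hx : x ∈ JJ f) (hs : |ss f x| ≤ s0) :
    tau f x ≤ 2 * (∫ u, |u| * f u) / (s0 * ∫ u, f u * Real.exp (-(2 * s0 * |u|))) *
      Real.exp (s0 * |x|) := by
  set D := ∫ u, f u * Real.exp (-(2 * s0 * |u|)) with hDdef
  have hfx := JJ_pos hx
  have hfm := h.measurable
  have key : ∀ u, f u * Real.exp (-(2 * s0 * |u|)) ≤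
      f x * Real.exp (s0 * |x|) * Real.exp (-(s0 * |u|)) := fun u => by
    have h1 := h.support hx u
    have h2 : -(ss f x * (u - x)) ≤ s0 * |u| + s0 * |x| := by
      calc -(ss f x * (u - x)) ≤ |ss f x * (u - x)| := neg_le_abs _
        _ = |ss f x| * |u - x| := abs_mul _ _
        _ ≤ s0 * (|u| + |x|) := by gcongr; exact abs_sub _ _
        _ = _ := by ring
    calc f u * Real.exp (-(2 * s0 * |u|)) ≤ (f x * Real.exp (s0 * |u| + s0 * |x|)) *
          Real.exp (-(2 * s0 * |u|)) := by
          gcongr; exact h1.trans (by gcongr)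
      _ = _ := by
        rw [mul_assoc (f x), mul_assoc (f x), ← Real.exp_add, ← Real.exp_add]; congr 2; ring
  have hD2 : D ≤ f x * Real.exp (s0 * |x|) * (2 / s0) := by
    rw [← integral_exp_abs hs0, ← integral_const_mul]
    refine integral_mono ?_ ((integrable_exp_neg_mul_abs hs0).const_mul _) key
    refine hf.mono (by fun_prop) (Eventually.of_forall fun u => ?_)
    rw [norm_mul, Real.norm_of_nonneg (Real.exp_pos _).le]
    refine mul_le_of_le_one_right (norm_nonneg _) ?_
    rw [Real.exp_le_one_iff]; have := abs_nonneg u; nlinarith [mul_nonneg hs0.le this]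
  have hF := F1_le h hi hm x
  have hA : 0 ≤ ∫ u, |u| * f u := integral_nonneg fun u => mul_nonneg (abs_nonneg _) (h.1 u)
  simp only [tau, Set.indicator_of_mem hx]
  rw [div_le_iff₀ hfx]
  refine hF.trans ?_
  rw [div_mul_eq_mul_div, div_mul_eq_mul_div, le_div_iff₀ (by positivity)]
  have : s0 * D ≤ 2 * (f x * Real.exp (s0 * |x|)) := by
    calc s0 * D ≤ s0 * (f x * Real.exp (s0 * |x|) * (2 / s0)) := by gcongr
      _ = _ := by field_simp
  calc _ ≤ (∫ u, |u| * f u) * (2 * (f x * Real.exp (s0 * |x|))) := by gcongr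
    _ = _ := by ring

lemma exists_L {f : ℝ → ℝ} (h : LC f) (hf : Integrable f) (hi : Integrable (fun u => u * f u))
    (hm : ∫ u, u * f u = 0) (hpos : 0 < ∫ u, f u) :
    ∃ L : ℝ → ℝ, Measurable L ∧ (∀ x, 1 ≤ L x) ∧ (∀ x, |x| ≤ L x) ∧ (∀ x, tau f x ≤ L x) ∧
      (∀ x, |tau' f x| ≤ L x) ∧ Integrable (fun x => L x ^ 24 * f x) := by
  have hex : ∃ x, 0 < f x := by
    by_contra hne
    push Not at hne
    have : f = 0 := funext fun x => le_antisymm (hne x) (h.1 x)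
    simp [this] at hpos
  have hfm := h.measurable
  obtain ⟨c, hc, hci⟩ := h.exp_moment hf hex
  obtain ⟨s0, hs0, rfl⟩ : ∃ s0, 0 < s0 ∧ c = 24 * s0 := ⟨c / 24, by positivity, by ring⟩
  set D := ∫ u, f u * Real.exp (-(2 * s0 * |u|)) with hDdef
  set A := ∫ u, |u| * f u with hAdef
  have hA : 0 ≤ A := integral_nonneg fun u => mul_nonneg (abs_nonneg _) (h.1 u)
  have hD : 0 < D := by
    rw [hDdef, integral_pos_iff_support_of_nonneg (fun u => mul_nonneg (h.1 u) (Real.exp_pos _).le)]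
    · rw [integral_pos_iff_support_of_nonneg h.1 hf] at hpos
      refine hpos.trans_le (measure_mono fun u hu => ?_)
      simp only [Function.mem_support] at hu ⊢
      exact mul_ne_zero hu (Real.exp_pos _).ne'
    · refine hf.mono (hfm.mul (by fun_prop)).aestronglyMeasurable (Eventually.of_forall fun u => ?_)
      rw [norm_mul, Real.norm_of_nonneg (Real.exp_pos _).le]
      refine mul_le_of_le_one_right (norm_nonneg _) ?_
      rw [Real.exp_le_one_iff]; have := abs_nonneg u; nlinarith [mul_nonneg hs0.le this]
  set Q := 2 * A / (s0 * D) with hQ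
  have hQ0 : 0 ≤ Q := by positivity
  set K := 1 + 11 / s0 + 10 / s0 ^ 2 + (1 + s0) * Q with hK
  have hE1 : ∀ x : ℝ, 1 ≤ Real.exp (s0 * |x|) := fun x => Real.one_le_exp (by positivity)
  have hEx : ∀ x : ℝ, |x| ≤ Real.exp (s0 * |x|) / s0 := fun x => by
    rw [le_div_iff₀ hs0]; have := Real.add_one_le_exp (s0 * |x|); linarith
  have hKp : 0 ≤ K := by positivity
  have ts : ∀ x ∈ JJ f, s0 < |ss f x| → tau f x * |ss f x| ≤ 2 * |x| + 8 / s0 := fun x hx hs => by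
    have hσ : 0 < |ss f x| := hs0.trans hs
    have h1 := F1_le_slope h hi hm hx (abs_pos.1 hσ)
    have hfx := JJ_pos hx
    simp only [tau, Set.indicator_of_mem hx]
    rw [div_mul_eq_mul_div, div_le_iff₀ hfx]
    calc F1 f x * |ss f x| ≤ f x * (2 * |x| / |ss f x| + 8 / |ss f x| ^ 2) * |ss f x| := by gcongr
      _ = (2 * |x| + 8 / |ss f x|) * f x := by field_simp
      _ ≤ _ := by gcongr
  have hQE : ∀ x, 0 ≤ Q * Real.exp (s0 * |x|) := fun x => by positivity
  refine ⟨fun x => K * Real.exp (s0 * |x|), by fun_prop, fun x => ?_, fun x => ?_, fun x => ?_,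
    fun x => ?_, ?_⟩
  · have : 1 ≤ K := by
      have : 0 ≤ 11 / s0 + 10 / s0 ^ 2 + (1 + s0) * Q := by positivity
      linarith
    have := hE1 x; nlinarith
  · show |x| ≤ K * Real.exp (s0 * |x|)
    refine (hEx x).trans ?_
    rw [div_eq_inv_mul]
    have : s0⁻¹ ≤ K := by
      have : 0 ≤ 1 + 10 / s0 + 10 / s0 ^ 2 + (1 + s0) * Q := by positivity
      rw [hK, ← one_div]; have e : 11 / s0 = 1 / s0 + 10 / s0 := by ring
      linarith
    gcongr
  · show tau f x ≤ K * Real.exp (s0 * |x|)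
    by_cases hx : x ∈ JJ f
    · rcases le_or_gt |ss f x| s0 with hs | hs
      · refine (tau_le_small h hf hi hm hs0 hD hx hs).trans ?_
        have : Q ≤ K := by
          have : 0 ≤ 1 + 11 / s0 + 10 / s0 ^ 2 + s0 * Q := by positivity
          rw [hK]; linarith
        gcongr
      · have h1 := ts x hx hs
        have h2 : tau f x * s0 ≤ 2 * |x| + 8 / s0 :=
          le_trans (mul_le_mul_of_nonneg_left hs.le (tau_nonneg h hi hm x)) h1
        have h3 : tau f x ≤ (2 * |x| + 8 / s0) / s0 := by rwa [le_div_iff₀ hs0]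
        refine h3.trans ?_
        have h4 := hEx x
        have h5 := hE1 x
        calc (2 * |x| + 8 / s0) / s0 ≤ (2 * (Real.exp (s0 * |x|) / s0) +
              8 * Real.exp (s0 * |x|) / s0) / s0 := by
              gcongr; linarith
          _ = 10 / s0 ^ 2 * Real.exp (s0 * |x|) := by field_simp; ring
          _ ≤ _ := by
            gcongr
            have : 0 ≤ 1 + 11 / s0 + (1 + s0) * Q := by positivity
            rw [hK]; linarith
    · simp only [tau, Set.indicator_of_notMem hx]; positivity
  · show |tau' f x| ≤ K * Real.exp (s0 * |x|)
    by_cases hx : x ∈ JJ f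
    · have hb : |tau' f x| ≤ |x| + tau f x * |ss f x| := by
        have : tau' f x = -x + tau f x * ss f x := by simp [tau, tau', hx]
        rw [this]
        refine (abs_add_le _ _).trans ?_
        rw [abs_neg, abs_mul, abs_of_nonneg (tau_nonneg h hi hm x)]
      refine hb.trans ?_
      have h4 := hEx x
      have h5 := hE1 x
      rcases le_or_gt |ss f x| s0 with hs | hs
      · have h6 := tau_le_small h hf hi hm hs0 hD hx hs
        calc |x| + tau f x * |ss f x| ≤ Real.exp (s0 * |x|) / s0 +
              (Q * Real.exp (s0 * |x|)) * s0 := by gcongr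
          _ = (1 / s0 + s0 * Q) * Real.exp (s0 * |x|) := by ring
          _ ≤ _ := by
            gcongr
            have : 0 ≤ 1 + 10 / s0 + 10 / s0 ^ 2 + Q := by positivity
            have e : 11 / s0 = 1 / s0 + 10 / s0 := by ring
            rw [hK]; linarith
      · have h1 := ts x hx hs
        calc |x| + tau f x * |ss f x| ≤ 3 * |x| + 8 / s0 := by linarith
          _ ≤ 3 * (Real.exp (s0 * |x|) / s0) + 8 * Real.exp (s0 * |x|) / s0 := by
            gcongr; linarith
          _ = 11 / s0 * Real.exp (s0 * |x|) := by ring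
          _ ≤ _ := by
            gcongr
            have : 0 ≤ 1 + 10 / s0 ^ 2 + (1 + s0) * Q := by positivity
            rw [hK]; linarith
    · simp only [tau', Set.indicator_of_notMem hx, abs_zero]; positivity
  · refine (hci.const_mul (K ^ 24)).congr (Eventually.of_forall fun x => ?_)
    have e : Real.exp (24 * s0 * |x|) = Real.exp (s0 * |x|) ^ 24 := by
      rw [← Real.exp_nat_mul]; congr 1; push_cast; rw [mul_assoc]
    simp only []
    rw [e, mul_pow, mul_assoc]

end WG


namespace WG

lemma ibp_vol {f : ℝ → ℝ} (h : LC f) (hi : Integrable (fun u => u * f u))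
    (hm : ∫ u, u * f u = 0) (hne : (JJ f).Nonempty) {G G' : ℝ → ℝ} (hGb : ∃ C, ∀ x, |G x| ≤ C)
    (hGc : ∀ x ∈ JJ f, ContinuousAt G x)
    (hGd : ∀ x ∈ JJ f, HasDerivWithinAt G (G' x) (Set.Ioi x) x)
    (hGi : Integrable (fun x => tau f x * G' x * f x)) :
    ∫ x, x * G x * f x = ∫ x, tau f x * G' x * f x := by
  obtain ⟨C, hC⟩ := hGb
  have hJo : IsOpen (JJ f) := isOpen_interior
  have hJm : MeasurableSet (JJ f) := hJo.measurableSet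
  have hJoc : (JJ f).OrdConnected := ((h.convex_gt 0).interior).ordConnected
  have : Nonempty (JJ f) := hne.to_subtype
  have hae := h.ae_zero
  obtain ⟨t, ht, htt⟩ := exists_seq_monotone_tendsto_atTop_atTop (JJ f)
  obtain ⟨s, hs, hst⟩ := exists_seq_antitone_tendsto_atTop_atBot (JJ f)
  have htu : ∀ u ∈ JJ f, ∀ᶠ k in atTop, u ≤ (t k : ℝ) := fun u hu => by
    filter_upwards [htt.eventually_ge_atTop ⟨u, hu⟩] with k hk using hk
  have hsu : ∀ u ∈ JJ f, ∀ᶠ k in atTop, (s k : ℝ) < u := fun u hu => by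
    obtain ⟨v, hv, hvJ⟩ : ∃ v, v < u ∧ v ∈ JJ f := by
      have : ∀ᶠ y in 𝓝[<] u, y ∈ JJ f := nhdsWithin_le_nhds (hJo.mem_nhds hu)
      obtain ⟨v, hv⟩ := (this.and self_mem_nhdsWithin).exists
      exact ⟨v, hv.2, hv.1⟩
    filter_upwards [hst.eventually_le_atBot ⟨v, hvJ⟩] with k hk
    exact lt_of_le_of_lt (show (s k : ℝ) ≤ v from hk) hv
  -- boundary terms
  have hF1t : Tendsto (fun k => F1 f (t k)) atTop (𝓝 0) := by
    have : Tendsto (fun k => ∫ u, (Set.Ioi (t k : ℝ)).indicator (fun u => u * f u) u) atTop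
        (𝓝 (∫ u : ℝ, (0 : ℝ))) := by
      refine tendsto_integral_of_dominated_convergence (fun u => |u * f u|)
        (fun k => (hi.aestronglyMeasurable.indicator measurableSet_Ioi)) hi.abs
        (fun k => Eventually.of_forall fun u => norm_indicator_le_norm_self _ _) ?_
      filter_upwards [hae] with u hu
      by_cases huJ : u ∈ JJ f
      · refine tendsto_const_nhds.congr' ?_
        filter_upwards [htu u huJ] with k hk
        rw [Set.indicator_of_notMem (by simpa using hk)]
      · refine tendsto_const_nhds.congr fun k => ?_
        simp [Set.indicator, hu huJ]
    simpa [integral_indicator, measurableSet_Ioi, F1] using this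
  have hF1s : Tendsto (fun k => F1 f (s k)) atTop (𝓝 0) := by
    have : Tendsto (fun k => ∫ u, (Set.Iic (s k : ℝ)).indicator (fun u => u * f u) u) atTop
        (𝓝 (∫ u : ℝ, (0 : ℝ))) := by
      refine tendsto_integral_of_dominated_convergence (fun u => |u * f u|)
        (fun k => (hi.aestronglyMeasurable.indicator measurableSet_Iic)) hi.abs
        (fun k => Eventually.of_forall fun u => norm_indicator_le_norm_self _ _) ?_
      filter_upwards [hae] with u hu
      by_cases huJ : u ∈ JJ f
      · refine tendsto_const_nhds.congr' ?_
        filter_upwards [hsu u huJ] with k hk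
        rw [Set.indicator_of_notMem (by simpa using hk)]
      · refine tendsto_const_nhds.congr fun k => ?_
        simp [Set.indicator, hu huJ]
    have h2 := this.neg
    simp only [F1_eq' hi hm]
    simpa [integral_indicator, measurableSet_Iic] using h2
  have hb : Tendsto (fun k => F1 f (t k) * G (t k) - F1 f (s k) * G (s k)) atTop (𝓝 0) := by
    have e1 : Tendsto (fun k => F1 f (t k) * G (t k)) atTop (𝓝 0) := by
      refine hF1t.zero_mul_isBoundedUnder_le ⟨C, ?_⟩
      simp only [eventually_map]
      exact Eventually.of_forall fun k => hC _
    have e2 : Tendsto (fun k => F1 f (s k) * G (s k)) atTop (𝓝 0) := by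
      refine hF1s.zero_mul_isBoundedUnder_le ⟨C, ?_⟩
      simp only [eventually_map]
      exact Eventually.of_forall fun k => hC _
    simpa using e1.sub e2
  -- integrability
  have hGm : AEStronglyMeasurable G (volume.restrict (JJ f)) :=
    ContinuousOn.aestronglyMeasurable (fun x hx => (hGc x hx).continuousWithinAt) hJm
  have hxG : IntegrableOn (fun x => x * G x * f x) (JJ f) := by
    have : IntegrableOn (fun x => (x * f x) * G x) (JJ f) :=
      Integrable.mul_bdd (c := C) hi.integrableOn hGm (Eventually.of_forall hC)
    refine this.congr (Eventually.of_forall fun x => ?_)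
    simp only []; ring
  have hfint : IntegrableOn (fun x => tau f x * G' x * f x - x * G x * f x) (JJ f) :=
    hGi.integrableOn.sub hxG
  have hfint' : IntegrableOn (fun x => -(x * f x) * G x + F1 f x * G' x) (JJ f) := by
    refine hfint.congr_fun (fun x hx => ?_) hJm
    simp only []
    rw [← tau_mul hx]; ring
  have hcov : AECover (volume.restrict (JJ f)) atTop (fun k => Set.Ioc (s k : ℝ) (t k)) := by
    refine ⟨?_, fun k => measurableSet_Ioc⟩
    rw [ae_restrict_iff' hJm]
    refine Eventually.of_forall fun x hx => ?_
    filter_upwards [htu x hx, hsu x hx] with k h1 h2 using ⟨h2, h1⟩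
  have hlim := hcov.integral_tendsto_of_countably_generated hfint'
  have hev : ∀ᶠ k in atTop, F1 f (t k) * G (t k) - F1 f (s k) * G (s k) =
      ∫ x in Set.Ioc (s k : ℝ) (t k), (-(x * f x) * G x + F1 f x * G' x)
        ∂(volume.restrict (JJ f)) := by
    obtain ⟨x0, hx0⟩ := hne
    filter_upwards [htu x0 hx0, hsu x0 hx0] with k h1 h2
    have hst' : (s k : ℝ) ≤ t k := h2.le.trans h1
    have hsub : Set.Icc (s k : ℝ) (t k) ⊆ JJ f := hJoc.out (s k).2 (t k).2
    have := intervalIntegral.integral_eq_sub_of_hasDeriv_right_of_le (f := fun x => F1 f x * G x)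
      (f' := fun x => -(x * f x) * G x + F1 f x * G' x) hst'
      (fun x hx => ((F1_continuous hi).continuousAt.mul (hGc x (hsub hx))).continuousWithinAt)
      (fun x hx => by
        have hxJ := hsub (Set.Ioo_subset_Icc_self hx)
        exact (F1_hasDerivAt h hi hm hxJ).hasDerivWithinAt.mul (hGd x hxJ))
      (by
        rw [intervalIntegrable_iff_integrableOn_Ioc_of_le hst']
        exact hfint'.mono_set (Set.Ioc_subset_Icc_self.trans hsub))
    rw [intervalIntegral.integral_of_le hst'] at this
    rw [Measure.restrict_restrict_of_subset (Set.Ioc_subset_Icc_self.trans hsub), this]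
  have h0 : ∫ x in JJ f, (-(x * f x) * G x + F1 f x * G' x) = 0 :=
    tendsto_nhds_unique (hlim.congr' (hev.mono fun k hk => hk.symm)) hb
  have h1 : ∫ x in JJ f, (tau f x * G' x * f x - x * G x * f x) = 0 := by
    rw [← h0]
    refine setIntegral_congr_fun hJm fun x hx => ?_
    rw [← tau_mul hx]; ring
  rw [integral_sub hGi.integrableOn hxG] at h1
  have e1 : ∫ x in JJ f, tau f x * G' x * f x = ∫ x, tau f x * G' x * f x :=
    setIntegral_eq_integral_of_forall_compl_eq_zero fun x hx => by simp [tau, hx]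
  have e2 : ∫ x in JJ f, x * G x * f x = ∫ x, x * G x * f x := by
    refine setIntegral_eq_integral_of_ae_compl_eq_zero ?_
    filter_upwards [hae] with x hx hxJ
    rw [hx hxJ]; ring
  linarith

structure SD (μ : Measure ℝ) (J : Set ℝ) (τ τ' L : ℝ → ℝ) : Prop where
  J_open : IsOpen J
  J_null : ∀ᵐ x ∂μ, x ∈ J
  τ_cont : ∀ x ∈ J, ContinuousAt τ x
  τ_deriv : ∀ x ∈ J, HasDerivWithinAt τ (τ' x) (Set.Ioi x) x
  τ_meas : Measurable τ
  τ'_meas : Measurable τ'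
  L_meas : Measurable L
  τ_nonneg : ∀ x, 0 ≤ τ x
  τ_le : ∀ x, τ x ≤ L x
  τ'_le : ∀ x, |τ' x| ≤ L x
  id_le : ∀ x, |x| ≤ L x
  one_le : ∀ x, 1 ≤ L x
  L_int : Integrable (fun x => L x ^ 24) μ
  mean : ∫ x, x ∂μ = 0
  var : ∫ x, x ^ 2 ∂μ = 1
  τ_mean : ∫ x, τ x ∂μ = 1
  ibp : ∀ G G' : ℝ → ℝ, (∃ C, ∀ x, |G x| ≤ C) → (∀ x ∈ J, ContinuousAt G x) →
    (∀ x ∈ J, HasDerivWithinAt G (G' x) (Set.Ioi x) x) → Integrable (fun x => τ x * G' x) μ →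
    ∫ x, x * G x ∂μ = ∫ x, τ x * G' x ∂μ

lemma exists_SD (μ : Measure ℝ) [IsProbabilityMeasure μ]
    (hmean : ∫ x, x ∂μ = 0) (hvar : ∫ x, x ^ 2 ∂μ = 1)
    {f : ℝ → ℝ} (h : LC f) (hμ : μ = volume.withDensity (fun x => ENNReal.ofReal (f x))) :
    ∃ J τ τ' L, SD μ J τ τ' L := by
  have hfm := h.measurable
  have hfm' : Measurable (fun x => ENNReal.ofReal (f x)) := hfm.ennreal_ofReal
  have hlt : ∀ᵐ x, ENNReal.ofReal (f x) < ⊤ := Eventually.of_forall fun x => ENNReal.ofReal_lt_top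
  have conv : ∀ g : ℝ → ℝ, ∫ x, g x ∂μ = ∫ x, g x * f x := fun g => by
    rw [hμ, integral_withDensity_eq_integral_toReal_smul hfm' hlt]
    refine integral_congr_ae (Eventually.of_forall fun x => ?_)
    simp [ENNReal.toReal_ofReal (h.1 x), mul_comm]
  have convi : ∀ g : ℝ → ℝ, Integrable g μ ↔ Integrable (fun x => g x * f x) := fun g => by
    rw [hμ, integrable_withDensity_iff_integrable_smul' hfm' hlt]
    refine integrable_congr (Eventually.of_forall fun x => ?_)
    simp [ENNReal.toReal_ofReal (h.1 x), mul_comm]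
  have hf : Integrable f := by
    have := (convi (fun _ => 1)).1 (integrable_const 1)
    simpa using this
  have hone : ∫ x, f x = 1 := by
    have := conv (fun _ => 1)
    simpa using this.symm
  have hx2 : Integrable (fun x : ℝ => x ^ 2) μ := by
    by_contra hh
    rw [integral_undef hh] at hvar; exact zero_ne_one hvar
  have hx1 : Integrable (fun x : ℝ => x) μ := by
    refine ((integrable_const (1:ℝ)).add hx2).mono (by fun_prop) (Eventually.of_forall fun x => ?_)
    simp only [Pi.add_apply, Real.norm_eq_abs]
    rw [abs_of_nonneg (a := 1 + x ^ 2) (by positivity)]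
    cases abs_cases x <;> nlinarith [sq_nonneg (x - 1), sq_nonneg (x + 1)]
  have hi := (convi _).1 hx1
  have hm : ∫ u, u * f u = 0 := by rw [← conv, hmean]
  obtain ⟨L, hLm, hL1, hLx, hLt, hLt', hLi⟩ := exists_L h hf hi hm (by rw [hone]; norm_num)
  have hne : (JJ f).Nonempty := by
    by_contra hne
    rw [Set.not_nonempty_iff_eq_empty] at hne
    have : ∫ x, f x = 0 := by
      refine integral_eq_zero_of_ae ?_
      filter_upwards [h.ae_zero] with x hx using hx (by simp [hne])
    rw [hone] at this; exact one_ne_zero this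
  have hLi' := (convi (fun x => L x ^ 24)).2 hLi
  have ibp : ∀ G G' : ℝ → ℝ, (∃ C, ∀ x, |G x| ≤ C) → (∀ x ∈ JJ f, ContinuousAt G x) →
    (∀ x ∈ JJ f, HasDerivWithinAt G (G' x) (Set.Ioi x) x) →
      Integrable (fun x => tau f x * G' x) μ →
    ∫ x, x * G x ∂μ = ∫ x, tau f x * G' x ∂μ := by
    intro G G' hb hc hd hi'
    rw [conv, conv]
    exact ibp_vol h hi hm hne hb hc hd ((convi _).1 hi')
  have hτi : Integrable (tau f) μ := by
    refine hLi'.mono (tau_measurable h hi).aestronglyMeasurable (Eventually.of_forall fun x => ?_)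
    rw [Real.norm_of_nonneg (tau_nonneg h hi hm x), Real.norm_of_nonneg (by have := hL1 x; positivity)]
    exact (hLt x).trans (le_self_pow₀ (hL1 x) (by norm_num))
  refine ⟨JJ f, tau f, tau' f, L, isOpen_interior, ?_, fun x hx => tau_contAt h hi hx,
    fun x hx => tau_hasDeriv h hi hm hx, tau_measurable h hi, tau'_measurable h hi, hLm,
    tau_nonneg h hi hm, hLt, hLt', hLx, hL1, hLi', hmean, hvar, ?_, ibp⟩
  · rw [hμ, ae_withDensity_iff hfm']
    filter_upwards [h.ae_zero] with x hx hne
    by_contra hxJ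
    exact hne (by simp [hx hxJ])
  · -- approximate the identity by bounded functions
    have step : ∀ k : ℕ, ∫ x, x * (x / (1 + ((k:ℝ) + 1)⁻¹ * x ^ 2)) ∂μ =
        ∫ x, tau f x * ((1 - ((k:ℝ) + 1)⁻¹ * x ^ 2) / (1 + ((k:ℝ) + 1)⁻¹ * x ^ 2) ^ 2) ∂μ := by
      intro k
      set e := ((k:ℝ) + 1)⁻¹ with he
      have he0 : 0 < e := by positivity
      have hp : ∀ x : ℝ, 0 < 1 + e * x ^ 2 := fun x => by positivity
      have hd : ∀ x : ℝ, HasDerivAt (fun x : ℝ => x / (1 + e * x ^ 2))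
          ((1 - e * x ^ 2) / (1 + e * x ^ 2) ^ 2) x := fun x => by
        have h1 : HasDerivAt (fun x : ℝ => 1 + e * x ^ 2) (e * (2 * x)) x := by
          have := ((hasDerivAt_pow 2 x).const_mul e).const_add 1
          simpa using this
        have := (hasDerivAt_id x).div h1 (hp x).ne'
        have e3 : (1 - e * x ^ 2) / (1 + e * x ^ 2) ^ 2 =
            (1 * (1 + e * x ^ 2) - id x * (e * (2 * x))) / (1 + e * x ^ 2) ^ 2 := by
          simp only [id]; congr 1; ring
        rw [e3]; exact this
      refine ibp _ _ ⟨1 + e⁻¹, fun x => ?_⟩ (fun x _ => (hd x).continuousAt)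
        (fun x _ => (hd x).hasDerivWithinAt) ?_
      · rw [abs_div, abs_of_pos (hp x), div_le_iff₀ (hp x)]
        have h1 : |x| ≤ 1 + x ^ 2 := by
          cases abs_cases x <;> nlinarith [sq_nonneg (x - 1), sq_nonneg (x + 1)]
        have : (1 + e⁻¹) * (1 + e * x ^ 2) = 1 + x ^ 2 + e⁻¹ + e * x ^ 2 := by field_simp; ring
        rw [this]
        have : 0 < e⁻¹ := by positivity
        nlinarith [mul_nonneg he0.le (sq_nonneg x)]
      · refine hτi.mul_bdd (c := 1) (Measurable.aestronglyMeasurable (by fun_prop))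
          (Eventually.of_forall fun x => ?_)
        rw [Real.norm_eq_abs, abs_div, abs_of_pos (pow_pos (hp x) 2), div_le_one (pow_pos (hp x) 2)]
        have := mul_nonneg he0.le (sq_nonneg x)
        rw [abs_le]; constructor <;> nlinarith
    have he : Tendsto (fun k : ℕ => ((k:ℝ) + 1)⁻¹) atTop (𝓝 0) := by
      simpa using tendsto_one_div_add_atTop_nhds_zero_nat (𝕜 := ℝ)
    have l1 : Tendsto (fun k : ℕ => ∫ x, x * (x / (1 + ((k:ℝ) + 1)⁻¹ * x ^ 2)) ∂μ) atTop
        (𝓝 (∫ x, x ^ 2 ∂μ)) := by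
      refine tendsto_integral_of_dominated_convergence (fun x => x ^ 2)
        (fun k => Measurable.aestronglyMeasurable (by fun_prop)) hx2 (fun k => Eventually.of_forall fun x => ?_)
        (Eventually.of_forall fun x => ?_)
      · have e0 : (0:ℝ) < ((k:ℝ) + 1)⁻¹ := by positivity
        have : x * (x / (1 + ((k:ℝ) + 1)⁻¹ * x ^ 2)) = x ^ 2 / (1 + ((k:ℝ) + 1)⁻¹ * x ^ 2) := by ring
        rw [this, Real.norm_of_nonneg (by positivity)]
        refine div_le_self (sq_nonneg x) ?_
        have := mul_nonneg e0.le (sq_nonneg x); linarith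
      · have : Tendsto (fun k : ℕ => x * (x / (1 + ((k:ℝ) + 1)⁻¹ * x ^ 2))) atTop
            (𝓝 (x * (x / (1 + 0 * x ^ 2)))) :=
          ((tendsto_const_nhds (x := x)).div ((he.mul_const (x ^ 2)).const_add 1) (by simp)).const_mul x
        simpa [pow_two] using this
    have l2 : Tendsto (fun k : ℕ => ∫ x, tau f x * ((1 - ((k:ℝ) + 1)⁻¹ * x ^ 2) /
        (1 + ((k:ℝ) + 1)⁻¹ * x ^ 2) ^ 2) ∂μ) atTop (𝓝 (∫ x, tau f x ∂μ)) := by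
      have := tau_measurable h hi
      refine tendsto_integral_of_dominated_convergence (tau f)
        (fun k => Measurable.aestronglyMeasurable (by fun_prop)) hτi (fun k => Eventually.of_forall fun x => ?_)
        (Eventually.of_forall fun x => ?_)
      · have e0 : (0:ℝ) < ((k:ℝ) + 1)⁻¹ := by positivity
        rw [norm_mul, Real.norm_of_nonneg (tau_nonneg h hi hm x)]
        refine mul_le_of_le_one_right (tau_nonneg h hi hm x) ?_
        have hp : 0 < 1 + ((k:ℝ) + 1)⁻¹ * x ^ 2 := by positivity
        rw [Real.norm_eq_abs, abs_div, abs_of_pos (pow_pos hp 2), div_le_one (pow_pos hp 2)]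
        have := mul_nonneg e0.le (sq_nonneg x)
        rw [abs_le]; constructor <;> nlinarith
      · have : Tendsto (fun k : ℕ => tau f x * ((1 - ((k:ℝ) + 1)⁻¹ * x ^ 2) /
            (1 + ((k:ℝ) + 1)⁻¹ * x ^ 2) ^ 2)) atTop
            (𝓝 (tau f x * ((1 - 0 * x ^ 2) / (1 + 0 * x ^ 2) ^ 2))) :=
          (((he.mul_const (x ^ 2)).const_sub 1).div
            (((he.mul_const (x ^ 2)).const_add 1).pow 2) (by simp)).const_mul _
        simpa using this
    rw [← hvar]
    exact (tendsto_nhds_unique (l1.congr step) l2).symm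

end WG


namespace WG

section resample
variable {ι : Type*} [Fintype ι] [DecidableEq ι] {α : ι → Type*} [∀ i, MeasurableSpace (α i)]
  (μ : ∀ i, Measure (α i)) [∀ i, IsProbabilityMeasure (μ i)]

lemma resample (i : ι) : MeasurePreserving (fun q : (∀ i, α i) × α i => Function.update q.1 i q.2)
    ((Measure.pi μ).prod (μ i)) (Measure.pi μ) := by
  have hm : Measurable (fun q : (∀ i, α i) × α i => Function.update q.1 i q.2) :=
    measurable_update'
  refine ⟨hm, ?_⟩
  symm
  refine Measure.pi_eq fun s hs => ?_
  rw [Measure.map_apply hm (MeasurableSet.univ_pi hs)]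
  have : (fun q : (∀ i, α i) × α i => Function.update q.1 i q.2) ⁻¹' Set.pi Set.univ s =
      (Set.pi Set.univ (Function.update s i Set.univ)) ×ˢ s i := by
    ext ⟨x, t⟩
    simp only [Set.mem_preimage, Set.mem_pi, Set.mem_univ, true_implies, Set.mem_prod]
    constructor
    · intro h
      refine ⟨fun j => ?_, by simpa using h i⟩
      by_cases hj : j = i
      · subst hj; simp
      · simpa [hj] using h j
    · rintro ⟨h1, h2⟩ j
      by_cases hj : j = i
      · subst hj; simpa using h2
      · simpa [hj] using h1 j
  rw [this, Measure.prod_prod, Measure.pi_pi]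
  rw [← Finset.mul_prod_erase _ _ (Finset.mem_univ i), ← Finset.mul_prod_erase _ (fun j => μ j (s j)) (Finset.mem_univ i)]
  simp only [Function.update_self, measure_univ, one_mul]
  rw [mul_comm]
  congr 1
  refine Finset.prod_congr rfl fun j hj => ?_
  rw [Function.update_of_ne (Finset.ne_of_mem_erase hj)]

lemma integral_resample (i : ι) {F : (∀ i, α i) → ℝ} (hF : Integrable F (Measure.pi μ)) :
    ∫ x, F x ∂(Measure.pi μ) = ∫ x, ∫ t, F (Function.update x i t) ∂(μ i) ∂(Measure.pi μ) := by
  have h := resample μ i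
  have h2 : Integrable (fun q : (∀ i, α i) × α i => F (Function.update q.1 i q.2))
    ((Measure.pi μ).prod (μ i)) := h.integrable_comp_of_integrable hF
  rw [← integral_prod (fun q : (∀ i, α i) × α i => F (Function.update q.1 i q.2)) h2]
  conv_lhs => rw [← h.map_eq]
  rw [integral_map h.measurable.aemeasurable]
  rw [h.map_eq]; exact hF.aestronglyMeasurable

end resample

section nested
variable {ι κ : Type*} [Fintype ι] [DecidableEq ι] [Fintype κ] [DecidableEq κ] (μ : Measure ℝ)
  [IsProbabilityMeasure μ]

/-- law of a `κ`-family of iid `ι`-vectors -/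
noncomputable def PP (ι κ : Type*) [Fintype ι] [Fintype κ] (μ : Measure ℝ) :
    Measure (κ → ι → ℝ) :=
  Measure.pi fun _ : κ => Measure.pi fun _ : ι => μ

instance : IsProbabilityMeasure (PP ι κ μ) := by unfold PP; infer_instance

/-- update of one entry -/
def upd (X : κ → ι → ℝ) (l : κ) (p : ι) (t : ℝ) : κ → ι → ℝ :=
  Function.update X l (Function.update (X l) p t)

lemma upd_apply (X : κ → ι → ℝ) (l : κ) (p : ι) (t : ℝ) (l' : κ) (p' : ι) :
    upd X l p t l' p' = if l' = l ∧ p' = p then t else X l' p' := by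
  unfold upd
  by_cases h : l' = l
  · subst h
    by_cases h2 : p' = p
    · subst h2; simp
    · simp [h2]
  · simp [h]

lemma measurable_upd (l : κ) (p : ι) :
    Measurable (fun q : (κ → ι → ℝ) × ℝ => upd q.1 l p q.2) := by
  refine measurable_pi_lambda _ fun l' => measurable_pi_lambda _ fun p' => ?_
  simp only [upd_apply]
  split_ifs
  · exact measurable_snd
  · fun_prop

lemma resample2 (l : κ) (p : ι) : MeasurePreserving
    (fun q : (κ → ι → ℝ) × ℝ => upd q.1 l p q.2) ((PP ι κ μ).prod μ) (PP ι κ μ) := by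
  have h1 := resample (fun _ : κ => Measure.pi fun _ : ι => μ) l
  have h2 := resample (fun _ : ι => μ) p
  refine ⟨measurable_upd l p, ?_⟩
  change Measure.map _ ((Measure.pi _).prod _) = Measure.pi _
  have e1 := (h1.prod (MeasurePreserving.id μ)).map_eq
  rw [← e1, Measure.map_map (measurable_upd l p) (h1.prod (MeasurePreserving.id μ)).measurable]
  have h3 := h1.comp ((MeasurePreserving.id
    (Measure.pi fun _ : κ => Measure.pi fun _ : ι => μ)).prod h2)
  have h4 := h3.comp (measurePreserving_prodAssoc (Measure.pi fun _ : κ => Measure.pi fun _ : ι => μ)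
    (Measure.pi fun _ : ι => μ) μ)
  refine Eq.trans ?_ h4.map_eq
  congr 1
  ext ⟨⟨X, y⟩, t⟩ l' p'
  simp [upd, MeasurableEquiv.prodAssoc]

lemma integral_resample2 (l : κ) (p : ι) {F : (κ → ι → ℝ) → ℝ} (hF : Integrable F (PP ι κ μ)) :
    ∫ x, F x ∂(PP ι κ μ) = ∫ x, ∫ t, F (upd x l p t) ∂μ ∂(PP ι κ μ) := by
  have h := resample2 (ι := ι) (κ := κ) μ l p
  have h2 : Integrable (fun q : (κ → ι → ℝ) × ℝ => F (upd q.1 l p q.2))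
    ((PP ι κ μ).prod μ) := h.integrable_comp_of_integrable hF
  rw [← integral_prod (fun q : (κ → ι → ℝ) × ℝ => F (upd q.1 l p q.2)) h2]
  conv_lhs => rw [← h.map_eq]
  rw [integral_map h.measurable.aemeasurable]
  rw [h.map_eq]; exact hF.aestronglyMeasurable

lemma ae_integrable_upd (l : κ) (p : ι) {F : (κ → ι → ℝ) → ℝ} (hF : Integrable F (PP ι κ μ)) :
    ∀ᵐ x ∂(PP ι κ μ), Integrable (fun t => F (upd x l p t)) μ := by
  have h := resample2 (ι := ι) (κ := κ) μ l p
  have h2 : Integrable (fun q : (κ → ι → ℝ) × ℝ => F (upd q.1 l p q.2))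
    ((PP ι κ μ).prod μ) := h.integrable_comp_of_integrable hF
  exact h2.prod_right_ae

lemma PP_swap : Measure.map (fun X : κ → ι → ℝ => fun i k => X k i) (PP ι κ μ) = PP κ ι μ := by
  unfold PP
  have h1 := Measure.infinitePi_map_curry (ι := κ) (κ := ι) (X := ℝ) (fun _ _ => μ)
  have h2 := Measure.infinitePi_map_curry (ι := ι) (κ := κ) (X := ℝ) (fun _ _ => μ)
  simp only [Measure.infinitePi_eq_pi] at h1 h2
  rw [← h1, ← h2, Measure.map_map (by fun_prop) (by fun_prop)]
  have h3 := measurePreserving_piCongrLeft (fun _ : κ × ι => μ) (Equiv.prodComm ι κ)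
  rw [← h3.map_eq]
  rw [Measure.map_map (by fun_prop) (by fun_prop)]
  congr 1

end nested

section gauss
/-- one-dimensional Gaussian integration by parts -/
lemma gauss_ibp1 {F F' : ℝ → ℝ} {C C' : ℝ} (hF : ∀ x, HasDerivAt F (F' x) x) (hb : ∀ x, |F x| ≤ C)
    (hb' : ∀ x, |F' x| ≤ C') (hm' : Measurable F') :
    ∫ t, t * F t ∂(gaussianReal 0 1) = ∫ t, F' t ∂(gaussianReal 0 1) := by
  have hd : ∀ x : ℝ, HasDerivAt (gaussianPDFReal 0 1) (-(x * gaussianPDFReal 0 1 x)) x := fun x => by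
    have h1 : HasDerivAt (fun x : ℝ => -x ^ 2 / 2) (-x) x := by
      have := ((hasDerivAt_pow 2 x).neg).div_const 2
      refine this.congr_deriv ?_
      simp; ring
    have h2 := (h1.exp).const_mul ((√(2 * Real.pi * (1 : NNReal)))⁻¹)
    have e : gaussianPDFReal 0 1 = fun x => (√(2 * Real.pi * (1 : NNReal)))⁻¹ * Real.exp (-x ^ 2 / 2) := by
      ext x; simp [gaussianPDFReal]
    rw [e]
    refine h2.congr_deriv ?_
    simp; ring
  have hFc : Measurable F := (continuous_iff_continuousAt.2 fun x => (hF x).continuousAt).measurable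
  have hid : Integrable (fun t : ℝ => t) (gaussianReal 0 1) :=
    (memLp_id_gaussianReal (μ := 0) (v := 1) 1).integrable (by simp)
  have conv : ∀ g : ℝ → ℝ, ∫ x, g x ∂(gaussianReal 0 1) = ∫ x, gaussianPDFReal 0 1 x * g x := fun g => by
    rw [integral_gaussianReal_eq_integral_smul (by norm_num)]; simp
  have convi : ∀ g : ℝ → ℝ, Integrable g (gaussianReal 0 1) → Integrable (fun x => gaussianPDFReal 0 1 x * g x) := fun g hg => by
    rw [gaussianReal_of_var_ne_zero 0 (by norm_num), integrable_withDensity_iff_integrable_smul'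
      (measurable_gaussianPDF 0 1) (Eventually.of_forall fun x => gaussianPDF_lt_top)] at hg
    simpa [toReal_gaussianPDF] using hg
  have hpdf := integrable_gaussianPDFReal 0 1
  have i1 : Integrable (fun x => gaussianPDFReal 0 1 x * (x * F x)) :=
    convi _ (hid.mul_bdd (c := C) hFc.aestronglyMeasurable (Eventually.of_forall hb))
  have key := integral_mul_deriv_eq_deriv_mul_of_integrable (u := F) (v := gaussianPDFReal 0 1)
    (u' := F') (v' := fun x => -(x * gaussianPDFReal 0 1 x)) (fun x _ => hF x) (fun x _ => hd x)
    (by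
      refine i1.neg.congr (Eventually.of_forall fun x => ?_)
      simp only [Pi.neg_apply, Pi.mul_apply]; ring)
    (hpdf.bdd_mul (c := C') hm'.aestronglyMeasurable (Eventually.of_forall hb'))
    (hpdf.bdd_mul (c := C) hFc.aestronglyMeasurable (Eventually.of_forall hb))
  rw [conv, conv]
  have e1 : ∫ x, gaussianPDFReal 0 1 x * (x * F x) = - ∫ x, F x * -(x * gaussianPDFReal 0 1 x) := by
    rw [← integral_neg]; congr 1; ext x; ring
  rw [e1, key, neg_neg]
  congr 1; ext x; ring

lemma gauss_ibp {ι : Type*} [Fintype ι] [DecidableEq ι] {F : (ι → ℝ) → ℝ} (hF : ContDiff ℝ 1 F)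
    {C C' : ℝ} (hb : ∀ x, |F x| ≤ C) (hb' : ∀ x, ‖fderiv ℝ F x‖ ≤ C') (k : ι) :
    ∫ g, g k * F g ∂(Measure.pi fun _ : ι => gaussianReal 0 1) =
    ∫ g, fderiv ℝ F g (Pi.single k 1) ∂(Measure.pi fun _ : ι => gaussianReal 0 1) := by
  have hid : Integrable (fun t : ℝ => t) (gaussianReal 0 1) :=
    (memLp_id_gaussianReal (μ := 0) (v := 1) 1).integrable (by simp)
  have hd : ∀ v, Continuous (fun g => fderiv ℝ F g v) := fun v =>
    (hF.continuous_fderiv (by norm_num)).clm_apply continuous_const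
  have hb1 : ∀ g, |fderiv ℝ F g (Pi.single k 1)| ≤ C' := fun g => by
    have := (fderiv ℝ F g).le_opNorm (Pi.single k 1)
    rw [Pi.norm_single] at this
    simp only [norm_one, mul_one] at this
    exact this.trans (hb' g)
  have j1 : Integrable (fun g => fderiv ℝ F g (Pi.single k 1))
      (Measure.pi fun _ : ι => gaussianReal 0 1) :=
    Integrable.of_bound (hd _).aestronglyMeasurable C' (Eventually.of_forall hb1)
  have j2 : Integrable (fun g => g k * F g) (Measure.pi fun _ : ι => gaussianReal 0 1) := by
    refine Integrable.mul_bdd (c := C) ?_ hF.continuous.aestronglyMeasurable (Eventually.of_forall hb)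
    exact (measurePreserving_eval (fun _ : ι => gaussianReal 0 1) k).integrable_comp_of_integrable hid
  rw [integral_resample _ k j1, integral_resample _ k j2]
  · congr 1; ext g
    have hu : ∀ t, HasDerivAt (fun t => Function.update g k t) (Pi.single k (1:ℝ)) t := fun t =>
      hasDerivAt_update g k t
    simp only [Function.update_self]
    refine gauss_ibp1 (C := C) (C' := C') (fun t => ?_) (fun t => hb _) (fun t => hb1 _) ?_
    · exact ((hF.differentiable (by norm_num)) _).hasFDerivAt.comp_hasDerivAt t (hu t)
    · have : Measurable (fun t => Function.update g k t) := measurable_update _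
      exact (hd _).measurable.comp this
end gauss

end WG


namespace WG

lemma clm_pi_sum {ι : Type*} [Fintype ι] [DecidableEq ι] (T : (ι → ℝ) →L[ℝ] ℝ) (v : ι → ℝ) :
    T v = ∑ k, v k * T (Pi.single k 1) := by
  conv_lhs => rw [show v = ∑ k, v k • (Pi.single k (1:ℝ) : ι → ℝ) by
    ext j; simp [Finset.sum_apply, Pi.single_apply]]
  rw [map_sum]; simp

lemma fderiv_affine {ι : Type*} [Fintype ι] {ψ : (ι → ℝ) → ℝ} (hψ : ContDiff ℝ 1 ψ) (a : ℝ)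
    (b : ι → ℝ) (w : ι → ℝ) :
    fderiv ℝ (fun w => ψ (a • w + b)) w = a • fderiv ℝ ψ (a • w + b) := by
  have h1 := (hψ.differentiable (by norm_num) (a • w + b)).hasFDerivAt
  have h2 : HasFDerivAt (fun w : ι → ℝ => a • w + b) (a • ContinuousLinearMap.id ℝ (ι → ℝ)) w :=
    ((hasFDerivAt_id w).const_smul a).add_const b
  have h3 := (h1.comp w h2).fderiv
  have : (ψ ∘ fun w : ι → ℝ => a • w + b) = fun w => ψ (a • w + b) := rfl
  rw [this] at h3
  rw [h3]; ext v; simp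

section tv
variable {Ω : Type*} [MeasurableSpace Ω] (P : Measure Ω) [IsProbabilityMeasure P]
  {ι : Type*} [Fintype ι] [DecidableEq ι] (W V : Ω → ι → ℝ) (χ : Ω → ℝ)

structure TVHyp : Prop where
  hW : Measurable W
  hV : Measurable V
  hχ : Measurable χ
  χ0 : ∀ ω, 0 ≤ χ ω
  χ1 : ∀ ω, χ ω ≤ 1
  hWi : ∀ k, Integrable (fun ω => W ω k) P
  hVi : ∀ k, Integrable (fun ω => V ω k ^ 2) P
  hid : ∀ k, ∀ h : (ι → ℝ) → ℝ, ContDiff ℝ 1 h → (∃ C, ∀ w, |h w| ≤ C) →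
    (∃ C, ∀ w, ‖fderiv ℝ h w‖ ≤ C) →
    ∫ ω, V ω k * h (W ω) ∂P = ∫ ω, χ ω * fderiv ℝ h (W ω) (Pi.single k 1) ∂P -
      ∫ ω, χ ω * W ω k * h (W ω) ∂P

noncomputable abbrev gam (ι : Type*) [Fintype ι] : Measure (ι → ℝ) :=
  Measure.pi fun _ : ι => gaussianReal 0 1

lemma integrable_gam (k : ι) : Integrable (fun g : ι → ℝ => g k) (gam ι) := by
  have hid : Integrable (fun t : ℝ => t) (gaussianReal 0 1) :=
    (memLp_id_gaussianReal (μ := 0) (v := 1) 1).integrable (by simp)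
  exact (measurePreserving_eval (fun _ : ι => gaussianReal 0 1) k).integrable_comp_of_integrable hid

lemma gam_second (k k' : ι) : Integrable (fun g : ι → ℝ => g k * g k') (gam ι) ∧
    ∫ g, g k * g k' ∂(gam ι) = if k = k' then 1 else 0 := by
  have hid2 : Integrable (fun t : ℝ => t ^ 2) (gaussianReal 0 1) :=
    (memLp_id_gaussianReal (μ := 0) (v := 1) 2).integrable_sq
  have hk2 : ∀ k : ι, Integrable (fun g : ι → ℝ => g k ^ 2) (gam ι) := fun k =>
    (measurePreserving_eval (fun _ : ι => gaussianReal 0 1) k).integrable_comp_of_integrable hid2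
  have hI : Integrable (fun g : ι → ℝ => g k * g k') (gam ι) := by
    refine ((hk2 k).add (hk2 k')).mono (by fun_prop) (Eventually.of_forall fun g => ?_)
    simp only [Pi.add_apply, Real.norm_eq_abs]
    rw [abs_of_nonneg (a := g k ^ 2 + g k' ^ 2) (by positivity), abs_le]
    constructor <;> nlinarith [sq_nonneg (g k - g k'), sq_nonneg (g k + g k')]
  refine ⟨hI, ?_⟩
  split_ifs with h
  · subst h
    have e : ∫ g, g k * g k ∂(gam ι) = ∫ t, t ^ 2 ∂(gaussianReal 0 1) := by
      rw [← (measurePreserving_eval (fun _ : ι => gaussianReal 0 1) k).map_eq, integral_map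
        (measurable_pi_apply k).aemeasurable (by fun_prop)]
      simp [pow_two]
    rw [e]
    have h1 := variance_fun_id_gaussianReal (μ := 0) (v := 1)
    rw [variance_eq_integral (by fun_prop)] at h1
    simpa using h1
  · rw [integral_resample _ k hI]
    have : ∀ g : ι → ℝ, ∫ t, Function.update g k t k * Function.update g k t k' ∂(gaussianReal 0 1) = 0 := by
      intro g
      simp only [Function.update_self, Function.update_of_ne (Ne.symm h)]
      rw [integral_mul_const, integral_id_gaussianReal]; simp
    simp only [this, integral_zero]

variable {P W V χ}

lemma TVHyp.V_int (H : TVHyp P W V χ) (k : ι) : Integrable (fun ω => V ω k) P := by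
  have hm : Measurable (fun ω => V ω k) := (measurable_pi_apply k).comp H.hV
  refine ((integrable_const (1:ℝ)).add (H.hVi k)).mono hm.aestronglyMeasurable
    (Eventually.of_forall fun ω => ?_)
  simp only [Pi.add_apply, Real.norm_eq_abs]
  rw [abs_of_nonneg (a := 1 + V ω k ^ 2) (by positivity), abs_le]
  constructor <;> nlinarith [sq_nonneg (V ω k - 1), sq_nonneg (V ω k + 1)]

lemma TVHyp.deriv_eq (H : TVHyp P W V χ) {ψ : (ι → ℝ) → ℝ} (hψ : ContDiff ℝ 1 ψ) {C C' : ℝ}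
    (hb : ∀ x, |ψ x| ≤ C) (hb' : ∀ x, ‖fderiv ℝ ψ x‖ ≤ C') (a b : ℝ) (k : ι) :
    ∫ q : Ω × (ι → ℝ), V q.1 k * q.2 k * ψ (a • W q.1 + b • q.2) ∂(P.prod (gam ι)) =
    ∫ q : Ω × (ι → ℝ), χ q.1 * (fderiv ℝ ψ (a • W q.1 + b • q.2) (Pi.single k 1) *
      (-b * W q.1 k + a * q.2 k)) ∂(P.prod (gam ι)) := by
  have hW := H.hW; have hV := H.hV; have hχ := H.hχ
  have hχb : ∀ ω, ‖χ ω‖ ≤ 1 := fun ω => by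
    rw [Real.norm_of_nonneg (H.χ0 ω)]; exact H.χ1 ω
  have hψc : Continuous ψ := hψ.continuous
  have hψm : Measurable ψ := hψc.measurable
  have hdc : Continuous (fun g => fderiv ℝ ψ g (Pi.single k 1)) :=
    (hψ.continuous_fderiv (by norm_num)).clm_apply continuous_const
  have hdm : Measurable (fun g => fderiv ℝ ψ g (Pi.single k 1)) := hdc.measurable
  have hb1 : ∀ g, |fderiv ℝ ψ g (Pi.single k 1)| ≤ C' := fun g => by
    have := (fderiv ℝ ψ g).le_opNorm (Pi.single k 1)
    rw [Pi.norm_single] at this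
    simp only [norm_one, mul_one] at this
    exact this.trans (hb' g)
  have hsm : Measurable (fun q : Ω × (ι → ℝ) => a • W q.1 + b • q.2) := by fun_prop
  have hψm2 : AEStronglyMeasurable (fun q : Ω × (ι → ℝ) => ψ (a • W q.1 + b • q.2)) (P.prod (gam ι)) :=
    (hψm.comp hsm).aestronglyMeasurable
  have hdm2 : AEStronglyMeasurable (fun q : Ω × (ι → ℝ) =>
      fderiv ℝ ψ (a • W q.1 + b • q.2) (Pi.single k 1)) (P.prod (gam ι)) :=
    (hdm.comp hsm).aestronglyMeasurable
  have hWk : Measurable (fun ω => W ω k) := (measurable_pi_apply k).comp hW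
  have hχW : Integrable (fun ω => χ ω * W ω k) P :=
    (H.hWi k).bdd_mul (c := 1) hχ.aestronglyMeasurable (Eventually.of_forall hχb)
  have hχi : Integrable χ P := Integrable.of_bound hχ.aestronglyMeasurable 1 (Eventually.of_forall hχb)
  have hgk := integrable_gam (ι := ι) k
  have i1 : Integrable (fun q : Ω × (ι → ℝ) => V q.1 k * q.2 k * ψ (a • W q.1 + b • q.2))
      (P.prod (gam ι)) :=
    ((H.V_int k).mul_prod hgk).mul_bdd (c := C) hψm2 (Eventually.of_forall fun q => hb _)
  have i2 : Integrable (fun q : Ω × (ι → ℝ) => χ q.1 * q.2 k *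
      fderiv ℝ ψ (a • W q.1 + b • q.2) (Pi.single k 1)) (P.prod (gam ι)) :=
    (hχi.mul_prod hgk).mul_bdd (c := C') hdm2 (Eventually.of_forall fun q => hb1 _)
  have i3 : Integrable (fun q : Ω × (ι → ℝ) => χ q.1 * W q.1 k * q.2 k *
      ψ (a • W q.1 + b • q.2)) (P.prod (gam ι)) :=
    (hχW.mul_prod hgk).mul_bdd (c := C) hψm2 (Eventually.of_forall fun q => hb _)
  have i4 : Integrable (fun q : Ω × (ι → ℝ) => χ q.1 * W q.1 k *
      fderiv ℝ ψ (a • W q.1 + b • q.2) (Pi.single k 1)) (P.prod (gam ι)) :=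
    ((hχW.comp_fst (gam ι))).mul_bdd (c := C') hdm2 (Eventually.of_forall fun q => hb1 _)
  have e3 : ∫ q : Ω × (ι → ℝ), χ q.1 * W q.1 k * q.2 k * ψ (a • W q.1 + b • q.2) ∂(P.prod (gam ι))
      = b * ∫ q : Ω × (ι → ℝ), χ q.1 * W q.1 k *
      fderiv ℝ ψ (a • W q.1 + b • q.2) (Pi.single k 1) ∂(P.prod (gam ι)) := by
    rw [integral_prod _ i3, integral_prod _ i4, ← integral_const_mul]
    congr 1; ext ω
    simp only []
    have h1 : ContDiff ℝ 1 (fun g : ι → ℝ => ψ (b • g + a • W ω)) := by fun_prop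
    have h2 := gauss_ibp h1 (C := C) (C' := |b| * C') (fun x => hb _) (fun x => by
      rw [fderiv_affine hψ, norm_smul]
      have := hb' (b • x + a • W ω)
      rw [Real.norm_eq_abs]; gcongr) k
    simp only [fderiv_affine hψ, smul_apply, smul_eq_mul] at h2
    simp only [mul_assoc, integral_const_mul]
    rw [integral_const_mul] at h2
    simp only [add_comm (a • W ω)]
    rw [h2]; ring
  have e1 : ∫ q : Ω × (ι → ℝ), V q.1 k * q.2 k * ψ (a • W q.1 + b • q.2) ∂(P.prod (gam ι)) =
      a * (∫ q : Ω × (ι → ℝ), χ q.1 * q.2 k *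
      fderiv ℝ ψ (a • W q.1 + b • q.2) (Pi.single k 1) ∂(P.prod (gam ι))) -
      ∫ q : Ω × (ι → ℝ), χ q.1 * W q.1 k * q.2 k * ψ (a • W q.1 + b • q.2) ∂(P.prod (gam ι)) := by
    rw [integral_prod_symm _ i1, integral_prod_symm _ i2, integral_prod_symm _ i3,
      ← integral_const_mul, ← integral_sub (i2.integral_prod_right.const_mul a) i3.integral_prod_right]
    congr 1; ext g
    simp only []
    have h1 : ContDiff ℝ 1 (fun w : ι → ℝ => ψ (a • w + b • g)) := by fun_prop
    have h2 := H.hid k (fun w : ι → ℝ => ψ (a • w + b • g)) h1 ⟨C, fun w => hb _⟩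
      ⟨|a| * C', fun w => by
        rw [fderiv_affine hψ, norm_smul]
        have := hb' (a • w + b • g)
        rw [Real.norm_eq_abs]; gcongr⟩
    simp only [fderiv_affine hψ, smul_apply, smul_eq_mul] at h2
    have r1 : ∀ ω, V ω k * g k * ψ (a • W ω + b • g) = g k * (V ω k * ψ (a • W ω + b • g)) :=
      fun ω => by ring
    have r2 : ∀ ω, χ ω * g k * fderiv ℝ ψ (a • W ω + b • g) (Pi.single k 1) =
      g k * (χ ω * fderiv ℝ ψ (a • W ω + b • g) (Pi.single k 1)) :=
      fun ω => by ring
    have r3 : ∀ ω, χ ω * W ω k * g k * ψ (a • W ω + b • g) =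
      g k * (χ ω * W ω k * ψ (a • W ω + b • g)) := fun ω => by ring
    have r4 : ∀ ω, χ ω * (a * fderiv ℝ ψ (a • W ω + b • g) (Pi.single k 1)) =
      a * (χ ω * fderiv ℝ ψ (a • W ω + b • g) (Pi.single k 1)) :=
      fun ω => by ring
    simp only [r1, r2, r3, integral_const_mul]
    simp only [r4, integral_const_mul] at h2
    rw [h2]; ring
  rw [e1, e3, ← integral_const_mul, ← integral_const_mul,
    ← integral_sub (i2.const_mul a) (i4.const_mul b)]
  congr 1; ext q; ring

lemma sq_integral_le' {α : Type*} [MeasurableSpace α] (Q : Measure α) [IsProbabilityMeasure Q]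
    {Z : α → ℝ} (hZ : Integrable Z Q) (hZ2 : Integrable (fun a => Z a ^ 2) Q) :
    (∫ a, Z a ∂Q) ^ 2 ≤ ∫ a, Z a ^ 2 ∂Q := by
  set m := ∫ a, Z a ∂Q
  have h : 0 ≤ ∫ a, (Z a - m) ^ 2 ∂Q := integral_nonneg fun a => sq_nonneg _
  have e : ∀ a, (Z a - m) ^ 2 = Z a ^ 2 - 2 * m * Z a + m ^ 2 := fun a => by ring
  simp only [e] at h
  have i1 : Integrable (fun a => Z a ^ 2 - 2 * m * Z a) Q := hZ2.sub (hZ.const_mul _)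
  rw [integral_add i1 (integrable_const _), integral_sub hZ2 (hZ.const_mul _),
    integral_const_mul] at h
  simp only [integral_const, probReal_univ, one_smul] at h
  nlinarith

lemma TVHyp.bound (H : TVHyp P W V χ) {ψ : (ι → ℝ) → ℝ} (hψ : ContDiff ℝ 1 ψ)
    (hb : ∀ x, |ψ x| ≤ 1) (a b : ℝ) :
    |∫ q : Ω × (ι → ℝ), (∑ k, V q.1 k * q.2 k) * ψ (a • W q.1 + b • q.2) ∂(P.prod (gam ι))| ≤
      √(∑ k, ∫ ω, V ω k ^ 2 ∂P) := by
  have hW := H.hW; have hV := H.hV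
  have hVk : ∀ k, Measurable (fun ω => V ω k) := fun k => (measurable_pi_apply k).comp hV
  have hsm : Measurable (fun q : Ω × (ι → ℝ) => a • W q.1 + b • q.2) := by fun_prop
  have hψm2 : AEStronglyMeasurable (fun q : Ω × (ι → ℝ) => ψ (a • W q.1 + b • q.2)) (P.prod (gam ι)) :=
    (hψ.continuous.measurable.comp hsm).aestronglyMeasurable
  have hZ : Integrable (fun q : Ω × (ι → ℝ) => ∑ k, V q.1 k * q.2 k) (P.prod (gam ι)) :=
    integrable_finsetSum _ fun k _ => (H.V_int k).mul_prod (integrable_gam k)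
  have hVV : ∀ k k', Integrable (fun ω => V ω k * V ω k') P := fun k k' => by
    refine ((H.hVi k).add (H.hVi k')).mono ((hVk k).mul (hVk k')).aestronglyMeasurable
      (Eventually.of_forall fun g => ?_)
    simp only [Pi.add_apply, Real.norm_eq_abs]
    rw [abs_of_nonneg (a := V g k ^ 2 + V g k' ^ 2) (by positivity), abs_le]
    constructor <;> nlinarith [sq_nonneg (V g k - V g k'), sq_nonneg (V g k + V g k')]
  have e0 : ∀ q : Ω × (ι → ℝ), (∑ k, V q.1 k * q.2 k) ^ 2 =
      ∑ k, ∑ k', (V q.1 k * V q.1 k') * (q.2 k * q.2 k') := fun q => by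
    rw [pow_two, Finset.sum_mul_sum]
    refine Finset.sum_congr rfl fun k _ => Finset.sum_congr rfl fun k' _ => by ring
  have hT : ∀ k k', Integrable (fun q : Ω × (ι → ℝ) => (V q.1 k * V q.1 k') * (q.2 k * q.2 k'))
      (P.prod (gam ι)) := fun k k' => (hVV k k').mul_prod (gam_second k k').1
  have hZ2 : Integrable (fun q : Ω × (ι → ℝ) => (∑ k, V q.1 k * q.2 k) ^ 2) (P.prod (gam ι)) := by
    simp only [e0]
    exact integrable_finsetSum _ fun k _ => integrable_finsetSum _ fun k' _ => hT k k'
  have hZ2v : ∫ q : Ω × (ι → ℝ), (∑ k, V q.1 k * q.2 k) ^ 2 ∂(P.prod (gam ι)) =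
      ∑ k, ∫ ω, V ω k ^ 2 ∂P := by
    simp only [e0]
    rw [integral_finsetSum _ fun k _ => integrable_finsetSum _ fun k' _ => hT k k']
    refine Finset.sum_congr rfl fun k _ => ?_
    rw [integral_finsetSum _ fun k' _ => hT k k']
    have : ∀ k', ∫ q : Ω × (ι → ℝ), (V q.1 k * V q.1 k') * (q.2 k * q.2 k') ∂(P.prod (gam ι)) =
        (∫ ω, V ω k * V ω k' ∂P) * if k = k' then 1 else 0 := fun k' => by
      rw [integral_prod_mul (fun ω => V ω k * V ω k') (fun g : ι → ℝ => g k * g k'),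
        (gam_second k k').2]
    simp [this, pow_two]
  have hsq : ∀ q : Ω × (ι → ℝ), ((∑ k, V q.1 k * q.2 k) * ψ (a • W q.1 + b • q.2)) ^ 2 ≤
      (∑ k, V q.1 k * q.2 k) ^ 2 := fun q => by
    rw [mul_pow]
    refine mul_le_of_le_one_right (sq_nonneg _) ?_
    rw [← sq_abs]; exact pow_le_one₀ (abs_nonneg _) (hb _)
  have hY := hZ.mul_bdd (c := 1) hψm2 (Eventually.of_forall fun q => hb _)
  have hY2 : Integrable (fun q : Ω × (ι → ℝ) => ((∑ k, V q.1 k * q.2 k) *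
      ψ (a • W q.1 + b • q.2)) ^ 2) (P.prod (gam ι)) := by
    refine hZ2.mono (hY.aestronglyMeasurable.pow 2) (Eventually.of_forall fun q => ?_)
    rw [Real.norm_of_nonneg (sq_nonneg _), Real.norm_of_nonneg (sq_nonneg _)]
    exact hsq q
  refine Real.abs_le_sqrt ((sq_integral_le' _ hY hY2).trans ?_)
  rw [← hZ2v]
  exact integral_mono hY2 hZ2 hsq

lemma TVHyp.smooth (H : TVHyp P W V χ) {ψ : (ι → ℝ) → ℝ} (hψ : ContDiff ℝ 1 ψ)
    (h0 : ∀ x, 0 ≤ ψ x) (h1 : ∀ x, ψ x ≤ 1) {C' : ℝ} (hb' : ∀ x, ‖fderiv ℝ ψ x‖ ≤ C') :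
    |∫ ω, ψ (W ω) ∂P - ∫ g, ψ g ∂(gam ι)| ≤
      Real.pi / 2 * √(∑ k, ∫ ω, V ω k ^ 2 ∂P) + ∫ ω, (1 - χ ω) ∂P := by
  have hW := H.hW; have hV := H.hV; have hχ := H.hχ
  have hb : ∀ x, |ψ x| ≤ 1 := fun x => by rw [abs_of_nonneg (h0 x)]; exact h1 x
  have hχb : ∀ ω, ‖χ ω‖ ≤ 1 := fun ω => by
    rw [Real.norm_of_nonneg (H.χ0 ω)]; exact H.χ1 ω
  have hC' : 0 ≤ C' := (norm_nonneg _).trans (hb' 0)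
  have hψm : Measurable ψ := hψ.continuous.measurable
  have hχi : Integrable χ P := Integrable.of_bound hχ.aestronglyMeasurable 1 (Eventually.of_forall hχb)
  set Q := P.prod (gam ι) with hQ
  set u : ℝ → ℝ := fun θ => ∫ q : Ω × (ι → ℝ), χ q.1 *
    ψ (Real.cos θ • W q.1 + Real.sin θ • q.2) ∂Q with hu
  have hdc : Continuous (fderiv ℝ ψ) := hψ.continuous_fderiv (by norm_num)
  set B : Ω × (ι → ℝ) → ℝ := fun q => C' * (∑ k, (|W q.1 k| + |q.2 k|)) with hB
  have hBi : Integrable B Q := by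
    refine Integrable.const_mul (integrable_finsetSum _ fun k _ => ?_) _
    exact ((H.hWi k).abs.comp_fst (gam ι)).add ((integrable_gam k).abs.comp_snd P)
  have hsm : ∀ a b : ℝ, Measurable (fun q : Ω × (ι → ℝ) => a • W q.1 + b • q.2) := fun a b => by
    fun_prop
  have hFm : ∀ θ, Measurable (fun q : Ω × (ι → ℝ) => χ q.1 *
      ψ (Real.cos θ • W q.1 + Real.sin θ • q.2)) := fun θ =>
    (hχ.comp measurable_fst).mul (hψm.comp (hsm _ _))
  have hderiv : ∀ θ, HasDerivAt u (∫ q : Ω × (ι → ℝ), χ q.1 *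
      fderiv ℝ ψ (Real.cos θ • W q.1 + Real.sin θ • q.2)
        ((-Real.sin θ) • W q.1 + Real.cos θ • q.2) ∂Q) θ := by
    intro θ
    refine (hasDerivAt_integral_of_dominated_loc_of_deriv_le (bound := B) (s := Set.univ)
      (F := fun θ q => χ q.1 * ψ (Real.cos θ • W q.1 + Real.sin θ • q.2))
      (F' := fun θ q => χ q.1 * fderiv ℝ ψ (Real.cos θ • W q.1 + Real.sin θ • q.2)
        ((-Real.sin θ) • W q.1 + Real.cos θ • q.2)) (x₀ := θ) univ_mem
      (Eventually.of_forall fun θ => (hFm θ).aestronglyMeasurable) ?_ ?_ ?_ hBi ?_).2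
    · refine Integrable.of_bound (hFm θ).aestronglyMeasurable 1 (Eventually.of_forall fun q => ?_)
      rw [norm_mul]
      exact mul_le_one₀ (hχb _) (norm_nonneg _) (hb _)
    · refine Measurable.aestronglyMeasurable ((hχ.comp measurable_fst).mul ?_)
      have hc : Continuous (fun r : (ι → ℝ) × (ι → ℝ) => fderiv ℝ ψ r.1 r.2) :=
        (hdc.comp continuous_fst).clm_apply continuous_snd
      exact hc.measurable.comp ((hsm _ _).prodMk (hsm _ _))
    · refine Eventually.of_forall fun q θ' _ => ?_
      rw [norm_mul]
      refine (mul_le_of_le_one_left (norm_nonneg _) (hχb _)).trans ?_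
      refine ((fderiv ℝ ψ _).le_opNorm _).trans ?_
      refine mul_le_mul (hb' _) ?_ (norm_nonneg _) hC'
      rw [pi_norm_le_iff_of_nonneg (Finset.sum_nonneg fun k _ => by positivity)]
      intro k
      have e1 : ‖((-Real.sin θ') • W q.1 + Real.cos θ' • q.2) k‖ ≤ |W q.1 k| + |q.2 k| := by
        simp only [Pi.add_apply, Pi.smul_apply, smul_eq_mul, Real.norm_eq_abs]
        refine (abs_add_le _ _).trans ?_
        rw [abs_mul, abs_mul, abs_neg]
        have s1 := Real.abs_sin_le_one θ'
        have s2 := Real.abs_cos_le_one θ'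
        have := abs_nonneg (W q.1 k); have := abs_nonneg (q.2 k)
        nlinarith
      refine e1.trans ?_
      exact Finset.single_le_sum (f := fun k => |W q.1 k| + |q.2 k|) (fun k _ => by positivity)
        (Finset.mem_univ k)
    · refine Eventually.of_forall fun q θ' _ => ?_
      have d1 : HasDerivAt (fun θ : ℝ => Real.cos θ • W q.1 + Real.sin θ • q.2)
          ((-Real.sin θ') • W q.1 + Real.cos θ' • q.2) θ' :=
        ((Real.hasDerivAt_cos θ').smul_const _).add ((Real.hasDerivAt_sin θ').smul_const _)
      have d2 := (hψ.differentiable (by norm_num)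
        (Real.cos θ' • W q.1 + Real.sin θ' • q.2)).hasFDerivAt
      exact (d2.comp_hasDerivAt θ' d1).const_mul _
  have hbd : ∀ θ, ‖∫ q : Ω × (ι → ℝ), χ q.1 *
      fderiv ℝ ψ (Real.cos θ • W q.1 + Real.sin θ • q.2)
        ((-Real.sin θ) • W q.1 + Real.cos θ • q.2) ∂Q‖ ≤ √(∑ k, ∫ ω, V ω k ^ 2 ∂P) := by
    intro θ
    have hVk : ∀ k, Measurable (fun ω => V ω k) := fun k => (measurable_pi_apply k).comp hV
    have hWk : ∀ k, Measurable (fun ω => W ω k) := fun k => (measurable_pi_apply k).comp hW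
    refine le_trans (le_of_eq ?_) (H.bound hψ hb (Real.cos θ) (Real.sin θ))
    rw [Real.norm_eq_abs]
    congr 1
    have hI1 : ∀ k, Integrable (fun q : Ω × (ι → ℝ) => V q.1 k * q.2 k *
        ψ (Real.cos θ • W q.1 + Real.sin θ • q.2)) Q := fun k =>
      ((H.V_int k).mul_prod (integrable_gam k)).mul_bdd (c := 1)
        (hψm.comp (hsm _ _)).aestronglyMeasurable (Eventually.of_forall fun q => hb _)
    have hI2 : ∀ k, Integrable (fun q : Ω × (ι → ℝ) => χ q.1 *
        (fderiv ℝ ψ (Real.cos θ • W q.1 + Real.sin θ • q.2) (Pi.single k 1) *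
      (-Real.sin θ * W q.1 k + Real.cos θ * q.2 k))) Q := fun k => by
      refine Integrable.bdd_mul (c := 1) ?_ (hχ.comp measurable_fst).aestronglyMeasurable
        (Eventually.of_forall fun q => hχb _)
      refine Integrable.bdd_mul (c := C') ?_ ?_ (Eventually.of_forall fun q => ?_)
      · exact (((H.hWi k).comp_fst (gam ι)).const_mul _).add
          (((integrable_gam k).comp_snd P).const_mul _)
      · exact ((hdc.clm_apply continuous_const).measurable.comp (hsm _ _)).aestronglyMeasurable
      · have := (fderiv ℝ ψ (Real.cos θ • W q.1 + Real.sin θ • q.2)).le_opNorm (Pi.single k 1)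
        rw [Pi.norm_single] at this
        simp only [norm_one, mul_one] at this
        exact this.trans (hb' _)
    simp only [Finset.sum_mul]
    rw [integral_finsetSum _ fun k _ => hI1 k]
    rw [Finset.sum_congr rfl fun k _ => H.deriv_eq hψ hb hb' (Real.cos θ) (Real.sin θ) k,
      ← integral_finsetSum _ fun k _ => hI2 k]
    congr 1; ext q
    rw [clm_pi_sum, Finset.mul_sum]
    refine Finset.sum_congr rfl fun k _ => ?_
    simp only [Pi.add_apply, Pi.smul_apply, smul_eq_mul]; ring
  have hmv := Convex.norm_image_sub_le_of_norm_hasDerivWithin_le (f := u) (s := Set.univ)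
    (fun θ _ => (hderiv θ).hasDerivWithinAt) (fun θ _ => hbd θ) convex_univ
    (Set.mem_univ (0:ℝ)) (Set.mem_univ (Real.pi / 2))
  have u0 : u 0 = ∫ ω, χ ω * ψ (W ω) ∂P := by
    simp only [hu, Real.cos_zero, Real.sin_zero, one_smul, zero_smul, add_zero]
    rw [hQ, integral_fun_fst (fun ω => χ ω * ψ (W ω))]; simp
  have u1 : u (Real.pi / 2) = (∫ ω, χ ω ∂P) * ∫ g, ψ g ∂(gam ι) := by
    simp only [hu, Real.cos_pi_div_two, Real.sin_pi_div_two, one_smul, zero_smul, zero_add]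
    rw [hQ, integral_prod_mul χ ψ]
  have hψW : Integrable (fun ω => ψ (W ω)) P :=
    Integrable.of_bound (hψm.comp hW).aestronglyMeasurable 1 (Eventually.of_forall fun q => hb _)
  have hχψW : Integrable (fun ω => χ ω * ψ (W ω)) P :=
    hψW.bdd_mul (c := 1) hχ.aestronglyMeasurable (Eventually.of_forall hχb)
  have hψg : Integrable ψ (gam ι) :=
    Integrable.of_bound hψm.aestronglyMeasurable 1 (Eventually.of_forall fun q => hb _)
  set m := ∫ g, ψ g ∂(gam ι) with hm
  have hm0 : 0 ≤ m := integral_nonneg h0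
  have hm1 : m ≤ 1 := by
    have := integral_mono hψg (integrable_const 1) h1
    simpa using this
  have hrest : |(∫ ω, ψ (W ω) ∂P - ∫ ω, χ ω * ψ (W ω) ∂P) - (1 - ∫ ω, χ ω ∂P) * m| ≤
      ∫ ω, (1 - χ ω) ∂P := by
    have e : (∫ ω, ψ (W ω) ∂P - ∫ ω, χ ω * ψ (W ω) ∂P) - (1 - ∫ ω, χ ω ∂P) * m =
        ∫ ω, (1 - χ ω) * (ψ (W ω) - m) ∂P := by
      have : ∀ ω, (1 - χ ω) * (ψ (W ω) - m) = ψ (W ω) - χ ω * ψ (W ω) - (m - χ ω * m) :=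
        fun ω => by ring
      simp only [this]
      have j1 : Integrable (fun ω => ψ (W ω) - χ ω * ψ (W ω)) P := hψW.sub hχψW
      have j2 : Integrable (fun ω => m - χ ω * m) P := (integrable_const m).sub (hχi.mul_const m)
      rw [integral_sub j1 j2,
        integral_sub hψW hχψW, integral_sub (integrable_const m) (hχi.mul_const m),
        integral_mul_const]
      simp; ring
    rw [e]
    refine (abs_integral_le_integral_abs).trans (integral_mono_of_nonneg
      (Eventually.of_forall fun ω => abs_nonneg _) ((integrable_const 1).sub hχi)
      (Eventually.of_forall fun ω => ?_))
    simp only []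
    have hχ1 := H.χ1 ω
    rw [abs_mul, abs_of_nonneg (by linarith : 0 ≤ 1 - χ ω)]
    refine mul_le_of_le_one_right (by linarith) ?_
    rw [abs_le]; constructor <;> linarith [h0 (W ω), h1 (W ω)]
  have hmv' : |u (Real.pi / 2) - u 0| ≤ Real.pi / 2 * √(∑ k, ∫ ω, V ω k ^ 2 ∂P) := by
    have := hmv
    rw [Real.norm_eq_abs, Real.norm_eq_abs, sub_zero, abs_of_pos (a := Real.pi / 2) (by positivity), mul_comm] at this
    exact this
  rw [u0, u1] at hmv'
  have split : ∫ ω, ψ (W ω) ∂P - m = -((∫ ω, χ ω ∂P) * m - ∫ ω, χ ω * ψ (W ω) ∂P) +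
      ((∫ ω, ψ (W ω) ∂P - ∫ ω, χ ω * ψ (W ω) ∂P) - (1 - ∫ ω, χ ω ∂P) * m) := by ring
  rw [split]
  refine (abs_add_le _ _).trans ?_
  rw [abs_neg]
  linarith

lemma TVHyp.tv (H : TVHyp P W V χ) {A : Set (ι → ℝ)} (hA : MeasurableSet A) :
    |(P.map W A).toReal - (gam ι A).toReal| ≤
      Real.pi / 2 * √(∑ k, ∫ ω, V ω k ^ 2 ∂P) + ∫ ω, (1 - χ ω) ∂P := by
  have : IsProbabilityMeasure (P.map W) := Measure.isProbabilityMeasure_map H.hW.aemeasurable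
  set m : Measure (ι → ℝ) := P.map W + gam ι with hm
  refine le_of_forall_pos_le_add fun ε hε => ?_
  obtain ⟨K, hKA, hK, hKm⟩ := hA.exists_isCompact_sdiff_lt (μ := m) (measure_ne_top _ _)
    (ε := ENNReal.ofReal (ε / 4)) (by simp; linarith)
  obtain ⟨U, hAU, hU, hUt, hUm⟩ := hA.exists_isOpen_sdiff_lt (μ := m) (measure_ne_top _ _)
    (ε := ENNReal.ofReal (ε / 4)) (by simp; linarith)
  obtain ⟨K', hK', hKK', hK'U⟩ := exists_compact_between hK hU (hKA.trans hAU)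
  obtain ⟨f, hf0, hf1, hf⟩ := exists_contMDiffMap_zero_one_of_isClosed
    (n := 1) (modelWithCornersSelf ℝ (ι → ℝ)) (s := (interior K')ᶜ) (t := K) isOpen_interior.isClosed_compl
    hK.isClosed (Set.disjoint_left.mpr fun x hx hx' => hx (hKK' hx'))
  have hfd : ContDiff ℝ 1 f := f.contMDiff.contDiff
  have hsupp : HasCompactSupport f := by
    refine HasCompactSupport.intro hK' fun x hx => ?_
    exact hf0 (fun h => hx (interior_subset h))
  obtain ⟨C', hC'⟩ := (hfd.continuous_fderiv (by norm_num)).bounded_above_of_compact_support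
    (hsupp.fderiv (𝕜 := ℝ))
  have hs := H.smooth hfd (fun x => (hf x).1) (fun x => (hf x).2) hC'
  have key : ∀ ν : Measure (ι → ℝ), [IsProbabilityMeasure ν] → ν ≤ m →
      |∫ g, f g ∂ν - (ν A).toReal| ≤ ε / 2 := by
    intro ν _ hν
    have hfi : Integrable f ν := Integrable.of_bound hfd.continuous.aestronglyMeasurable 1
      (Eventually.of_forall fun x => by rw [Real.norm_of_nonneg (hf x).1]; exact (hf x).2)
    have hUK : ν (U \ K) ≤ ENNReal.ofReal (ε / 2) := by
      calc ν (U \ K) ≤ m (U \ K) := hν _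
        _ ≤ m ((U \ A) ∪ (A \ K)) := measure_mono fun x hx => by
            by_cases h : x ∈ A
            · exact Or.inr ⟨h, hx.2⟩
            · exact Or.inl ⟨hx.1, h⟩
        _ ≤ m (U \ A) + m (A \ K) := measure_union_le _ _
        _ ≤ ENNReal.ofReal (ε / 4) + ENNReal.ofReal (ε / 4) := add_le_add hUm.le hKm.le
        _ = ENNReal.ofReal (ε / 2) := by
            rw [← ENNReal.ofReal_add (by linarith) (by linarith)]; congr 1; ring
    have hAi : Integrable (A.indicator (fun _ => (1:ℝ))) ν := (integrable_const 1).indicator hA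
    have hDm : MeasurableSet (U \ K) := hU.measurableSet.diff hK.measurableSet
    have hDi : Integrable ((U \ K).indicator (fun _ => (1:ℝ))) ν := (integrable_const 1).indicator hDm
    have eA : (ν A).toReal = ∫ g, A.indicator (fun _ => (1:ℝ)) g ∂ν := by
      rw [integral_indicator hA]; simp [Measure.real]
    rw [eA, ← integral_sub hfi hAi]
    refine abs_integral_le_integral_abs.trans ?_
    have e2 : ∫ g, (U \ K).indicator (fun _ => (1:ℝ)) g ∂ν = (ν (U \ K)).toReal := by
      rw [integral_indicator hDm]; simp [Measure.real]
    have : ∫ g, |f g - A.indicator (fun _ => (1:ℝ)) g| ∂ν ≤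
        ∫ g, (U \ K).indicator (fun _ => (1:ℝ)) g ∂ν := by
      refine integral_mono (hfi.sub hAi).abs hDi fun x => ?_
      show |f x - A.indicator (fun _ => (1:ℝ)) x| ≤ (U \ K).indicator (fun _ => (1:ℝ)) x
      by_cases hx : x ∈ K
      · have : f x = 1 := hf1 hx
        rw [this, Set.indicator_of_mem (hKA hx), Set.indicator_of_notMem (fun h => h.2 hx)]; simp
      · by_cases hxU : x ∈ U
        · rw [Set.indicator_of_mem (s := U \ K) ⟨hxU, hx⟩]
          have := hf x
          by_cases hxA : x ∈ A
          · rw [Set.indicator_of_mem hxA, abs_le]; constructor <;> linarith [this.1, this.2]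
          · rw [Set.indicator_of_notMem hxA, abs_le]; constructor <;> linarith [this.1, this.2]
        · have : f x = 0 := hf0 (fun h => hxU (hK'U (interior_subset h)))
          rw [this, Set.indicator_of_notMem (fun h => hxU (hAU h)), Set.indicator_of_notMem (fun h => hxU h.1)]
          simp
    rw [e2] at this
    refine this.trans ?_
    exact ENNReal.toReal_le_of_le_ofReal (by linarith) hUK
  have k1 := key (P.map W) (Measure.le_add_right le_rfl)
  have k2 := key (gam ι) (Measure.le_add_left le_rfl)
  rw [integral_map H.hW.aemeasurable hfd.continuous.aestronglyMeasurable] at k1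
  rw [abs_le] at *
  constructor <;> linarith [k1.1, k1.2, k2.1, k2.2, hs.1, hs.2]

end tv

end WG


namespace WG

section linalg
variable {ι κ : Type*} [Fintype ι] [DecidableEq ι] [Fintype κ]

lemma cs_mulVec (E : Matrix ι ι ℝ) (y : ι → ℝ) :
    ∑ a, (E.mulVec y a) ^ 2 ≤ (∑ a, ∑ b, E a b ^ 2) * ∑ b, y b ^ 2 := by
  rw [Finset.sum_mul]
  refine Finset.sum_le_sum fun a _ => ?_
  exact Finset.sum_mul_sq_le_sq_mul_sq _ _ _

lemma mulVec_sub_one (A : Matrix ι ι ℝ) (y : ι → ℝ) (a : ι) :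
    A.mulVec y a = y a + (A - 1).mulVec y a := by
  rw [Matrix.sub_mulVec]; simp

lemma norm_le_of_near (A : Matrix ι ι ℝ) (hA : ∑ a, ∑ b, (A - 1) a b ^ 2 ≤ 1 / 4) (y : ι → ℝ) :
    ∑ a, y a ^ 2 ≤ 4 * ∑ a, (A.mulVec y a) ^ 2 := by
  have h1 := cs_mulVec (A - 1) y
  have h0 : 0 ≤ ∑ b, y b ^ 2 := Finset.sum_nonneg fun _ _ => sq_nonneg _
  have h2 : ∑ a, y a ^ 2 ≤ 2 * ∑ a, (A.mulVec y a) ^ 2 + 2 * ∑ a, ((A - 1).mulVec y a) ^ 2 := by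
    rw [Finset.mul_sum, Finset.mul_sum, ← Finset.sum_add_distrib]
    refine Finset.sum_le_sum fun a _ => ?_
    rw [mulVec_sub_one A y a]
    nlinarith [sq_nonneg (y a + 2 * (A - 1).mulVec y a)]
  nlinarith

lemma det_unit_of_near (A : Matrix ι ι ℝ) (hA : ∑ a, ∑ b, (A - 1) a b ^ 2 ≤ 1 / 4) :
    IsUnit A.det := by
  rw [isUnit_iff_ne_zero]
  intro h
  obtain ⟨v, hv, hv0⟩ := Matrix.exists_mulVec_eq_zero_iff.mpr h
  have := norm_le_of_near A hA v
  rw [hv0] at this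
  simp only [Pi.zero_apply, ne_eq, OfNat.ofNat_ne_zero, not_false_eq_true, zero_pow,
    Finset.sum_const_zero, mul_zero] at this
  apply hv
  have h2 := (Finset.sum_eq_zero_iff_of_nonneg (fun a _ => sq_nonneg (v a))).mp
    (le_antisymm this (Finset.sum_nonneg fun _ _ => sq_nonneg _))
  ext a
  simpa using h2 a (Finset.mem_univ a)

lemma inv_bound (A : Matrix ι ι ℝ) (hA : ∑ a, ∑ b, (A - 1) a b ^ 2 ≤ 1 / 4) (z : ι → ℝ) :
    ∑ a, (A⁻¹.mulVec z a) ^ 2 ≤ 4 * ∑ a, z a ^ 2 := by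
  have := norm_le_of_near A hA (A⁻¹.mulVec z)
  rwa [Matrix.mulVec_mulVec, Matrix.mul_nonsing_inv _ (det_unit_of_near A hA), Matrix.one_mulVec] at this

lemma quad_le (A : Matrix ι ι ℝ) (hA : ∑ a, ∑ b, (A - 1) a b ^ 2 ≤ 1 / 4) (r : ι → ℝ) :
    ∑ a, r a * A.mulVec r a ≤ 3 / 2 * ∑ a, r a ^ 2 := by
  have h1 := cs_mulVec (A - 1) r
  have h0 : 0 ≤ ∑ b, r b ^ 2 := Finset.sum_nonneg fun _ _ => sq_nonneg _
  have h2 : ∑ a, r a * A.mulVec r a ≤ 5 / 4 * ∑ a, r a ^ 2 + ∑ a, ((A - 1).mulVec r a) ^ 2 := by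
    rw [Finset.mul_sum, ← Finset.sum_add_distrib]
    refine Finset.sum_le_sum fun a _ => ?_
    rw [mulVec_sub_one A r a]
    nlinarith [sq_nonneg (r a - 2 * (A - 1).mulVec r a)]
  nlinarith

/-- the synthesis bound -/
lemma r_bound (A : Matrix ι ι ℝ) (hA : ∑ a, ∑ b, (A - 1) a b ^ 2 ≤ 1 / 4)
    (D : ℝ) (hD : 0 < D) (t s : κ → ℝ) (ht : ∀ l, 0 ≤ t l) (Y : κ → ι → ℝ) (e : ι → ℝ)
    (hAe : ∀ a b, A a b = (∑ l, t l * Y l a * Y l b) / D + if a = b then e a ^ 2 else 0)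
    (r : ι → ℝ) (hr : ∀ a, r a = (∑ l, t l * s l * Y l a) / √D) :
    ∑ a, r a ^ 2 ≤ 3 / 2 * ∑ l, t l * s l ^ 2 := by
  have hq := quad_le A hA r
  have hsD : 0 < √D := Real.sqrt_pos.mpr hD
  have hsq : √D * √D = D := Real.mul_self_sqrt hD.le
  set y : κ → ℝ := fun l => (∑ a, Y l a * r a) / √D with hy
  have e1 : ∑ a, r a ^ 2 = ∑ l, t l * s l * y l := by
    calc ∑ a, r a ^ 2 = ∑ a, ∑ l, t l * s l * (Y l a * r a / √D) := by
          refine Finset.sum_congr rfl fun a _ => ?_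
          have : r a ^ 2 = (∑ l, t l * s l * Y l a) / √D * r a := by rw [← hr a]; ring
          rw [this, Finset.sum_div, Finset.sum_mul]
          exact Finset.sum_congr rfl fun l _ => by ring
      _ = _ := by
          rw [Finset.sum_comm]
          refine Finset.sum_congr rfl fun l _ => ?_
          show _ = t l * s l * ((∑ a, Y l a * r a) / √D)
          rw [← Finset.mul_sum, Finset.sum_div]
  have e2 : ∑ l, t l * y l ^ 2 ≤ ∑ a, r a * A.mulVec r a := by
    have : ∑ a, r a * A.mulVec r a = ∑ l, t l * y l ^ 2 + ∑ a, (e a * r a) ^ 2 := by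
      have ea : ∀ a, r a * A.mulVec r a = ∑ l, t l * (Y l a * r a) / √D * y l + (e a * r a) ^ 2 := by
        intro a
        have : A.mulVec r a = ∑ l, t l * Y l a / √D * y l + e a ^ 2 * r a := by
          show ∑ b, A a b * r b = _
          simp only [hAe, add_mul, Finset.sum_add_distrib]
          congr 1
          · simp only [Finset.sum_div, Finset.sum_mul]
            rw [Finset.sum_comm]
            refine Finset.sum_congr rfl fun l _ => ?_
            rw [hy]; simp only []
            rw [Finset.sum_div, Finset.mul_sum]
            refine Finset.sum_congr rfl fun b _ => ?_
            have : t l * Y l a / √D * (Y l b * r b / √D) = t l * Y l a * Y l b * r b / (√D * √D) := by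
              field_simp
            rw [this, hsq]; ring
          · simp
        rw [this, mul_add, Finset.mul_sum]
        congr 1
        · exact Finset.sum_congr rfl fun l _ => by ring
        · ring
      simp only [ea, Finset.sum_add_distrib]
      congr 1
      rw [Finset.sum_comm]
      refine Finset.sum_congr rfl fun l _ => ?_
      rw [← Finset.sum_mul, pow_two, ← mul_assoc]
      congr 1
      rw [hy]; simp only []
      rw [← Finset.sum_div, ← Finset.mul_sum]; ring
    rw [this]
    have : 0 ≤ ∑ a, (e a * r a) ^ 2 := Finset.sum_nonneg fun _ _ => sq_nonneg _
    linarith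
  have e3 : ∑ l, t l * s l * y l ≤ 3 / 4 * ∑ l, t l * s l ^ 2 + 1 / 3 * ∑ l, t l * y l ^ 2 := by
    rw [Finset.mul_sum, Finset.mul_sum, ← Finset.sum_add_distrib]
    refine Finset.sum_le_sum fun l _ => ?_
    nlinarith [mul_nonneg (ht l) (sq_nonneg (3 * s l - 2 * y l))]
  nlinarith

end linalg

/-- derivative of the matrix inverse along a one-parameter family, entrywise -/
lemma inv_deriv {ι : Type*} [Fintype ι] [DecidableEq ι] {M : ℝ → Matrix ι ι ℝ}
    {M' : Matrix ι ι ℝ} {s : Set ℝ} {t : ℝ} (hM : ∀ a b, HasDerivWithinAt (fun u => M u a b) (M' a b) s t)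
    (hdet : IsUnit (M t).det) (a b : ι) :
    HasDerivWithinAt (fun u => (M u)⁻¹ a b) (-((M t)⁻¹ * M' * (M t)⁻¹) a b) s t := by
  let _ : NormedRing (Matrix ι ι ℝ) := Matrix.linftyOpNormedRing
  let _ : NormedAlgebra ℝ (Matrix ι ι ℝ) := Matrix.linftyOpNormedAlgebra
  have hM1 : HasDerivWithinAt M M' s t := by
    have h2 : ∀ u, M u = ∑ a, ∑ b, (M u a b) • (Matrix.single a b (1:ℝ)) := fun u => by
      conv_lhs => rw [Matrix.matrix_eq_sum_single (M u)]
      simp [Matrix.smul_single]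
    have h3 : M' = ∑ a, ∑ b, (M' a b) • (Matrix.single a b (1:ℝ)) := by
      conv_lhs => rw [Matrix.matrix_eq_sum_single M']
      simp [Matrix.smul_single]
    rw [h3, show M = fun u => _ from funext h2]
    exact HasDerivWithinAt.fun_sum fun a _ => HasDerivWithinAt.fun_sum fun b _ => (hM a b).smul_const _
  have hu : IsUnit (M t) := (Matrix.isUnit_iff_isUnit_det _).mpr hdet
  obtain ⟨x, hx⟩ := hu
  have h1 := hasFDerivAt_ringInverse (𝕜 := ℝ) x
  rw [hx] at h1
  have h2 := h1.comp_hasDerivWithinAt t hM1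
  have hxinv : (↑x⁻¹ : Matrix ι ι ℝ) = (M t)⁻¹ := by rw [← hx, Matrix.coe_units_inv]
  have h3 : HasDerivWithinAt (fun u => (M u)⁻¹) (-((M t)⁻¹ * M' * (M t)⁻¹)) s t := by
    have e : (fun u => (M u)⁻¹) = Ring.inverse ∘ M := by
      ext1 u; exact Matrix.nonsing_inv_eq_ringInverse _
    rw [e]
    refine h2.congr_deriv ?_
    simp [hxinv]
  have hcl : Continuous (fun A : Matrix ι ι ℝ => A a b) := by
    exact continuous_id.matrix_elem a b
  let l : Matrix ι ι ℝ →L[ℝ] ℝ := ⟨Matrix.entryLinearMap ℝ ℝ a b, hcl⟩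
  have h4 := l.hasFDerivAt.comp_hasDerivWithinAt (x := t) (f := fun u => (M u)⁻¹) h3
  exact h4

lemma measurable_inv_entry {Ω ι : Type*} [MeasurableSpace Ω] [Fintype ι] [DecidableEq ι]
    {M : Ω → Matrix ι ι ℝ} (hM : ∀ a b, Measurable fun x => M x a b) (a b : ι) :
    Measurable fun x => (M x)⁻¹ a b := by
  have hM' : Measurable (fun x => (fun a b => M x a b : ι → ι → ℝ)) :=
    measurable_pi_lambda _ fun a => measurable_pi_lambda _ fun b => hM a b
  have c1 : Continuous (fun A : ι → ι → ℝ => Matrix.det (A : Matrix ι ι ℝ)) :=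
    Continuous.matrix_det (A := fun A : ι → ι → ℝ => (A : Matrix ι ι ℝ)) continuous_id
  have c2 : Continuous (fun A : ι → ι → ℝ => (Matrix.adjugate (A : Matrix ι ι ℝ)) a b) :=
    (Continuous.matrix_adjugate (A := fun A : ι → ι → ℝ => (A : Matrix ι ι ℝ)) continuous_id).matrix_elem a b
  have : ∀ x, (M x)⁻¹ a b = ((M x).det)⁻¹ * (M x).adjugate a b := fun x => by
    rw [Matrix.inv_def, Ring.inverse_eq_inv']; rfl
  simp only [this]
  exact (c1.measurable.comp hM').inv.mul (c2.measurable.comp hM')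

lemma continuousAt_inv_entry {Ω ι : Type*} [TopologicalSpace Ω] [Fintype ι] [DecidableEq ι]
    {M : Ω → Matrix ι ι ℝ} {x : Ω} (hM : ∀ a b, ContinuousAt (fun x => M x a b) x)
    (hdet : IsUnit (M x).det) (a b : ι) :
    ContinuousAt (fun x => (M x)⁻¹ a b) x := by
  have hM' : ContinuousAt (fun x => (fun a b => M x a b : ι → ι → ℝ)) x :=
    continuousAt_pi.mpr fun a => continuousAt_pi.mpr fun b => hM a b
  have c1 : Continuous (fun A : ι → ι → ℝ => Matrix.det (A : Matrix ι ι ℝ)) :=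
    Continuous.matrix_det (A := fun A : ι → ι → ℝ => (A : Matrix ι ι ℝ)) continuous_id
  have c2 : Continuous (fun A : ι → ι → ℝ => (Matrix.adjugate (A : Matrix ι ι ℝ)) a b) :=
    (Continuous.matrix_adjugate (A := fun A : ι → ι → ℝ => (A : Matrix ι ι ℝ)) continuous_id).matrix_elem a b
  have : ∀ x, (M x)⁻¹ a b = ((M x).det)⁻¹ * (M x).adjugate a b := fun x => by
    rw [Matrix.inv_def, Ring.inverse_eq_inv']; rfl
  simp only [this]
  exact ((c1.continuousAt.comp hM').inv₀ hdet.ne_zero).mul (c2.continuousAt.comp hM')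

end WG


namespace WG

section defs
variable {n d : ℕ}

/-- the vector with its `j`-th coordinate erased -/
def Yv (j : Fin n) (x : Fin n → ℝ) (a : Fin n) : ℝ := if a = j then 0 else x a

/-- the local covariance matrices -/
noncomputable def Mx (τ : ℝ → ℝ) (j : Fin n) (X : Fin d → Fin n → ℝ) : Matrix (Fin n) (Fin n) ℝ :=
  fun a b => (∑ l, τ (X l j) * Yv j (X l) a * Yv j (X l) b) / (d : ℝ) +
    if a = b then (if a = j then (1 : ℝ) else 0) ^ 2 else 0

/-- total squared deviation -/
noncomputable def SS (τ : ℝ → ℝ) (X : Fin d → Fin n → ℝ) : ℝ :=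
  ∑ j, ∑ a, ∑ b, (Mx τ j X - 1) a b ^ 2

noncomputable def chi (τ : ℝ → ℝ) (X : Fin d → Fin n → ℝ) : ℝ := (max 0 (1 - 4 * SS τ X)) ^ 2

noncomputable def chid (τ : ℝ → ℝ) (X : Fin d → Fin n → ℝ) : ℝ := -8 * max 0 (1 - 4 * SS τ X)

open Classical in
/-- truncated inverse -/
noncomputable def Bx (τ : ℝ → ℝ) (j : Fin n) (X : Fin d → Fin n → ℝ) : Matrix (Fin n) (Fin n) ℝ :=
  fun a b => if SS τ X ≤ 1 / 4 then (Mx τ j X)⁻¹ a b else 0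

noncomputable def wv (j : Fin n) (X : Fin d → Fin n → ℝ) (a : Fin n) : ℝ :=
  (∑ l, X l j * Yv j (X l) a) / √(d : ℝ)

def Dk (τ τ' : ℝ → ℝ) (p j : Fin n) (x : Fin n → ℝ) (a b : Fin n) : ℝ :=
  if p = j then τ' (x p) * Yv j x a * Yv j x b
  else τ (x j) * ((if a = p then 1 else 0) * Yv j x b + Yv j x a * (if b = p then 1 else 0))

noncomputable def DS (τ τ' : ℝ → ℝ) (p : Fin n) (l : Fin d) (X : Fin d → Fin n → ℝ) : ℝ :=
  ∑ j, ∑ a, ∑ b, 2 * (Mx τ j X - 1) a b * (Dk τ τ' p j (X l) a b / d)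

noncomputable def BY (τ : ℝ → ℝ) (p : Fin n) (l : Fin d) (X : Fin d → Fin n → ℝ) (i : Fin n) : ℝ :=
  (Bx τ p X).mulVec (Yv p (X l)) i

noncomputable def YBY (τ : ℝ → ℝ) (p : Fin n) (l : Fin d) (X : Fin d → Fin n → ℝ) : ℝ :=
  ∑ i, Yv p (X l) i * BY τ p l X i

noncomputable def sv (τ τ' : ℝ → ℝ) (p : Fin n) (l : Fin d) (X : Fin d → Fin n → ℝ) : ℝ :=
  chi τ X * τ' (X l p) * YBY τ p l X / d - chid τ X * DS τ τ' p l X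

noncomputable def rv (τ τ' : ℝ → ℝ) (p : Fin n) (X : Fin d → Fin n → ℝ) (a : Fin n) : ℝ :=
  (∑ l, τ (X l p) * sv τ τ' p l X * Yv p (X l) a) / √(d : ℝ)

noncomputable def Vv (τ τ' : ℝ → ℝ) (p : Fin n) (X : Fin d → Fin n → ℝ) (i : Fin n) : ℝ :=
  chi τ X * ((Bx τ p X).mulVec (wv p X) i - wv p X i) + (Bx τ p X).mulVec (rv τ τ' p X) i

noncomputable def Ww (X : Fin d → Fin n → ℝ) (k : {q : Fin n × Fin n // q.1 < q.2}) : ℝ :=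
  (∑ l, X l k.1.1 * X l k.1.2) / √(d : ℝ)

noncomputable def dW (p : Fin n) (l : Fin d) (X : Fin d → Fin n → ℝ)
    (k : {q : Fin n × Fin n // q.1 < q.2}) : ℝ :=
  ((if k.1.1 = p then X l k.1.2 else 0) + (if k.1.2 = p then X l k.1.1 else 0)) / √(d : ℝ)

end defs

section RDs
variable {n d : ℕ}

/-- right-differentiability in one coordinate -/
def RD (J : Set ℝ) (l : Fin d) (p : Fin n) (F F' : (Fin d → Fin n → ℝ) → ℝ) : Prop :=
  ∀ X, ∀ t ∈ J, ContinuousAt (fun u => F (upd X l p u)) t ∧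
    HasDerivWithinAt (fun u => F (upd X l p u)) (F' (upd X l p t)) (Set.Ioi t) t

variable {J : Set ℝ} {l : Fin d} {p : Fin n} {F F' G G' : (Fin d → Fin n → ℝ) → ℝ}

lemma RD.add (hF : RD J l p F F') (hG : RD J l p G G') :
    RD J l p (fun X => F X + G X) (fun X => F' X + G' X) := fun X t ht =>
  ⟨(hF X t ht).1.add (hG X t ht).1, (hF X t ht).2.add (hG X t ht).2⟩

lemma RD.mul (hF : RD J l p F F') (hG : RD J l p G G') :
    RD J l p (fun X => F X * G X) (fun X => F' X * G X + F X * G' X) := fun X t ht =>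
  ⟨(hF X t ht).1.mul (hG X t ht).1, (hF X t ht).2.mul (hG X t ht).2⟩

lemma RD.congr (hF : RD J l p F F') (h : ∀ X, F' X = G' X) : RD J l p F G' := by
  have : F' = G' := funext h
  rwa [← this]

lemma RD.const (c : ℝ) : RD J l p (fun _ => c) (fun _ => 0) := fun _ _ _ =>
  ⟨continuousAt_const, hasDerivWithinAt_const _ _ _⟩

lemma RD.indep (h : ∀ X t, F (upd X l p t) = F X) : RD J l p F (fun _ => 0) := fun X t ht => by
  simp only [h]
  exact ⟨continuousAt_const, hasDerivWithinAt_const _ _ _⟩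

lemma RD.sum {α : Type*} {s : Finset α} {F F' : α → (Fin d → Fin n → ℝ) → ℝ}
    (h : ∀ a ∈ s, RD J l p (F a) (F' a)) :
    RD J l p (fun X => ∑ a ∈ s, F a X) (fun X => ∑ a ∈ s, F' a X) := fun X t ht =>
  ⟨tendsto_finsetSum _ fun a ha => (h a ha X t ht).1,
    HasDerivWithinAt.fun_sum fun a ha => (h a ha X t ht).2⟩

lemma RD.div_const (hF : RD J l p F F') (c : ℝ) : RD J l p (fun X => F X / c) (fun X => F' X / c) :=
  fun X t ht => ⟨(hF X t ht).1.div_const c, (hF X t ht).2.div_const c⟩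

lemma RD.comp {φ φ' : ℝ → ℝ} (hφ : ∀ s, HasDerivAt φ (φ' s) s) (hF : RD J l p F F') :
    RD J l p (fun X => φ (F X)) (fun X => φ' (F X) * F' X) := fun X t ht =>
  ⟨ContinuousAt.comp (f := fun u => F (upd X l p u)) (hφ _).continuousAt (hF X t ht).1,
   (hφ (F (upd X l p t))).comp_hasDerivWithinAt (h := fun u => F (upd X l p u)) t (hF X t ht).2⟩

lemma RD.coord (l' : Fin d) (p' : Fin n) :
    RD J l p (fun X => X l' p') (fun _ => if l' = l ∧ p' = p then 1 else 0) := fun X t ht => by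
  simp only [upd_apply]
  split_ifs
  · exact ⟨continuousAt_id, hasDerivWithinAt_id _ _⟩
  · exact ⟨continuousAt_const, hasDerivWithinAt_const _ _ _⟩

variable {μ : Measure ℝ} {τ τ' L : ℝ → ℝ}

lemma RD.tau (H : SD μ J τ τ' L) : RD J l p (fun X => τ (X l p)) (fun X => τ' (X l p)) :=
  fun X t ht => by
  simp only [upd_apply, and_self, if_true]
  exact ⟨H.τ_cont t ht, H.τ_deriv t ht⟩

lemma Yv_upd_self (X : Fin d → Fin n → ℝ) (l l' : Fin d) (p : Fin n) (t : ℝ) :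
    Yv p (upd X l p t l') = Yv p (X l') := by
  ext a
  simp only [Yv, upd_apply]
  by_cases h : a = p <;> simp [h]

lemma RD.Yv_ne {j : Fin n} (hj : p ≠ j) (a : Fin n) :
    RD J l p (fun X => Yv j (X l) a) (fun _ => if a = p then 1 else 0) := by
  unfold Yv
  by_cases h : a = j
  · simp only [h, if_true]
    rw [if_neg (Ne.symm hj)]; exact RD.const 0
  · simp only [h, if_false]
    refine (RD.coord (J := J) (l := l) (p := p) l a).congr fun X => ?_
    simp

lemma RD.Mx_term (H : SD μ J τ τ' L) (j : Fin n) (l' : Fin d) (a b : Fin n) :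
    RD J l p (fun X => τ (X l' j) * Yv j (X l') a * Yv j (X l') b)
      (fun X => if l' = l then Dk τ τ' p j (X l) a b else 0) := by
  by_cases h : l' = l
  · subst h
    simp only [if_true]
    by_cases hj : p = j
    · subst hj
      have hY : ∀ a, RD J l' p (fun X => Yv p (X l') a) (fun _ => 0) := fun a =>
        RD.indep fun X t => by rw [Yv_upd_self]
      refine (((RD.tau H).mul (hY a)).mul (hY b)).congr fun X => ?_
      simp [Dk]
    · have hτ : RD J l' p (fun X => τ (X l' j)) (fun _ => 0) :=
        RD.indep fun X t => by rw [upd_apply]; simp [Ne.symm hj]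
      refine ((hτ.mul (RD.Yv_ne hj a)).mul (RD.Yv_ne hj b)).congr fun X => ?_
      simp only [Dk, hj, if_false]; ring
  · simp only [h, if_false]
    refine RD.indep fun X t => ?_
    have : upd X l p t l' = X l' := by ext a; rw [upd_apply]; simp [h]
    rw [this]

lemma RD.Mx (H : SD μ J τ τ' L) (j a b : Fin n) :
    RD J l p (fun X => Mx τ j X a b) (fun X => Dk τ τ' p j (X l) a b / d) := by
  unfold WG.Mx
  refine (((RD.sum fun l' _ => RD.Mx_term H j l' a b).div_const (d:ℝ)).add (RD.const _)).congr fun X => ?_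
  simp

lemma RD.Mx1 (H : SD μ J τ τ' L) (j a b : Fin n) :
    RD J l p (fun X => (WG.Mx τ j X - 1) a b) (fun X => Dk τ τ' p j (X l) a b / d) := by
  refine ((RD.Mx H j a b).add (RD.const (-(1 : Matrix (Fin n) (Fin n) ℝ) a b))).congr fun X => ?_
  simp

lemma RD.SS (H : SD μ J τ τ' L) : RD J l p (fun X => SS τ X) (fun X => DS τ τ' p l X) := by
  unfold WG.SS DS
  refine RD.sum fun j _ => RD.sum fun a _ => RD.sum fun b _ => ?_
  have := (RD.Mx1 (l := l) (p := p) H j a b)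
  simp only [pow_two]
  refine (this.mul this).congr fun X => ?_
  ring

lemma hasDerivAt_max_sq (s : ℝ) :
    HasDerivAt (fun s : ℝ => (max 0 (1 - 4 * s)) ^ 2) (-8 * max 0 (1 - 4 * s)) s := by
  have lin : ∀ s : ℝ, HasDerivAt (fun s : ℝ => 1 - 4 * s) (-4) s := fun s => by
    have := ((hasDerivAt_id s).const_mul 4).const_sub 1
    simpa using this
  rcases lt_trichotomy (1 - 4 * s) 0 with h | h | h
  · rw [max_eq_left h.le, mul_zero]
    have : (fun s : ℝ => (max 0 (1 - 4 * s)) ^ 2) =ᶠ[𝓝 s] fun _ => 0 := by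
      filter_upwards [(lin s).continuousAt.eventually_lt continuousAt_const h] with u hu
      rw [max_eq_left hu.le]; simp
    exact (hasDerivAt_const s (0:ℝ)).congr_of_eventuallyEq this
  · rw [h, max_self, mul_zero]
    rw [hasDerivAt_iff_isLittleO]
    simp only [h, max_self, smul_zero]
    have : (fun x' : ℝ => (x' - s) ^ 2) =o[𝓝 s] fun x' => x' - s := by
      have h1 : Tendsto (fun x' : ℝ => x' - s) (𝓝 s) (𝓝 0) := by
        have : ContinuousAt (fun x' : ℝ => x' - s) s := by fun_prop
        simpa [ContinuousAt] using this
      exact (Asymptotics.isLittleO_pow_id (𝕜 := ℝ) (n := 2) one_lt_two).comp_tendsto h1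
    refine Asymptotics.IsBigO.trans_isLittleO ?_ this
    refine Asymptotics.IsBigO.of_bound 16 (Eventually.of_forall fun x => ?_)
    have e : 1 - 4 * x = -4 * (x - s) := by linarith
    rw [e]
    simp only [ne_eq, OfNat.ofNat_ne_zero, not_false_eq_true, zero_pow, sub_zero, norm_pow, Real.norm_eq_abs]
    rw [show (16:ℝ) = 4 ^ 2 by norm_num, ← mul_pow]
    refine pow_le_pow_left₀ (abs_nonneg _) ?_ 2
    rw [abs_of_nonneg (le_max_left _ _)]
    refine max_le (by positivity) ?_
    have := neg_abs_le (x - s); linarith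
  · have : (fun s : ℝ => (max 0 (1 - 4 * s)) ^ 2) =ᶠ[𝓝 s] fun s => (1 - 4 * s) ^ 2 := by
      filter_upwards [continuousAt_const.eventually_lt (lin s).continuousAt h] with u hu
      rw [max_eq_right hu.le]
    rw [max_eq_right h.le]
    refine (((lin s).pow 2).congr_of_eventuallyEq this).congr_deriv ?_
    simp; ring

lemma RD.chi (H : SD μ J τ τ' L) : RD J l p (fun X => chi τ X)
    (fun X => chid τ X * DS τ τ' p l X) := by
  unfold WG.chi chid
  exact RD.comp hasDerivAt_max_sq (RD.SS H)

lemma RD.Ww (k : {q : Fin n × Fin n // q.1 < q.2}) :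
    RD J l p (fun X => Ww X k) (fun X => dW p l X k) := by
  unfold WG.Ww dW
  refine RD.div_const ?_ _
  refine (RD.sum fun l' _ => (RD.coord l' _).mul (RD.coord l' _)).congr fun X => ?_
  rw [Finset.sum_eq_single l]
  · simp
  · intro b _ hb; simp [hb]
  · simp

lemma RD.hW {h : ({q : Fin n × Fin n // q.1 < q.2} → ℝ) → ℝ} (hh : ContDiff ℝ 1 h) :
    RD J l p (fun X => h (WG.Ww X)) (fun X => fderiv ℝ h (WG.Ww X) (dW p l X)) := fun X t ht => by
  have h1 := (hh.differentiable (by norm_num) (WG.Ww (upd X l p t))).hasFDerivAt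
  have c1 : ContinuousAt (fun u => WG.Ww (upd X l p u)) t :=
    continuousAt_pi.mpr fun k => (RD.Ww k X t ht).1
  have d1 : HasDerivWithinAt (fun u => WG.Ww (upd X l p u)) (dW p l (upd X l p t)) (Set.Ioi t) t :=
    hasDerivWithinAt_pi.mpr fun k => (RD.Ww k X t ht).2
  exact ⟨ContinuousAt.comp (f := fun u => WG.Ww (upd X l p u)) h1.continuousAt c1,
    h1.comp_hasDerivWithinAt t d1⟩

/-- each block is within the total deviation -/
lemma block_le (τ : ℝ → ℝ) (j : Fin n) (X : Fin d → Fin n → ℝ) :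
    ∑ a, ∑ b, (WG.Mx τ j X - 1) a b ^ 2 ≤ WG.SS τ X :=
  Finset.single_le_sum (f := fun j => ∑ a, ∑ b, (WG.Mx τ j X - 1) a b ^ 2)
    (fun _ _ => Finset.sum_nonneg fun _ _ => Finset.sum_nonneg fun _ _ => sq_nonneg _) (Finset.mem_univ j)

lemma SS_nonneg (τ : ℝ → ℝ) (X : Fin d → Fin n → ℝ) : 0 ≤ WG.SS τ X :=
  Finset.sum_nonneg fun _ _ => Finset.sum_nonneg fun _ _ => Finset.sum_nonneg fun _ _ => sq_nonneg _

lemma Bx_bound (τ : ℝ → ℝ) (j : Fin n) (X : Fin d → Fin n → ℝ) (z : Fin n → ℝ) :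
    ∑ a, ((Bx τ j X).mulVec z a) ^ 2 ≤ 4 * ∑ a, z a ^ 2 := by
  by_cases h : WG.SS τ X ≤ 1 / 4
  · have : Bx τ j X = (WG.Mx τ j X)⁻¹ := by ext a b; simp only [Bx, h, if_true]
    rw [this]
    exact inv_bound _ ((block_le τ j X).trans h) z
  · have : Bx τ j X = 0 := by ext a b; simp only [Bx, h, if_false, Matrix.zero_apply]
    rw [this]
    simp only [Matrix.zero_mulVec, Pi.zero_apply, ne_eq, OfNat.ofNat_ne_zero, not_false_eq_true,
      zero_pow, Finset.sum_const_zero]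
    exact mul_nonneg (by norm_num) (Finset.sum_nonneg fun _ _ => sq_nonneg _)

lemma Bx_bound' (τ : ℝ → ℝ) (j : Fin n) (X : Fin d → Fin n → ℝ) (z : Fin n → ℝ) (a : Fin n) :
    |(Bx τ j X).mulVec z a| ≤ 2 * ∑ a, |z a| := by
  have h1 := Bx_bound τ j X z
  have h2 : ((Bx τ j X).mulVec z a) ^ 2 ≤ ∑ a, ((Bx τ j X).mulVec z a) ^ 2 :=
    Finset.single_le_sum (f := fun a => ((Bx τ j X).mulVec z a) ^ 2) (fun _ _ => sq_nonneg _)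
      (Finset.mem_univ a)
  have h3 : ∑ a, z a ^ 2 ≤ (∑ a, |z a|) ^ 2 := by
    have := Finset.sum_sq_le_sq_sum_of_nonneg (s := Finset.univ) (f := fun a => |z a|) (fun a _ => abs_nonneg _)
    simpa using this
  refine abs_le_of_sq_le_sq ?_ (by positivity)
  nlinarith

lemma RD.BYchi (H : SD μ J τ τ' L) (i : Fin n) :
    RD J l p (fun X => BY τ p l X i * WG.chi τ X)
      (fun X => -(τ' (X l p) * BY τ p l X i * YBY τ p l X / d) * WG.chi τ X +
        BY τ p l X i * (chid τ X * DS τ τ' p l X)) := fun X t ht => by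
  obtain ⟨cχ, dχ⟩ := RD.chi (l := l) (p := p) H X t ht
  obtain ⟨cS, dS⟩ := RD.SS (l := l) (p := p) H X t ht
  by_cases hS : WG.SS τ (upd X l p t) < 1 / 4
  · have ev : ∀ᶠ u in 𝓝 t, WG.SS τ (upd X l p u) < 1 / 4 := cS.eventually_lt continuousAt_const hS
    have hdet : IsUnit (WG.Mx τ p (upd X l p t)).det :=
      det_unit_of_near _ ((block_le τ p _).trans hS.le)
    have eqB : ∀ a b, (fun u => Bx τ p (upd X l p u) a b) =ᶠ[𝓝 t]
        fun u => (WG.Mx τ p (upd X l p u))⁻¹ a b := fun a b => by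
      filter_upwards [ev] with u hu
      simp only [Bx, hu.le, if_true]
    have eqB0 : Bx τ p (upd X l p t) = (WG.Mx τ p (upd X l p t))⁻¹ := by
      ext a b; exact (eqB a b).self_of_nhds
    have cB : ∀ a b, ContinuousAt (fun u => Bx τ p (upd X l p u) a b) t := fun a b => by
      refine ContinuousAt.congr ?_ (eqB a b).symm
      exact continuousAt_inv_entry (M := fun u => WG.Mx τ p (upd X l p u))
        (fun a b => (RD.Mx H p a b X t ht).1) hdet a b
    have dB : ∀ a b, HasDerivWithinAt (fun u => Bx τ p (upd X l p u) a b)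
        (-((Bx τ p (upd X l p t)) * (Matrix.of fun a b => Dk τ τ' p p (upd X l p t l) a b / d) *
          (Bx τ p (upd X l p t))) a b) (Set.Ioi t) t := fun a b => by
      rw [eqB0]
      refine HasDerivWithinAt.congr_of_eventuallyEq ?_ ((eqB a b).filter_mono nhdsWithin_le_nhds)
        (eqB a b).self_of_nhds
      exact inv_deriv (M := fun u => WG.Mx τ p (upd X l p u))
        (fun a b => (RD.Mx H p a b X t ht).2) hdet a b
    have cBY : ContinuousAt (fun u => BY τ p l (upd X l p u) i) t := by
      have e : (fun u => BY τ p l (upd X l p u) i) =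
          fun u => ∑ b, Bx τ p (upd X l p u) i b * Yv p (X l) b := by
        ext u; unfold BY; rw [Yv_upd_self]; rfl
      rw [e]
      exact tendsto_finsetSum _ fun b _ => (cB i b).mul_const _
    have dBY : HasDerivWithinAt (fun u => BY τ p l (upd X l p u) i)
        (-(τ' (upd X l p t l p) * BY τ p l (upd X l p t) i * YBY τ p l (upd X l p t) / d))
        (Set.Ioi t) t := by
      have h0 : HasDerivWithinAt (fun u => BY τ p l (upd X l p u) i)
        (∑ b, (-((Bx τ p (upd X l p t)) * (Matrix.of fun a b => Dk τ τ' p p (upd X l p t l) a b / d) *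
          (Bx τ p (upd X l p t))) i b) * Yv p (X l) b) (Set.Ioi t) t := by
        have e : (fun u => BY τ p l (upd X l p u) i) =
            fun u => ∑ b, Bx τ p (upd X l p u) i b * Yv p (X l) b := by
          ext u; unfold BY; rw [Yv_upd_self]; rfl
        rw [e]
        exact HasDerivWithinAt.fun_sum fun b _ => (dB i b).mul_const _
      refine h0.congr_deriv ?_
      set B := Bx τ p (upd X l p t) with hB
      have hY : Yv p (X l) = Yv p (upd X l p t l) := (Yv_upd_self _ _ _ _ _).symm
      rw [hY]
      set y := Yv p (upd X l p t l) with hy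
      set D : Matrix (Fin n) (Fin n) ℝ := Matrix.of fun a b => Dk τ τ' p p (upd X l p t l) a b / d with hD
      have e1 : ∑ b, (-(B * D * B) i b) * y b = -((B * D * B).mulVec y i) := by
        simp only [neg_mul, Finset.sum_neg_distrib]; rfl
      rw [e1, ← Matrix.mulVec_mulVec, ← Matrix.mulVec_mulVec]
      have e2 : ∀ v, D.mulVec v = (τ' (upd X l p t l p) / d * ∑ b, y b * v b) • y := by
        intro v; ext a
        show ∑ b, Dk τ τ' p p (upd X l p t l) a b / d * v b = _
        simp only [Dk, if_true, Pi.smul_apply, smul_eq_mul]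
        rw [Finset.mul_sum, Finset.sum_mul]
        refine Finset.sum_congr rfl fun b _ => ?_
        ring
      rw [e2, Matrix.mulVec_smul]
      simp only [Pi.smul_apply, smul_eq_mul]
      have e3 : ∑ b, y b * B.mulVec y b = YBY τ p l (upd X l p t) := rfl
      have e4 : B.mulVec y i = BY τ p l (upd X l p t) i := rfl
      rw [e3, e4]; ring
    exact ⟨cBY.mul cχ, dBY.mul dχ⟩
  · push Not at hS
    have hm : max 0 (1 - 4 * WG.SS τ (upd X l p t)) = 0 := max_eq_left (by linarith)
    have hχ0 : WG.chi τ (upd X l p t) = 0 := by unfold WG.chi; rw [hm]; simp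
    have hχd0 : chid τ (upd X l p t) = 0 := by unfold chid; rw [hm]; simp
    set K := 2 * ∑ a, |Yv p (X l) a| with hK
    have hbd : ∀ u, |BY τ p l (upd X l p u) i| ≤ K := fun u => by
      have := Bx_bound' τ p (upd X l p u) (Yv p (upd X l p u l)) i
      rw [Yv_upd_self] at this
      unfold BY; rw [Yv_upd_self]; exact this
    have hχn : ∀ u, 0 ≤ WG.chi τ (upd X l p u) := fun u => sq_nonneg _
    have hbig : ∀ u, ‖BY τ p l (upd X l p u) i * WG.chi τ (upd X l p u)‖ ≤
        K * ‖WG.chi τ (upd X l p u)‖ := fun u => by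
      rw [norm_mul]; exact mul_le_mul_of_nonneg_right (hbd u) (norm_nonneg _)
    constructor
    · have h0 : Tendsto (fun u => K * ‖WG.chi τ (upd X l p u)‖) (𝓝 t) (𝓝 0) := by
        have := (cχ.norm.const_mul K)
        simpa [ContinuousAt, hχ0] using this
      have := squeeze_zero_norm hbig h0
      simpa [ContinuousAt, hχ0] using this
    · simp only [hχ0, hχd0, mul_zero, zero_mul, add_zero]
      simp only [hχd0, zero_mul] at dχ
      rw [hasDerivWithinAt_iff_isLittleO] at dχ ⊢
      simp only [hχ0, smul_zero, sub_zero, mul_zero] at dχ ⊢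
      exact (Asymptotics.IsBigO.of_bound K (Eventually.of_forall hbig)).trans_isLittleO dχ

end RDs

end WG


namespace WG

section Grs
variable {Ω : Type*} [MeasurableSpace Ω]

/-- polynomial growth with respect to a weight -/
def Gr (Λ : Ω → ℝ) (m : ℕ) (F : Ω → ℝ) : Prop :=
  Measurable F ∧ ∃ C, 0 ≤ C ∧ ∀ ω, |F ω| ≤ C * Λ ω ^ m

structure Wt (P : Measure Ω) (Λ : Ω → ℝ) : Prop where
  one_le : ∀ ω, 1 ≤ Λ ω
  int : Integrable (fun ω => Λ ω ^ 24) P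

variable {P : Measure Ω} {Λ : Ω → ℝ} {m m' : ℕ} {F G : Ω → ℝ}

lemma Gr.mono (hΛ : Wt P Λ) (hF : Gr Λ m F) (h : m ≤ m') : Gr Λ m' F := by
  obtain ⟨hm, C, hC, hb⟩ := hF
  refine ⟨hm, C, hC, fun ω => (hb ω).trans ?_⟩
  exact mul_le_mul_of_nonneg_left (pow_le_pow_right₀ (hΛ.one_le ω) h) hC

lemma Gr.add (hF : Gr Λ m F) (hG : Gr Λ m G) : Gr Λ m (fun ω => F ω + G ω) := by
  obtain ⟨hm, C, hC, hb⟩ := hF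
  obtain ⟨hm', C', hC', hb'⟩ := hG
  refine ⟨hm.add hm', C + C', by positivity, fun ω => (abs_add_le _ _).trans ?_⟩
  rw [add_mul]; exact add_le_add (hb ω) (hb' ω)

lemma Gr.neg (hF : Gr Λ m F) : Gr Λ m (fun ω => - F ω) := by
  obtain ⟨hm, C, hC, hb⟩ := hF
  exact ⟨hm.neg, C, hC, fun ω => by rw [abs_neg]; exact hb ω⟩

lemma Gr.sub (hF : Gr Λ m F) (hG : Gr Λ m G) : Gr Λ m (fun ω => F ω - G ω) := by
  simp only [sub_eq_add_neg]; exact hF.add hG.neg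

lemma Gr.mul (hF : Gr Λ m F) (hG : Gr Λ m' G) : Gr Λ (m + m') (fun ω => F ω * G ω) := by
  obtain ⟨hm, C, hC, hb⟩ := hF
  obtain ⟨hm', C', hC', hb'⟩ := hG
  refine ⟨hm.mul hm', C * C', by positivity, fun ω => ?_⟩
  rw [abs_mul, pow_add]
  calc |F ω| * |G ω| ≤ (C * Λ ω ^ m) * (C' * Λ ω ^ m') :=
        mul_le_mul (hb ω) (hb' ω) (abs_nonneg _) ((abs_nonneg _).trans (hb ω))
    _ = _ := by ring

lemma Gr.mul' (hF : Gr Λ m F) (hG : Gr Λ m' G) {k : ℕ} (hk : m + m' = k) :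
    Gr Λ k (fun ω => F ω * G ω) := hk ▸ hF.mul hG

lemma Gr.sq (hF : Gr Λ m F) {k : ℕ} (hk : m + m = k) : Gr Λ k (fun ω => F ω ^ 2) := by
  simp only [pow_two]; exact hF.mul' hF hk

lemma Gr.const (c : ℝ) : Gr Λ 0 (fun _ => c) :=
  ⟨measurable_const, |c|, abs_nonneg _, fun ω => by simp⟩

lemma Gr.const_mul (hF : Gr Λ m F) (c : ℝ) : Gr Λ m (fun ω => c * F ω) :=
  (Gr.const c).mul' hF (zero_add m)

lemma Gr.div_const (hF : Gr Λ m F) (c : ℝ) : Gr Λ m (fun ω => F ω / c) := by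
  simp only [div_eq_inv_mul]; exact hF.const_mul _

lemma Gr.zero : Gr Λ m (fun _ => 0) :=
  ⟨measurable_const, 0, le_rfl, fun ω => by simp⟩

lemma Gr.sum {α : Type*} {s : Finset α} {F : α → Ω → ℝ} (h : ∀ a ∈ s, Gr Λ m (F a)) :
    Gr Λ m (fun ω => ∑ a ∈ s, F a ω) := by
  classical
  induction s using Finset.induction_on with
  | empty => simpa using Gr.zero
  | insert a s ha ih =>
    simp only [Finset.sum_insert ha]
    exact (h a (by simp)).add (ih fun b hb => h b (by simp [hb]))

lemma Gr.of_bdd (hm : Measurable F) {C : ℝ} (hC : 0 ≤ C) (h : ∀ ω, |F ω| ≤ C) : Gr Λ 0 F :=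
  ⟨hm, C, hC, fun ω => by simpa using h ω⟩

lemma Gr.integrable (hΛ : Wt P Λ) (hF : Gr Λ m F) (h : m ≤ 24) : Integrable F P := by
  obtain ⟨hm, C, hC, hb⟩ := hF.mono hΛ h
  refine (hΛ.int.const_mul C).mono hm.aestronglyMeasurable (Eventually.of_forall fun ω => ?_)
  have : 0 ≤ C * Λ ω ^ 24 := (abs_nonneg _).trans (hb ω)
  rw [Real.norm_eq_abs, Real.norm_of_nonneg this]
  exact hb ω

lemma Gr.congr (hF : Gr Λ m F) (h : ∀ ω, F ω = G ω) : Gr Λ m G := by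
  have : F = G := funext h
  rwa [← this]

end Grs

lemma one_le_prod_real {α : Type*} (s : Finset α) {f : α → ℝ} (h : ∀ a, 1 ≤ f a) :
    1 ≤ ∏ a ∈ s, f a :=
  Finset.prod_induction _ (fun x => 1 ≤ x) (fun _ _ => one_le_mul_of_one_le_of_one_le) le_rfl
    fun a _ => h a

lemma le_prod_real {α : Type*} [Fintype α] {f : α → ℝ} (h : ∀ a, 1 ≤ f a) (a : α) :
    f a ≤ ∏ a, f a := by
  classical
  rw [← Finset.mul_prod_erase _ _ (Finset.mem_univ a)]
  have := one_le_prod_real (Finset.univ.erase a) h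
  have h1 := h a
  nlinarith

section wts
variable {μ : Measure ℝ} [IsProbabilityMeasure μ] {J : Set ℝ} {τ τ' L : ℝ → ℝ}

noncomputable def Lam1 (L : ℝ → ℝ) {n : ℕ} (x : Fin n → ℝ) : ℝ := ∏ a, L (x a)

noncomputable def Lam (L : ℝ → ℝ) {n d : ℕ} (X : Fin d → Fin n → ℝ) : ℝ := ∏ l, Lam1 L (X l)

variable {n d : ℕ}

lemma one_le_Lam1 (H : SD μ J τ τ' L) (x : Fin n → ℝ) : 1 ≤ Lam1 L x :=
  one_le_prod_real _ fun _ => H.one_le _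

lemma le_Lam1 (H : SD μ J τ τ' L) (x : Fin n → ℝ) (a : Fin n) : L (x a) ≤ Lam1 L x :=
  le_prod_real (f := fun a => L (x a)) (fun _ => H.one_le _) a

lemma Lam1_le (H : SD μ J τ τ' L) (X : Fin d → Fin n → ℝ) (l : Fin d) : Lam1 L (X l) ≤ Lam L X :=
  le_prod_real (f := fun l => Lam1 L (X l)) (fun _ => one_le_Lam1 H _) l

lemma le_Lam (H : SD μ J τ τ' L) (X : Fin d → Fin n → ℝ) (l : Fin d) (a : Fin n) :
    L (X l a) ≤ Lam L X := (le_Lam1 H (X l) a).trans (Lam1_le H X l)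

lemma wt1 (H : SD μ J τ τ' L) : Wt (Measure.pi fun _ : Fin n => μ) (Lam1 L) := by
  refine ⟨one_le_Lam1 H, ?_⟩
  simp only [Lam1, ← Finset.prod_pow]
  exact Integrable.fintype_prod (f := fun _ x => L x ^ 24) fun _ => H.L_int

lemma wt (H : SD μ J τ τ' L) : Wt (PP (Fin n) (Fin d) μ) (Lam L) := by
  refine ⟨fun X => one_le_prod_real _ fun _ => one_le_Lam1 H _, ?_⟩
  simp only [Lam, ← Finset.prod_pow]
  exact Integrable.fintype_prod (f := fun _ x => Lam1 L x ^ 24) fun _ => (wt1 H).int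

lemma gr1 (H : SD μ J τ τ' L) {f : ℝ → ℝ} (hf : Measurable f) (hb : ∀ x, |f x| ≤ L x) (a : Fin n) :
    Gr (Lam1 L) 1 (fun x : Fin n → ℝ => f (x a)) :=
  ⟨hf.comp (measurable_pi_apply a), 1, zero_le_one, fun x => by
    rw [one_mul, pow_one]; exact (hb _).trans (le_Lam1 H x a)⟩

lemma gr2 (H : SD μ J τ τ' L) {f : ℝ → ℝ} (hf : Measurable f) (hb : ∀ x, |f x| ≤ L x) (l : Fin d)
    (a : Fin n) : Gr (Lam L) 1 (fun X : Fin d → Fin n → ℝ => f (X l a)) :=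
  ⟨hf.comp (by fun_prop), 1, zero_le_one, fun x => by
    rw [one_mul, pow_one]; exact (hb _).trans (le_Lam H x l a)⟩

lemma SD.abs_τ_le (H : SD μ J τ τ' L) (x : ℝ) : |τ x| ≤ L x := by
  rw [abs_of_nonneg (H.τ_nonneg x)]; exact H.τ_le x

lemma gr_X (H : SD μ J τ τ' L) (l : Fin d) (a : Fin n) :
    Gr (Lam L) 1 (fun X : Fin d → Fin n → ℝ => X l a) := gr2 H measurable_id H.id_le l a

lemma gr_τ (H : SD μ J τ τ' L) (l : Fin d) (a : Fin n) :
    Gr (Lam L) 1 (fun X : Fin d → Fin n → ℝ => τ (X l a)) := gr2 H H.τ_meas H.abs_τ_le l a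

lemma gr_τ' (H : SD μ J τ τ' L) (l : Fin d) (a : Fin n) :
    Gr (Lam L) 1 (fun X : Fin d → Fin n → ℝ => τ' (X l a)) := gr2 H H.τ'_meas H.τ'_le l a

lemma gr_Y (H : SD μ J τ τ' L) (j : Fin n) (l : Fin d) (a : Fin n) :
    Gr (Lam L) 1 (fun X : Fin d → Fin n → ℝ => Yv j (X l) a) := by
  unfold Yv
  split_ifs
  · exact Gr.zero
  · exact gr_X H l a

lemma gr_Mx (H : SD μ J τ τ' L) (j a b : Fin n) :
    Gr (Lam L) 3 (fun X : Fin d → Fin n → ℝ => (Mx τ j X - 1) a b) := by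
  have : ∀ X : Fin d → Fin n → ℝ, (∑ l, τ (X l j) * Yv j (X l) a * Yv j (X l) b) / (d : ℝ) +
      ((if a = b then (if a = j then (1 : ℝ) else 0) ^ 2 else 0) - (1 : Matrix (Fin n) (Fin n) ℝ) a b) =
      (Mx τ j X - 1) a b := fun X => by
    simp only [Mx, Matrix.sub_apply]; ring
  refine Gr.congr (Gr.add (Gr.div_const (Gr.sum fun l _ => ?_) _)
    ((Gr.const _).mono (wt H) (by norm_num))) this
  exact ((gr_τ H l j).mul (gr_Y H j l a)).mul (gr_Y H j l b)

lemma gr_SS (H : SD μ J τ τ' L) : Gr (Lam L) 6 (fun X : Fin d → Fin n → ℝ => SS τ X) := by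
  unfold SS
  exact Gr.sum fun j _ => Gr.sum fun a _ => Gr.sum fun b _ => (gr_Mx H j a b).sq rfl

lemma meas_SS (H : SD μ J τ τ' L) : Measurable (fun X : Fin d → Fin n → ℝ => SS τ X) := (gr_SS H).1

lemma max_le_one' (τ : ℝ → ℝ) (X : Fin d → Fin n → ℝ) : max 0 (1 - 4 * SS τ X) ≤ 1 :=
  max_le zero_le_one (by linarith [SS_nonneg τ X])

lemma chi_nonneg (τ : ℝ → ℝ) (X : Fin d → Fin n → ℝ) : 0 ≤ chi τ X := sq_nonneg _

lemma chi_le_one (τ : ℝ → ℝ) (X : Fin d → Fin n → ℝ) : chi τ X ≤ 1 :=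
  pow_le_one₀ (le_max_left _ _) (max_le_one' τ X)

lemma one_sub_chi_le (τ : ℝ → ℝ) (X : Fin d → Fin n → ℝ) : 1 - chi τ X ≤ 8 * SS τ X := by
  unfold chi
  have := SS_nonneg τ X
  have h1 := le_max_right 0 (1 - 4 * SS τ X)
  have h2 := max_le_one' τ X
  have h0 := le_max_left 0 (1 - 4 * SS τ X)
  nlinarith

lemma abs_chid_le (τ : ℝ → ℝ) (X : Fin d → Fin n → ℝ) : |chid τ X| ≤ 8 := by
  unfold chid
  have h2 := max_le_one' τ X
  have h0 := le_max_left 0 (1 - 4 * SS τ X)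
  rw [abs_le]; constructor <;> linarith

lemma chi_zero (τ : ℝ → ℝ) (X : Fin d → Fin n → ℝ) (h : ¬ SS τ X ≤ 1 / 4) :
    chi τ X = 0 ∧ chid τ X = 0 := by
  have hm : max 0 (1 - 4 * SS τ X) = 0 := max_eq_left (by linarith)
  unfold chi chid; rw [hm]; simp

lemma gr_chi (H : SD μ J τ τ' L) : Gr (Lam L) 0 (fun X : Fin d → Fin n → ℝ => chi τ X) := by
  refine Gr.of_bdd ?_ zero_le_one fun X => ?_
  · unfold chi
    exact (measurable_const.max (measurable_const.sub ((meas_SS H).const_mul 4))).pow_const 2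
  · rw [abs_of_nonneg (chi_nonneg τ X)]; exact chi_le_one τ X

lemma gr_Bx (H : SD μ J τ τ' L) (j a b : Fin n) :
    Gr (Lam L) 0 (fun X : Fin d → Fin n → ℝ => Bx τ j X a b) := by
  refine Gr.of_bdd (C := 2) ?_ (by norm_num) fun X => ?_
  · unfold Bx
    refine Measurable.ite (measurableSet_le (meas_SS H) measurable_const) ?_ measurable_const
    refine measurable_inv_entry (fun a b => ?_) a b
    have : ∀ X : Fin d → Fin n → ℝ, Mx τ j X a b = (Mx τ j X - 1) a b + (1 : Matrix (Fin n) (Fin n) ℝ) a b :=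
      fun X => by simp
    simp only [this]
    exact (gr_Mx H j a b).1.add_const _
  · have := Bx_bound' τ j X (Pi.single b 1) a
    rw [Matrix.mulVec_single_one] at this
    simpa [Pi.single_apply, apply_ite abs] using this

lemma gr_mulVec (H : SD μ J τ τ' L) (j : Fin n) {z : (Fin d → Fin n → ℝ) → Fin n → ℝ} {m : ℕ}
    (hz : ∀ a, Gr (Lam L) m (fun X => z X a)) (i : Fin n) :
    Gr (Lam L) m (fun X => (Bx τ j X).mulVec (z X) i) := by
  show Gr (Lam L) m (fun X => ∑ b, Bx τ j X i b * z X b)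
  exact Gr.sum fun b _ => (gr_Bx H j i b).mul' (hz b) (zero_add m)

lemma gr_BY (H : SD μ J τ τ' L) (p : Fin n) (l : Fin d) (i : Fin n) :
    Gr (Lam L) 1 (fun X : Fin d → Fin n → ℝ => BY τ p l X i) :=
  gr_mulVec H p (fun a => gr_Y H p l a) i

lemma gr_YBY (H : SD μ J τ τ' L) (p : Fin n) (l : Fin d) :
    Gr (Lam L) 2 (fun X : Fin d → Fin n → ℝ => YBY τ p l X) :=
  Gr.sum fun i _ => (gr_Y H p l i).mul (gr_BY H p l i)

lemma gr_w (H : SD μ J τ τ' L) (j a : Fin n) :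
    Gr (Lam L) 2 (fun X : Fin d → Fin n → ℝ => wv j X a) :=
  Gr.div_const (Gr.sum fun l _ => (gr_X H l j).mul (gr_Y H j l a)) _

lemma gr_W (H : SD μ J τ τ' L) (k : {q : Fin n × Fin n // q.1 < q.2}) :
    Gr (Lam L) 2 (fun X : Fin d → Fin n → ℝ => Ww X k) :=
  Gr.div_const (Gr.sum fun l _ => (gr_X H l _).mul (gr_X H l _)) _

lemma gr_ite (H : SD μ J τ τ' L) {m : ℕ} {F : (Fin d → Fin n → ℝ) → ℝ} (q : Prop) [Decidable q]
    (hF : Gr (Lam L) m F) : Gr (Lam L) m (fun X => if q then F X else 0) := by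
  split_ifs
  · exact hF
  · exact Gr.zero

lemma gr_dW (H : SD μ J τ τ' L) (p : Fin n) (l : Fin d) (k : {q : Fin n × Fin n // q.1 < q.2}) :
    Gr (Lam L) 1 (fun X : Fin d → Fin n → ℝ => dW p l X k) :=
  Gr.div_const ((gr_ite H _ (gr_X H l _)).add (gr_ite H _ (gr_X H l _))) _

lemma gr_Dk (H : SD μ J τ τ' L) (p j : Fin n) (l : Fin d) (a b : Fin n) :
    Gr (Lam L) 3 (fun X : Fin d → Fin n → ℝ => Dk τ τ' p j (X l) a b) := by
  unfold Dk
  split_ifs with h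
  · exact ((gr_τ' H l p).mul (gr_Y H j l a)).mul (gr_Y H j l b)
  all_goals
    refine Gr.mono (wt H) (m := 2) ?_ (by norm_num)
    refine (gr_τ H l j).mul' (m' := 1) (Gr.add ?_ ?_) rfl
  all_goals first
    | exact (Gr.const _).mul' (gr_Y H j l b) rfl
    | exact (gr_Y H j l a).mul' (Gr.const _) rfl

lemma gr_chidM (H : SD μ J τ τ' L) (j a b : Fin n) :
    Gr (Lam L) 0 (fun X : Fin d → Fin n → ℝ => chid τ X * (Mx τ j X - 1) a b) := by
  refine Gr.of_bdd (C := 8) ?_ (by norm_num) fun X => ?_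
  · refine Measurable.mul ?_ (gr_Mx H j a b).1
    unfold chid
    exact (measurable_const.max (measurable_const.sub ((meas_SS H).const_mul 4))).const_mul _
  · by_cases h : SS τ X ≤ 1 / 4
    · have h1 : (Mx τ j X - 1) a b ^ 2 ≤ 1 / 4 := by
        refine le_trans ?_ ((block_le τ j X).trans h)
        refine le_trans ?_ (Finset.single_le_sum (f := fun a => ∑ b, (Mx τ j X - 1) a b ^ 2)
          (fun _ _ => Finset.sum_nonneg fun _ _ => sq_nonneg _) (Finset.mem_univ a))
        exact Finset.single_le_sum (f := fun b => (Mx τ j X - 1) a b ^ 2)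
          (fun _ _ => sq_nonneg _) (Finset.mem_univ b)
      have h2 : |(Mx τ j X - 1) a b| ≤ 1 := abs_le_one_iff_mul_self_le_one.mpr (by nlinarith)
      rw [abs_mul]
      calc |chid τ X| * |(Mx τ j X - 1) a b| ≤ 8 * 1 :=
            mul_le_mul (abs_chid_le τ X) h2 (abs_nonneg _) (by norm_num)
        _ = 8 := by norm_num
    · rw [(chi_zero τ X h).2]; simp

lemma gr_chidDS (H : SD μ J τ τ' L) (p : Fin n) (l : Fin d) :
    Gr (Lam L) 3 (fun X : Fin d → Fin n → ℝ => chid τ X * DS τ τ' p l X) := by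
  have : ∀ X : Fin d → Fin n → ℝ, ∑ j, ∑ a, ∑ b, 2 / (d:ℝ) * ((chid τ X * (Mx τ j X - 1) a b) *
      Dk τ τ' p j (X l) a b) = chid τ X * DS τ τ' p l X := fun X => by
    unfold DS
    simp only [Finset.mul_sum]
    refine Finset.sum_congr rfl fun j _ => Finset.sum_congr rfl fun a _ =>
      Finset.sum_congr rfl fun b _ => ?_
    ring
  refine Gr.congr ?_ this
  exact Gr.sum fun j _ => Gr.sum fun a _ => Gr.sum fun b _ =>
    Gr.const_mul ((gr_chidM H j a b).mul' (gr_Dk H p j l a b) rfl) _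

lemma gr_sv (H : SD μ J τ τ' L) (p : Fin n) (l : Fin d) :
    Gr (Lam L) 3 (fun X : Fin d → Fin n → ℝ => sv τ τ' p l X) :=
  Gr.sub (Gr.div_const (((gr_chi H).mul (gr_τ' H l p)).mul' (gr_YBY H p l) rfl) _) (gr_chidDS H p l)

lemma gr_rv (H : SD μ J τ τ' L) (p a : Fin n) :
    Gr (Lam L) 5 (fun X : Fin d → Fin n → ℝ => rv τ τ' p X a) :=
  Gr.div_const (Gr.sum fun l _ => ((gr_τ H l p).mul (gr_sv H p l)).mul' (gr_Y H p l a) rfl) _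

lemma gr_Vv (H : SD μ J τ τ' L) (p i : Fin n) :
    Gr (Lam L) 5 (fun X : Fin d → Fin n → ℝ => Vv τ τ' p X i) := by
  refine Gr.add (Gr.mono (wt H) (m := 2) ?_ (by norm_num)) (gr_mulVec H p (fun a => gr_rv H p a) i)
  exact (gr_chi H).mul' ((gr_mulVec H p (fun a => gr_w H p a) i).sub (gr_w H p i)) rfl

end wts

end WG


namespace WG

section inst
variable {μ : Measure ℝ} [IsProbabilityMeasure μ] {J : Set ℝ} {τ τ' L : ℝ → ℝ} {n d : ℕ}

lemma BX_eq (p : Fin n) (X : Fin d → Fin n → ℝ) (h : SS τ X ≤ 1 / 4) :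
    Bx τ p X = (Mx τ p X)⁻¹ := by ext a b; simp only [Bx, h, if_true]

lemma BM_eq (p : Fin n) (X : Fin d → Fin n → ℝ) (h : SS τ X ≤ 1 / 4) (i a : Fin n) (ha : a ≠ p) :
    ∑ l, τ (X l p) * BY τ p l X i * Yv p (X l) a / d = if i = a then 1 else 0 := by
  have hdet : IsUnit (Mx τ p X).det := det_unit_of_near _ ((block_le τ p _).trans h)
  have h1 : (Bx τ p X * Mx τ p X) i a = (1 : Matrix (Fin n) (Fin n) ℝ) i a := by
    rw [BX_eq p X h, Matrix.nonsing_inv_mul _ hdet]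
  rw [Matrix.one_apply] at h1
  rw [← h1, Matrix.mul_apply]
  have h2 : ∀ c, Mx τ p X c a = (∑ l, τ (X l p) * Yv p (X l) c * Yv p (X l) a) / d := fun c => by
    unfold Mx
    by_cases hc : c = a
    · subst hc; simp [ha]
    · simp [hc]
  simp only [h2]
  have h3 : ∀ l, BY τ p l X i = ∑ c, Bx τ p X i c * Yv p (X l) c := fun l => rfl
  simp only [h3, Finset.sum_div, Finset.mul_sum, Finset.sum_mul]
  rw [Finset.sum_comm]
  refine Finset.sum_congr rfl fun c _ => Finset.sum_congr rfl fun l _ => ?_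
  ring

lemma sum_dW (hd : 0 < d) (X : Fin d → Fin n → ℝ) (h : SS τ X ≤ 1 / 4)
    (k : {q : Fin n × Fin n // q.1 < q.2}) :
    ∑ l, (τ (X l k.1.2) * BY τ k.1.2 l X k.1.1 / √(d : ℝ)) • dW k.1.2 l X = Pi.single k 1 := by
  obtain ⟨⟨i, p⟩, hip⟩ := k
  simp only at hip ⊢
  have hd0 : (0 : ℝ) < d := by exact_mod_cast hd
  have hs : √(d : ℝ) * √(d : ℝ) = d := Real.mul_self_sqrt hd0.le
  have key : ∀ a, a ≠ p → ∑ l, (τ (X l p) * BY τ p l X i / √(d : ℝ)) * (X l a / √(d : ℝ)) =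
      if i = a then 1 else 0 := fun a ha => by
    rw [← BM_eq (τ := τ) p X h i a ha]
    refine Finset.sum_congr rfl fun l _ => ?_
    have : Yv p (X l) a = X l a := by simp [Yv, ha]
    rw [this, div_mul_div_comm, hs]
  ext ⟨⟨a, b⟩, hab⟩
  simp only at hab
  simp only [Finset.sum_apply, Pi.smul_apply, smul_eq_mul, dW, Pi.single_apply, Subtype.mk.injEq,
    Prod.mk.injEq]
  by_cases hb : b = p
  · subst hb
    have ha : a ≠ b := hab.ne
    simp only [ha, if_false, if_true, zero_add, and_true]
    rw [key a ha]
    simp only [eq_comm]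
  · by_cases ha : a = p
    · subst ha
      simp only [hb, if_false, if_true, add_zero, and_false]
      rw [key b hb]
      have : i ≠ b := (hip.trans hab).ne
      simp [this]
    · simp [ha, hb]

lemma Bw_eq (p : Fin n) (X : Fin d → Fin n → ℝ) (i : Fin n) (c : Fin d → ℝ) :
    ∑ l, c l * (BY τ p l X i / √(d : ℝ)) =
      (Bx τ p X).mulVec (fun a => (∑ l, c l * Yv p (X l) a) / √(d : ℝ)) i := by
  show _ = ∑ a, Bx τ p X i a * ((∑ l, c l * Yv p (X l) a) / √(d : ℝ))
  have h3 : ∀ l, BY τ p l X i = ∑ c, Bx τ p X i c * Yv p (X l) c := fun l => rfl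
  simp only [h3, Finset.sum_div, Finset.mul_sum]
  rw [Finset.sum_comm]
  refine Finset.sum_congr rfl fun c _ => Finset.sum_congr rfl fun l _ => ?_
  ring

variable {h : ({q : Fin n × Fin n // q.1 < q.2} → ℝ) → ℝ}

lemma meas_Ww (H : SD μ J τ τ' L) : Measurable (Ww (n := n) (d := d)) :=
  measurable_pi_lambda _ fun k => (gr_W H k).1

lemma gr_h (H : SD μ J τ τ' L) (hh : ContDiff ℝ 1 h) (hb : ∃ C, ∀ w, |h w| ≤ C) :
    Gr (Lam L) 0 (fun X : Fin d → Fin n → ℝ => h (Ww X)) := by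
  obtain ⟨C, hC⟩ := hb
  exact Gr.of_bdd (hh.continuous.measurable.comp (meas_Ww H)) ((abs_nonneg _).trans (hC 0))
    fun X => hC _

lemma gr_Dh (H : SD μ J τ τ' L) (hh : ContDiff ℝ 1 h) (hb : ∃ C, ∀ w, ‖fderiv ℝ h w‖ ≤ C)
    (v : {q : Fin n × Fin n // q.1 < q.2} → ℝ) :
    Gr (Lam L) 0 (fun X : Fin d → Fin n → ℝ => fderiv ℝ h (Ww X) v) := by
  obtain ⟨C, hC⟩ := hb
  have hc : Continuous (fun w => fderiv ℝ h w v) := (hh.continuous_fderiv (by norm_num)).clm_apply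
    continuous_const
  refine Gr.of_bdd (C := C * ‖v‖) (hc.measurable.comp (meas_Ww H))
    (mul_nonneg ((norm_nonneg _).trans (hC 0)) (norm_nonneg _)) fun X => ?_
  exact ((fderiv ℝ h (Ww X)).le_opNorm v).trans (mul_le_mul_of_nonneg_right (hC _) (norm_nonneg _))

lemma gr_DhdW (H : SD μ J τ τ' L) (hh : ContDiff ℝ 1 h) (hb : ∃ C, ∀ w, ‖fderiv ℝ h w‖ ≤ C)
    (p : Fin n) (l : Fin d) :
    Gr (Lam L) 1 (fun X : Fin d → Fin n → ℝ => fderiv ℝ h (Ww X) (dW p l X)) := by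
  refine Gr.congr (F := fun X : Fin d → Fin n → ℝ =>
    ∑ k, dW p l X k * fderiv ℝ h (Ww X) (Pi.single k 1)) ?_ fun X => ?_
  · exact Gr.sum fun k _ => (gr_dW H p l k).mul' (gr_Dh H hh hb _) rfl
  · conv_rhs => rw [pi_eq_sum_univ' (dW p l X), map_sum]
    refine Finset.sum_congr rfl fun k _ => ?_
    rw [map_smul, smul_eq_mul]

/-- integration by parts in one coordinate -/
lemma ibp_coord (H : SD μ J τ τ' L) (l : Fin d) (p : Fin n)
    {G G' : (Fin d → Fin n → ℝ) → ℝ} (hRD : RD J l p G G')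
    (hb : ∀ X, ∃ C, ∀ t, |G (upd X l p t)| ≤ C)
    (h1 : Integrable (fun X => X l p * G X) (PP (Fin n) (Fin d) μ))
    (h2 : Integrable (fun X => τ (X l p) * G' X) (PP (Fin n) (Fin d) μ)) :
    ∫ X, X l p * G X ∂(PP (Fin n) (Fin d) μ) = ∫ X, τ (X l p) * G' X ∂(PP (Fin n) (Fin d) μ) := by
  rw [integral_resample2 μ l p h1, integral_resample2 μ l p h2]
  refine integral_congr_ae ?_
  filter_upwards [ae_integrable_upd μ l p h2] with X hX
  simp only [upd_apply, and_self, if_true] at hX ⊢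
  exact H.ibp _ _ (hb X) (fun t ht => (hRD X t ht).1) (fun t ht => (hRD X t ht).2) hX

lemma chi_pos_imp {X : Fin d → Fin n → ℝ} (h : ¬ SS τ X ≤ 1 / 4) : chi τ X = 0 := by
  unfold chi
  rw [max_eq_left (by push Not at h; linarith)]; norm_num

lemma tvhyp (H : SD μ J τ τ' L) (hd : 0 < d) :
    TVHyp (PP (Fin n) (Fin d) μ) (Ww (n := n) (d := d))
      (fun X k => Vv τ τ' k.1.2 X k.1.1) (chi τ) where
  hW := meas_Ww H
  hV := measurable_pi_lambda _ fun k => (gr_Vv H _ _).1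
  hχ := (gr_chi H).1
  χ0 := fun _ => chi_nonneg _ _
  χ1 := fun _ => chi_le_one _ _
  hWi := fun k => (gr_W H k).integrable (wt H) (by norm_num)
  hVi := fun k => ((gr_Vv H _ _).sq rfl).integrable (wt H) (by norm_num)
  hid := by
    intro k h hh hb hb'
    obtain ⟨⟨i, p⟩, hip⟩ := k
    simp only at hip ⊢
    set G : Fin d → (Fin d → Fin n → ℝ) → ℝ := fun l X =>
      (BY τ p l X i * chi τ X) / √(d : ℝ) * h (Ww X) with hG
    set G' : Fin d → (Fin d → Fin n → ℝ) → ℝ := fun l X =>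
      (-(τ' (X l p) * BY τ p l X i * YBY τ p l X / d) * WG.chi τ X +
        BY τ p l X i * (chid τ X * DS τ τ' p l X)) / √(d : ℝ) * h (Ww X) +
      (BY τ p l X i * chi τ X) / √(d : ℝ) * fderiv ℝ h (Ww X) (dW p l X) with hG'
    have hRD : ∀ l, RD J l p (G l) (G' l) := fun l => ((RD.BYchi H i).div_const _).mul (RD.hW hh)
    have g1 : ∀ l, Gr (Lam L) 2 (fun X : Fin d → Fin n → ℝ => X l p * G l X) := fun l =>
      (gr_X H l p).mul' (m' := 1) ((((gr_BY H p l i).mul' (m' := 0) (gr_chi H) rfl).div_const _).mul'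
        (gr_h H hh hb) rfl) rfl
    have e' : ∀ l X, G' l X = -(BY τ p l X i * sv τ τ' p l X) / √(d : ℝ) * h (Ww X) +
      (BY τ p l X i * chi τ X) / √(d : ℝ) * fderiv ℝ h (Ww X) (dW p l X) := fun l X => by
      simp only [hG', sv]; ring
    have g2 : ∀ l, Gr (Lam L) 5 (fun X : Fin d → Fin n → ℝ => τ (X l p) * G' l X) := fun l => by
      simp only [e']
      refine (gr_τ H l p).mul' (m' := 4) (Gr.add ?_ ?_) rfl
      · exact (((gr_BY H p l i).mul' (m' := 3) (gr_sv H p l) rfl).neg.div_const _).mul' (gr_h H hh hb) rfl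
      · refine Gr.mono (wt H) (m := 2) ?_ (by norm_num)
        exact (((gr_BY H p l i).mul' (m' := 0) (gr_chi H) rfl).div_const _).mul' (gr_DhdW H hh hb' p l) rfl
    have hibp : ∀ l, ∫ X, X l p * G l X ∂(PP (Fin n) (Fin d) μ) =
        ∫ X, τ (X l p) * G' l X ∂(PP (Fin n) (Fin d) μ) := fun l => by
      refine ibp_coord H l p (hRD l) (fun X => ?_) ((g1 l).integrable (wt H) (by norm_num))
        ((g2 l).integrable (wt H) (by norm_num))
      obtain ⟨C, hC⟩ := hb
      have hC0 : 0 ≤ C := (abs_nonneg _).trans (hC 0)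
      refine ⟨(2 * ∑ a, |Yv p (X l) a|) * 1 / √(d : ℝ) * C, fun t => ?_⟩
      simp only [hG]
      rw [abs_mul, abs_div, abs_mul, abs_of_nonneg (Real.sqrt_nonneg _)]
      have hB : |BY τ p l (upd X l p t) i| ≤ 2 * ∑ a, |Yv p (X l) a| := by
        have := Bx_bound' τ p (upd X l p t) (Yv p (upd X l p t l)) i
        have e : (Bx τ p (upd X l p t)).mulVec (Yv p (upd X l p t l)) i = BY τ p l (upd X l p t) i := rfl
        rwa [e, Yv_upd_self] at this
      have hc : |chi τ (upd X l p t)| ≤ 1 := by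
        rw [abs_of_nonneg (chi_nonneg _ _)]; exact chi_le_one _ _
      gcongr
      exact hC _
    have gV : Gr (Lam L) 5 (fun X : Fin d → Fin n → ℝ => Vv τ τ' p X i * h (Ww X)) :=
      (gr_Vv H p i).mul' (gr_h H hh hb) rfl
    have gD : Gr (Lam L) 0 (fun X : Fin d → Fin n → ℝ =>
      chi τ X * fderiv ℝ h (Ww X) (Pi.single ⟨(i, p), hip⟩ 1)) :=
      (gr_chi H).mul' (gr_Dh H hh hb' _) rfl
    have gW : Gr (Lam L) 2 (fun X : Fin d → Fin n → ℝ =>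
      chi τ X * Ww X ⟨(i, p), hip⟩ * h (Ww X)) :=
      ((gr_chi H).mul' (gr_W H _) (zero_add 2)).mul' (gr_h H hh hb) rfl
    have iV := gV.integrable (wt H) (by norm_num)
    have iD := gD.integrable (wt H) (by norm_num)
    have iW := gW.integrable (wt H) (by norm_num)
    have pw : ∀ X : Fin d → Fin n → ℝ, Vv τ τ' p X i * h (Ww X) -
        (chi τ X * fderiv ℝ h (Ww X) (Pi.single ⟨(i, p), hip⟩ 1) -
          chi τ X * Ww X ⟨(i, p), hip⟩ * h (Ww X)) =
        ∑ l, X l p * G l X - ∑ l, τ (X l p) * G' l X := fun X => by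
      have s1 : ∑ l, X l p * G l X = (Bx τ p X).mulVec (wv p X) i * chi τ X * h (Ww X) := by
        have := Bw_eq (τ := τ) p X i (fun l => X l p)
        have e : (fun a => (∑ l, X l p * Yv p (X l) a) / √(d : ℝ)) = wv p X := rfl
        rw [e] at this
        rw [← this, Finset.sum_mul, Finset.sum_mul]
        refine Finset.sum_congr rfl fun l _ => ?_
        simp only [hG]; ring
      have s2 : ∑ l, τ (X l p) * G' l X = -((Bx τ p X).mulVec (rv τ τ' p X) i * h (Ww X)) +
          chi τ X * fderiv ℝ h (Ww X) (Pi.single ⟨(i, p), hip⟩ 1) := by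
        have := Bw_eq (τ := τ) p X i (fun l => τ (X l p) * sv τ τ' p l X)
        have e : (fun a => (∑ l, τ (X l p) * sv τ τ' p l X * Yv p (X l) a) / √(d : ℝ)) =
          rv τ τ' p X := rfl
        rw [e] at this
        have s3 : chi τ X * fderiv ℝ h (Ww X) (Pi.single ⟨(i, p), hip⟩ 1) =
            chi τ X * ∑ l, (τ (X l p) * BY τ p l X i / √(d : ℝ)) * fderiv ℝ h (Ww X) (dW p l X) := by
          by_cases hS : SS τ X ≤ 1 / 4
          · have h4 := sum_dW (τ := τ) hd X hS ⟨(i, p), hip⟩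
            simp only at h4
            rw [← h4, map_sum]
            simp only [map_smul, smul_eq_mul]
          · rw [chi_pos_imp hS, zero_mul, zero_mul]
        rw [s3, ← this, Finset.sum_mul, Finset.mul_sum, ← Finset.sum_neg_distrib,
          ← Finset.sum_add_distrib]
        refine Finset.sum_congr rfl fun l _ => ?_
        rw [e']; ring
      have s4 : wv p X i = Ww X ⟨(i, p), hip⟩ := by
        simp only [wv, Ww]
        congr 1
        refine Finset.sum_congr rfl fun l _ => ?_
        have : Yv p (X l) i = X l i := by simp [Yv, hip.ne]
        rw [this, mul_comm]
      rw [s1, s2, ← s4, Vv]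
      ring
    have i1 : ∀ l, Integrable (fun X : Fin d → Fin n → ℝ => X l p * G l X) (PP (Fin n) (Fin d) μ) :=
      fun l => (g1 l).integrable (wt H) (by norm_num)
    have i2 : ∀ l, Integrable (fun X : Fin d → Fin n → ℝ => τ (X l p) * G' l X) (PP (Fin n) (Fin d) μ) :=
      fun l => (g2 l).integrable (wt H) (by norm_num)
    have fin : ∫ X, (Vv τ τ' p X i * h (Ww X) -
        (chi τ X * fderiv ℝ h (Ww X) (Pi.single ⟨(i, p), hip⟩ 1) -
          chi τ X * Ww X ⟨(i, p), hip⟩ * h (Ww X))) ∂(PP (Fin n) (Fin d) μ) = 0 := by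
      simp only [pw]
      rw [integral_sub (integrable_finsetSum _ fun l _ => i1 l) (integrable_finsetSum _ fun l _ => i2 l),
        integral_finsetSum _ (fun l _ => i1 l), integral_finsetSum _ (fun l _ => i2 l)]
      simp only [hibp, sub_self]
    have iDW : Integrable (fun X : Fin d → Fin n → ℝ =>
        chi τ X * fderiv ℝ h (Ww X) (Pi.single ⟨(i, p), hip⟩ 1) -
          chi τ X * Ww X ⟨(i, p), hip⟩ * h (Ww X)) (PP (Fin n) (Fin d) μ) := iD.sub iW
    rw [integral_sub iV iDW, integral_sub iD iW] at fin
    linarith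

end inst

end WG


namespace WG

section det
variable {τ τ' : ℝ → ℝ} {n d : ℕ}

/-- squared deviation of the linear part -/
noncomputable def Zs (τ : ℝ → ℝ) (p : Fin n) (X : Fin d → Fin n → ℝ) : ℝ :=
  ∑ a, ((Mx τ p X - 1).mulVec (wv p X) a) ^ 2

noncomputable def Qs (p : Fin n) (x : Fin n → ℝ) : ℝ := ∑ a, Yv p x a ^ 2

def Ks (τ τ' : ℝ → ℝ) (p : Fin n) (x : Fin n → ℝ) : ℝ := ∑ j, ∑ a, ∑ b, Dk τ τ' p j x a b ^ 2

lemma YBY_sq (p : Fin n) (l : Fin d) (X : Fin d → Fin n → ℝ) :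
    YBY τ p l X ^ 2 ≤ 4 * Qs p (X l) ^ 2 := by
  have h1 : YBY τ p l X ^ 2 ≤ (∑ i, Yv p (X l) i ^ 2) * ∑ i, BY τ p l X i ^ 2 :=
    Finset.sum_mul_sq_le_sq_mul_sq _ _ _
  have h2 : ∑ i, BY τ p l X i ^ 2 ≤ 4 * ∑ i, Yv p (X l) i ^ 2 := Bx_bound τ p X (Yv p (X l))
  have h3 : 0 ≤ Qs p (X l) := Finset.sum_nonneg fun _ _ => sq_nonneg _
  unfold Qs at *
  nlinarith

lemma DS_sq (hd : 0 < d) (p : Fin n) (l : Fin d) (X : Fin d → Fin n → ℝ) (h : SS τ X ≤ 1 / 4) :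
    DS τ τ' p l X ^ 2 ≤ Ks τ τ' p (X l) / d ^ 2 := by
  have hd0 : (0 : ℝ) < d := by exact_mod_cast hd
  have e1 : DS τ τ' p l X = ∑ q : Fin n × Fin n × Fin n,
      (2 * (Mx τ q.1 X - 1) q.2.1 q.2.2) * (Dk τ τ' p q.1 (X l) q.2.1 q.2.2 / d) := by
    simp only [Fintype.sum_prod_type, DS]
  have h1 : DS τ τ' p l X ^ 2 ≤ (∑ q : Fin n × Fin n × Fin n, (2 * (Mx τ q.1 X - 1) q.2.1 q.2.2) ^ 2) *
      ∑ q : Fin n × Fin n × Fin n, (Dk τ τ' p q.1 (X l) q.2.1 q.2.2 / d) ^ 2 := by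
    rw [e1]; exact Finset.sum_mul_sq_le_sq_mul_sq _ _ _
  have e2 : ∑ q : Fin n × Fin n × Fin n, (2 * (Mx τ q.1 X - 1) q.2.1 q.2.2) ^ 2 = 4 * SS τ X := by
    simp only [Fintype.sum_prod_type, SS, mul_pow, Finset.mul_sum]; norm_num
  have e3 : ∑ q : Fin n × Fin n × Fin n, (Dk τ τ' p q.1 (X l) q.2.1 q.2.2 / d) ^ 2 =
      Ks τ τ' p (X l) / d ^ 2 := by
    simp only [Fintype.sum_prod_type, Ks, div_pow, Finset.sum_div]
  rw [e2, e3] at h1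
  have h3 : 0 ≤ Ks τ τ' p (X l) / d ^ 2 := by
    rw [← e3]; exact Finset.sum_nonneg fun _ _ => sq_nonneg _
  nlinarith

lemma sv_sq (hd : 0 < d) (p : Fin n) (l : Fin d) (X : Fin d → Fin n → ℝ) (h : SS τ X ≤ 1 / 4) :
    sv τ τ' p l X ^ 2 ≤ (8 * τ' (X l p) ^ 2 * Qs p (X l) ^ 2 + 128 * Ks τ τ' p (X l)) / d ^ 2 := by
  have hd0 : (0 : ℝ) < d := by exact_mod_cast hd
  have h1 := YBY_sq (τ := τ) p l X
  have h2 := DS_sq (τ' := τ') hd p l X h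
  have h3 : chid τ X ^ 2 ≤ 64 := by
    have := abs_chid_le τ X
    rw [← sq_abs]; nlinarith [abs_nonneg (chid τ X)]
  have h4 : chi τ X ^ 2 ≤ 1 := by
    have := chi_le_one τ X
    have := chi_nonneg τ X
    nlinarith
  have h5 : (chi τ X * τ' (X l p) * YBY τ p l X / d) ^ 2 ≤
      4 * τ' (X l p) ^ 2 * Qs p (X l) ^ 2 / d ^ 2 := by
    rw [div_pow]
    gcongr
    rw [mul_pow, mul_pow]
    calc chi τ X ^ 2 * τ' (X l p) ^ 2 * YBY τ p l X ^ 2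
        ≤ 1 * τ' (X l p) ^ 2 * (4 * Qs p (X l) ^ 2) := by gcongr
      _ = _ := by ring
  have h6 : (chid τ X * DS τ τ' p l X) ^ 2 ≤ 64 * (Ks τ τ' p (X l) / d ^ 2) := by
    rw [mul_pow]; gcongr
  have h7 : sv τ τ' p l X ^ 2 ≤ 2 * (chi τ X * τ' (X l p) * YBY τ p l X / d) ^ 2 +
      2 * (chid τ X * DS τ τ' p l X) ^ 2 := by
    unfold sv
    nlinarith [sq_nonneg (chi τ X * τ' (X l p) * YBY τ p l X / d + chid τ X * DS τ τ' p l X)]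
  refine h7.trans ?_
  calc _ ≤ 2 * (4 * τ' (X l p) ^ 2 * Qs p (X l) ^ 2 / d ^ 2) +
        2 * (64 * (Ks τ τ' p (X l) / d ^ 2)) := by gcongr
    _ = _ := by ring

lemma V_sq (hd : 0 < d) (hτ : ∀ x, 0 ≤ τ x) (p : Fin n) (X : Fin d → Fin n → ℝ) :
    ∑ i, Vv τ τ' p X i ^ 2 ≤ 8 * Zs τ p X + 12 * ∑ l, τ (X l p) *
      ((8 * τ' (X l p) ^ 2 * Qs p (X l) ^ 2 + 128 * Ks τ τ' p (X l)) / d ^ 2) := by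
  have hd0 : (0 : ℝ) < d := by exact_mod_cast hd
  by_cases h : SS τ X ≤ 1 / 4
  · have hdet : IsUnit (Mx τ p X).det := det_unit_of_near _ ((block_le τ p _).trans h)
    have hBM : Bx τ p X * Mx τ p X = 1 := by rw [BX_eq p X h, Matrix.nonsing_inv_mul _ hdet]
    set z := (Mx τ p X - 1).mulVec (wv p X) with hz
    have e1 : ∀ i, (Bx τ p X).mulVec (wv p X) i - wv p X i = - (Bx τ p X).mulVec z i := fun i => by
      have : (Bx τ p X).mulVec z = wv p X - (Bx τ p X).mulVec (wv p X) := by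
        rw [hz, Matrix.mulVec_mulVec, mul_sub, hBM, mul_one, Matrix.sub_mulVec, Matrix.one_mulVec]
      rw [this]; simp
    have h4 : chi τ X ^ 2 ≤ 1 := by
      have := chi_le_one τ X
      have := chi_nonneg τ X
      nlinarith
    have e2 : ∀ i, Vv τ τ' p X i ^ 2 ≤ 2 * ((Bx τ p X).mulVec z i) ^ 2 +
        2 * ((Bx τ p X).mulVec (rv τ τ' p X) i) ^ 2 := fun i => by
      unfold Vv
      rw [e1]
      have : chi τ X ^ 2 * ((Bx τ p X).mulVec z i) ^ 2 ≤ 1 * ((Bx τ p X).mulVec z i) ^ 2 := by gcongr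
      nlinarith [sq_nonneg (chi τ X * -(Bx τ p X).mulVec z i - (Bx τ p X).mulVec (rv τ τ' p X) i)]
    have e3 := Bx_bound τ p X z
    have e4 := Bx_bound τ p X (rv τ τ' p X)
    have e5 : ∑ a, rv τ τ' p X a ^ 2 ≤ 3 / 2 * ∑ l, τ (X l p) * sv τ τ' p l X ^ 2 :=
      r_bound (Mx τ p X) ((block_le τ p _).trans h) d hd0 (fun l => τ (X l p))
        (fun l => sv τ τ' p l X) (fun l => hτ _) (fun l => Yv p (X l))
        (fun a => if a = p then (1 : ℝ) else 0) (fun a b => rfl) _ (fun a => rfl)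
    have e6 : ∑ l, τ (X l p) * sv τ τ' p l X ^ 2 ≤ ∑ l, τ (X l p) *
      ((8 * τ' (X l p) ^ 2 * Qs p (X l) ^ 2 + 128 * Ks τ τ' p (X l)) / d ^ 2) :=
      Finset.sum_le_sum fun l _ => mul_le_mul_of_nonneg_left (sv_sq hd p l X h) (hτ _)
    have e7 : ∑ i, Vv τ τ' p X i ^ 2 ≤ 2 * ∑ i, ((Bx τ p X).mulVec z i) ^ 2 +
        2 * ∑ i, ((Bx τ p X).mulVec (rv τ τ' p X) i) ^ 2 := by
      rw [Finset.mul_sum, Finset.mul_sum, ← Finset.sum_add_distrib]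
      exact Finset.sum_le_sum fun i _ => e2 i
    have e8 : Zs τ p X = ∑ a, z a ^ 2 := rfl
    rw [e8]
    linarith
  · have hB : Bx τ p X = 0 := by ext a b; simp only [Bx, h, if_false, Matrix.zero_apply]
    have e0 : ∀ i, Vv τ τ' p X i = 0 := fun i => by
      unfold Vv; rw [(chi_zero τ X h).1, hB]; simp
    simp only [e0]
    have h1 : 0 ≤ Zs τ p X := Finset.sum_nonneg fun _ _ => sq_nonneg _
    have h2 : ∀ l, 0 ≤ τ (X l p) *
      ((8 * τ' (X l p) ^ 2 * Qs p (X l) ^ 2 + 128 * Ks τ τ' p (X l)) / d ^ 2) := fun l => by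
      have := hτ (X l p)
      have : 0 ≤ Ks τ τ' p (X l) := Finset.sum_nonneg fun _ _ => Finset.sum_nonneg fun _ _ =>
        Finset.sum_nonneg fun _ _ => sq_nonneg _
      positivity
    have h3 := Finset.sum_nonneg fun l (_ : l ∈ Finset.univ) => h2 l
    simp only [ne_eq, OfNat.ofNat_ne_zero, not_false_eq_true, zero_pow, Finset.sum_const_zero]
    linarith

end det

end WG


namespace WG

section mom
variable {μ : Measure ℝ} [IsProbabilityMeasure μ] {J : Set ℝ} {τ τ' L : ℝ → ℝ} {n d : ℕ}

lemma mp_entry (μ : Measure ℝ) [IsProbabilityMeasure μ] (l : Fin d) (a : Fin n) :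
    MeasurePreserving (fun X : Fin d → Fin n → ℝ => X l a) (PP (Fin n) (Fin d) μ) μ :=
  (measurePreserving_eval (fun _ : Fin n => μ) a).comp
    (measurePreserving_eval (fun _ : Fin d => Measure.pi fun _ : Fin n => μ) l)

lemma int_entry (H : SD μ J τ τ' L) (l : Fin d) (a : Fin n) :
    Integrable (fun X : Fin d → Fin n → ℝ => L (X l a) ^ 24) (PP (Fin n) (Fin d) μ) :=
  (mp_entry μ l a).integrable_comp_of_integrable H.L_int

lemma E_entry (H : SD μ J τ τ' L) (l : Fin d) (a : Fin n) :
    ∫ X : Fin d → Fin n → ℝ, L (X l a) ^ 24 ∂(PP (Fin n) (Fin d) μ) = ∫ x, L x ^ 24 ∂μ := by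
  have h := mp_entry (n := n) μ l a
  have h2 : AEStronglyMeasurable (fun x => L x ^ 24)
    (Measure.map (fun X : Fin d → Fin n → ℝ => X l a) (PP (Fin n) (Fin d) μ)) := by
    rw [h.map_eq]; exact H.L_int.1
  conv_rhs => rw [← h.map_eq]
  rw [integral_map h.measurable.aemeasurable h2]

/-- moment bound via the maximum of five entries -/
lemma E5 (H : SD μ J τ τ' L) {F : (Fin d → Fin n → ℝ) → ℝ} (l l' : Fin d) (a b c a' b' : Fin n)
    {K : ℝ} (hK : 0 ≤ K) (h0 : ∀ X, 0 ≤ F X)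
    (h : ∀ X m, 1 ≤ m → L (X l a) ≤ m → L (X l b) ≤ m → L (X l c) ≤ m → L (X l' a') ≤ m →
      L (X l' b') ≤ m → F X ≤ K * m ^ 24) :
    ∫ X, F X ∂(PP (Fin n) (Fin d) μ) ≤ K * (5 * ∫ x, L x ^ 24 ∂μ) := by
  have hi := int_entry (n := n) (d := d) H
  have hI : Integrable (fun X : Fin d → Fin n → ℝ => K * (L (X l a) ^ 24 + L (X l b) ^ 24 + L (X l c) ^ 24 +
      L (X l' a') ^ 24 + L (X l' b') ^ 24)) (PP (Fin n) (Fin d) μ) :=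
    (((((hi l a).add (hi l b)).add (hi l c)).add (hi l' a')).add (hi l' b')).const_mul K
  have key : ∀ X, F X ≤ K * (L (X l a) ^ 24 + L (X l b) ^ 24 + L (X l c) ^ 24 +
      L (X l' a') ^ 24 + L (X l' b') ^ 24) := fun X => by
    have p1 : ∀ x, 0 ≤ L x ^ 24 := fun x => pow_nonneg (zero_le_one.trans (H.one_le x)) _
    have P : ∀ m, (m = L (X l a) ∨ m = L (X l b) ∨ m = L (X l c) ∨ m = L (X l' a') ∨ m = L (X l' b')) →
        m ^ 24 ≤ L (X l a) ^ 24 + L (X l b) ^ 24 + L (X l c) ^ 24 +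
      L (X l' a') ^ 24 + L (X l' b') ^ 24 := by
      have := p1 (X l a)
      have := p1 (X l b)
      have := p1 (X l c)
      have := p1 (X l' a')
      have := p1 (X l' b')
      rintro m (h | h | h | h | h) <;> rw [h] <;> linarith
    set M := max (L (X l a)) (max (L (X l b)) (max (L (X l c)) (max (L (X l' a')) (L (X l' b'))))) with hM
    have hMm : M = L (X l a) ∨ M = L (X l b) ∨ M = L (X l c) ∨ M = L (X l' a') ∨ M = L (X l' b') := by
      rw [hM]
      rcases max_choice (L (X l a)) (max (L (X l b)) (max (L (X l c)) (max (L (X l' a')) (L (X l' b'))))) with h | h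
      · exact Or.inl h
      rw [h]
      rcases max_choice (L (X l b)) (max (L (X l c)) (max (L (X l' a')) (L (X l' b')))) with h | h
      · exact Or.inr (Or.inl h)
      rw [h]
      rcases max_choice (L (X l c)) (max (L (X l' a')) (L (X l' b'))) with h | h
      · exact Or.inr (Or.inr (Or.inl h))
      rw [h]
      rcases max_choice (L (X l' a')) (L (X l' b')) with h | h
      · exact Or.inr (Or.inr (Or.inr (Or.inl h)))
      · exact Or.inr (Or.inr (Or.inr (Or.inr h)))
    refine (h X M ((H.one_le (X l a)).trans (le_max_left _ _)) (by simp [hM]) (by simp [hM])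
      (by simp [hM]) (by simp [hM]) (by simp [hM])).trans ?_
    exact mul_le_mul_of_nonneg_left (P M hMm) hK
  refine (integral_mono_of_nonneg (Eventually.of_forall h0) hI (Eventually.of_forall key)).trans ?_
  have j2 := (hi l a).fun_add (hi l b)
  have j3 := j2.fun_add (hi l c)
  have j4 := j3.fun_add (hi l' a')
  rw [integral_const_mul, integral_add j4 (hi l' b'), integral_add j3 (hi l' a'),
    integral_add j2 (hi l c), integral_add (hi l a) (hi l b)]
  simp only [E_entry H]
  refine le_of_eq ?_
  ring

lemma pow_le_24 {m : ℝ} (hm : 1 ≤ m) {k : ℕ} (hk : k ≤ 24) : m ^ k ≤ m ^ 24 :=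
  pow_le_pow_right₀ hm hk

lemma Yv_abs_le (H : SD μ J τ τ' L) (j : Fin n) (x : Fin n → ℝ) (a : Fin n) {m : ℝ} (hm : 1 ≤ m)
    (h : L (x a) ≤ m) : |Yv j x a| ≤ m := by
  unfold Yv
  split_ifs
  · simp; linarith
  · exact (H.id_le _).trans h

lemma abs_sq_le {x m : ℝ} (h : |x| ≤ m) : x ^ 2 ≤ m ^ 2 := by
  rw [← sq_abs]; exact pow_le_pow_left₀ (abs_nonneg _) h 2

lemma E_Q (H : SD μ J τ τ' L) (p : Fin n) (l : Fin d) (a : Fin n) :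
    ∫ X : Fin d → Fin n → ℝ, τ (X l p) * τ' (X l p) ^ 2 * Yv p (X l) a ^ 4 ∂(PP (Fin n) (Fin d) μ) ≤
      1 * (5 * ∫ x, L x ^ 24 ∂μ) := by
  refine E5 H l l p a a a a zero_le_one (fun X => ?_) fun X m hm h1 h2 _ _ _ => ?_
  · have := H.τ_nonneg (X l p)
    positivity
  · have t1 : τ (X l p) ≤ m := (H.τ_le _).trans h1
    have t2 : τ' (X l p) ^ 2 ≤ m ^ 2 := abs_sq_le ((H.τ'_le _).trans h1)
    have t3 : Yv p (X l) a ^ 4 ≤ m ^ 4 := by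
      have := abs_sq_le (Yv_abs_le H p (X l) a hm h2)
      have := pow_le_pow_left₀ (sq_nonneg _) this 2
      calc _ = (Yv p (X l) a ^ 2) ^ 2 := by ring
        _ ≤ _ := this
        _ = _ := by ring
    calc _ ≤ m * m ^ 2 * m ^ 4 := by
          gcongr
      _ = m ^ 7 := by ring
      _ ≤ 1 * m ^ 24 := by rw [one_mul]; exact pow_le_24 hm (by norm_num)

/-- counting coefficients -/
def cc (p j a b : Fin n) : ℝ :=
  (if p = j then 1 else 0) + 2 * ((if a = p then 1 else 0) + (if b = p then 1 else 0))

lemma cc_nonneg (p j a b : Fin n) : 0 ≤ cc p j a b := by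
  unfold cc; positivity

lemma sum_cc (p : Fin n) : ∑ j, ∑ a, ∑ b, cc p j a b = 5 * (n : ℝ) ^ 2 := by
  unfold cc
  simp [Finset.sum_add_distrib, ← Finset.mul_sum]
  ring

lemma E_D (H : SD μ J τ τ' L) (p : Fin n) (l : Fin d) (j a b : Fin n) :
    ∫ X : Fin d → Fin n → ℝ, τ (X l p) * Dk τ τ' p j (X l) a b ^ 2 ∂(PP (Fin n) (Fin d) μ) ≤
      cc p j a b * (5 * ∫ x, L x ^ 24 ∂μ) := by
  refine E5 H l l p a b j j (cc_nonneg _ _ _ _) (fun X => ?_) fun X m hm h1 h2 h3 h4 _ => ?_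
  · have := H.τ_nonneg (X l p)
    positivity
  · have m0 : 0 ≤ m := by linarith
    have t1 : τ (X l p) ≤ m := (H.τ_le _).trans h1
    have t0 := H.τ_nonneg (X l p)
    have t2 : τ' (X l p) ^ 2 ≤ m ^ 2 := abs_sq_le ((H.τ'_le _).trans h1)
    have t3 : Yv j (X l) a ^ 2 ≤ m ^ 2 := abs_sq_le (Yv_abs_le H j (X l) a hm h2)
    have t4 : Yv j (X l) b ^ 2 ≤ m ^ 2 := abs_sq_le (Yv_abs_le H j (X l) b hm h3)
    have t5 : τ (X l j) ^ 2 ≤ m ^ 2 := abs_sq_le ((H.abs_τ_le _).trans h4)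
    have key : Dk τ τ' p j (X l) a b ^ 2 ≤ cc p j a b * m ^ 6 := by
      unfold Dk cc
      by_cases hpj : p = j
      · simp only [hpj, if_true]
        rw [hpj] at t2
        calc _ = τ' (X l j) ^ 2 * Yv j (X l) a ^ 2 * Yv j (X l) b ^ 2 := by ring
          _ ≤ m ^ 2 * m ^ 2 * m ^ 2 := by gcongr
          _ = 1 * m ^ 6 := by ring
          _ ≤ _ := by gcongr; simp only [le_add_iff_nonneg_right]; positivity
      · simp only [hpj, if_false, zero_add]
        have m46 : m ^ 4 ≤ m ^ 6 := pow_le_pow_right₀ hm (by norm_num)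
        have i1 : ∀ q : Prop, ∀ [Decidable q], ((if q then (1:ℝ) else 0) ^ 2 = if q then 1 else 0) := by
          intro q _; split_ifs <;> norm_num
        have i2 : ∀ q : Prop, ∀ [Decidable q], (0 : ℝ) ≤ if q then 1 else 0 := by
          intro q _; split_ifs <;> norm_num
        set u : ℝ := if a = p then 1 else 0 with hu
        set v : ℝ := if b = p then 1 else 0 with hv
        have hu2 : u ^ 2 = u := i1 _
        have hv2 : v ^ 2 = v := i1 _
        have hu0 : 0 ≤ u := i2 _
        have hv0 : 0 ≤ v := i2 _
        have s1 : (u * Yv j (X l) b + Yv j (X l) a * v) ^ 2 ≤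
            2 * (u * Yv j (X l) b ^ 2 + v * Yv j (X l) a ^ 2) := by
          have := sq_nonneg (u * Yv j (X l) b - Yv j (X l) a * v)
          calc _ ≤ 2 * (u ^ 2 * Yv j (X l) b ^ 2 + v ^ 2 * Yv j (X l) a ^ 2) := by nlinarith
            _ = _ := by rw [hu2, hv2]
        calc (τ (X l j) * (u * Yv j (X l) b + Yv j (X l) a * v)) ^ 2
            = τ (X l j) ^ 2 * (u * Yv j (X l) b + Yv j (X l) a * v) ^ 2 := by ring
          _ ≤ m ^ 2 * (2 * (u * m ^ 2 + v * m ^ 2)) := by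
              refine mul_le_mul t5 (s1.trans ?_) (sq_nonneg _) (by positivity)
              gcongr
          _ = 2 * (u + v) * m ^ 4 := by ring
          _ ≤ _ := by gcongr
    calc _ ≤ m * (cc p j a b * m ^ 6) := by
          gcongr
      _ = cc p j a b * m ^ 7 := by ring
      _ ≤ cc p j a b * m ^ 24 := mul_le_mul_of_nonneg_left (pow_le_24 hm (by norm_num)) (cc_nonneg _ _ _ _)

lemma E_second (H : SD μ J τ τ' L) (p : Fin n) (l : Fin d) :
    Integrable (fun X : Fin d → Fin n → ℝ => τ (X l p) *
      ((8 * τ' (X l p) ^ 2 * Qs p (X l) ^ 2 + 128 * Ks τ τ' p (X l)) / d ^ 2)) (PP (Fin n) (Fin d) μ) ∧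
    ∫ X : Fin d → Fin n → ℝ, τ (X l p) *
      ((8 * τ' (X l p) ^ 2 * Qs p (X l) ^ 2 + 128 * Ks τ τ' p (X l)) / d ^ 2) ∂(PP (Fin n) (Fin d) μ) ≤
      3240 * (∫ x, L x ^ 24 ∂μ) * (n : ℝ) ^ 2 / d ^ 2 := by
  have iQ : ∀ a, Integrable (fun X : Fin d → Fin n → ℝ =>
      τ (X l p) * τ' (X l p) ^ 2 * Yv p (X l) a ^ 4) (PP (Fin n) (Fin d) μ) := fun a => by
    refine Gr.integrable (wt H) (m := 7) ?_ (by norm_num)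
    refine ((gr_τ H l p).mul' ((gr_τ' H l p).sq rfl) rfl).mul' (m' := 4) ?_ rfl
    refine Gr.congr (((gr_Y H p l a).sq (k := 2) rfl).sq (k := 4) rfl) fun X => ?_
    ring
  have iD : ∀ j a b, Integrable (fun X : Fin d → Fin n → ℝ =>
      τ (X l p) * Dk τ τ' p j (X l) a b ^ 2) (PP (Fin n) (Fin d) μ) := fun j a b =>
    Gr.integrable (wt H) (m := 7) ((gr_τ H l p).mul' ((gr_Dk H p j l a b).sq rfl) rfl) (by norm_num)
  have iQs : Integrable (fun X : Fin d → Fin n → ℝ => ∑ a,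
      τ (X l p) * τ' (X l p) ^ 2 * Yv p (X l) a ^ 4) (PP (Fin n) (Fin d) μ) :=
    integrable_finsetSum _ fun a _ => iQ a
  have iDs : Integrable (fun X : Fin d → Fin n → ℝ => ∑ j, ∑ a, ∑ b,
      τ (X l p) * Dk τ τ' p j (X l) a b ^ 2) (PP (Fin n) (Fin d) μ) :=
    integrable_finsetSum _ fun j _ => integrable_finsetSum _ fun a _ =>
      integrable_finsetSum _ fun b _ => iD j a b
  set C0 := ∫ x, L x ^ 24 ∂μ with hC0
  have bQ : ∫ X : Fin d → Fin n → ℝ, ∑ a,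
      τ (X l p) * τ' (X l p) ^ 2 * Yv p (X l) a ^ 4 ∂(PP (Fin n) (Fin d) μ) ≤ n * (5 * C0) := by
    rw [integral_finsetSum _ fun a _ => iQ a]
    refine (Finset.sum_le_sum fun a _ => E_Q H p l a).trans ?_
    simp [← hC0]
  have bD : ∫ X : Fin d → Fin n → ℝ, ∑ j, ∑ a, ∑ b,
      τ (X l p) * Dk τ τ' p j (X l) a b ^ 2 ∂(PP (Fin n) (Fin d) μ) ≤ 5 * (n:ℝ) ^ 2 * (5 * C0) := by
    rw [integral_finsetSum _ fun j _ => integrable_finsetSum _ fun a _ =>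
      integrable_finsetSum _ fun b _ => iD j a b]
    rw [← sum_cc p, Finset.sum_mul]
    refine Finset.sum_le_sum fun j _ => ?_
    rw [integral_finsetSum _ fun a _ =>
      integrable_finsetSum _ fun b _ => iD j a b, Finset.sum_mul]
    refine Finset.sum_le_sum fun a _ => ?_
    rw [integral_finsetSum _ fun b _ => iD j a b, Finset.sum_mul]
    exact Finset.sum_le_sum fun b _ => E_D H p l j a b
  have pw : ∀ X : Fin d → Fin n → ℝ, τ (X l p) *
      ((8 * τ' (X l p) ^ 2 * Qs p (X l) ^ 2 + 128 * Ks τ τ' p (X l)) / d ^ 2) ≤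
      (8 * n * (∑ a, τ (X l p) * τ' (X l p) ^ 2 * Yv p (X l) a ^ 4) +
      128 * ∑ j, ∑ a, ∑ b, τ (X l p) * Dk τ τ' p j (X l) a b ^ 2) / d ^ 2 := fun X => by
    have t0 := H.τ_nonneg (X l p)
    rw [← mul_div_assoc]
    gcongr
    have h1 : Qs p (X l) ^ 2 ≤ n * ∑ a, Yv p (X l) a ^ 4 := by
      unfold Qs
      have := sq_sum_le_card_mul_sum_sq (s := Finset.univ) (f := fun a => Yv p (X l) a ^ 2)
      simp only [Finset.card_univ, Fintype.card_fin, ← pow_mul] at this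
      exact this
    have h2 : ∑ j, ∑ a, ∑ b, τ (X l p) * Dk τ τ' p j (X l) a b ^ 2 = τ (X l p) * Ks τ τ' p (X l) := by
      simp only [Ks, Finset.mul_sum]
    rw [h2, ← Finset.mul_sum]
    have h3 : τ (X l p) * (8 * τ' (X l p) ^ 2) * Qs p (X l) ^ 2 ≤
      τ (X l p) * (8 * τ' (X l p) ^ 2) * (n * ∑ a, Yv p (X l) a ^ 4) := by gcongr
    linarith
  have p0 : ∀ X : Fin d → Fin n → ℝ, 0 ≤ τ (X l p) *
      ((8 * τ' (X l p) ^ 2 * Qs p (X l) ^ 2 + 128 * Ks τ τ' p (X l)) / d ^ 2) := fun X => by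
    have := H.τ_nonneg (X l p)
    have : 0 ≤ Ks τ τ' p (X l) := Finset.sum_nonneg fun _ _ => Finset.sum_nonneg fun _ _ =>
        Finset.sum_nonneg fun _ _ => sq_nonneg _
    positivity
  have iT : Integrable (fun X : Fin d → Fin n → ℝ => (8 * n * (∑ a, τ (X l p) * τ' (X l p) ^ 2 * Yv p (X l) a ^ 4) +
      128 * ∑ j, ∑ a, ∑ b, τ (X l p) * Dk τ τ' p j (X l) a b ^ 2) / d ^ 2) (PP (Fin n) (Fin d) μ) :=
    ((iQs.const_mul _).add (iDs.const_mul _)).div_const _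
  have mm : Measurable (fun X : Fin d → Fin n → ℝ => τ (X l p) *
      ((8 * τ' (X l p) ^ 2 * Qs p (X l) ^ 2 + 128 * Ks τ τ' p (X l)) / d ^ 2)) := by
    refine (gr_τ H l p).1.mul (Measurable.div_const (Measurable.add ?_ ?_) _)
    · refine Measurable.mul (((gr_τ' H l p).1.pow_const 2).const_mul 8) (Measurable.pow_const ?_ 2)
      exact Finset.measurable_fun_sum _ fun a _ => (gr_Y H p l a).1.pow_const 2
    · refine Measurable.const_mul ?_ _
      exact Finset.measurable_fun_sum _ fun j _ => Finset.measurable_fun_sum _ fun a _ =>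
        Finset.measurable_fun_sum _ fun b _ => (gr_Dk H p j l a b).1.pow_const 2
  refine ⟨iT.mono' mm.aestronglyMeasurable (Eventually.of_forall fun X => ?_), ?_⟩
  · rw [Real.norm_of_nonneg (p0 X)]; exact pw X
  · refine (integral_mono_of_nonneg (Eventually.of_forall p0) iT (Eventually.of_forall pw)).trans ?_
    rw [integral_div, integral_add (iQs.const_mul _) (iDs.const_mul _), integral_const_mul, integral_const_mul]
    gcongr
    have n0 : (0 : ℝ) ≤ n := Nat.cast_nonneg _
    nlinarith [mul_le_mul_of_nonneg_left bQ (by positivity : (0:ℝ) ≤ 8 * n)]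

end mom

end WG


namespace WG

lemma orth {Ω : Type*} [MeasurableSpace Ω] {P : Measure Ω} {α : Type*} [DecidableEq α] (s : Finset α)
    (F : α → Ω → ℝ) (hfint : ∀ i j, Integrable (fun ω => F i ω * F j ω) P)
    (hz : ∀ i ∈ s, ∀ j ∈ s, i ≠ j → ∫ ω, F i ω * F j ω ∂P = 0) {c : ℝ}
    (hc : ∀ i ∈ s, ∫ ω, F i ω ^ 2 ∂P ≤ c) :
    ∫ ω, (∑ i ∈ s, F i ω) ^ 2 ∂P ≤ s.card * c := by
  have e : ∀ ω, (∑ i ∈ s, F i ω) ^ 2 = ∑ i ∈ s, ∑ j ∈ s, F i ω * F j ω := fun ω => by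
    rw [pow_two, Finset.sum_mul_sum]
  simp only [e]
  rw [integral_finsetSum _ fun i _ => integrable_finsetSum _ fun j _ => hfint i j]
  have e2 : ∀ i ∈ s, ∫ ω, ∑ j ∈ s, F i ω * F j ω ∂P ≤ c := fun i hi => by
    rw [integral_finsetSum _ fun j _ => hfint i j, Finset.sum_eq_single i]
    · simp only [← pow_two]; exact hc i hi
    · intro j hj hji; exact hz i hi j hj (Ne.symm hji)
    · intro h; exact absurd hi h
  calc _ ≤ ∑ i ∈ s, c := Finset.sum_le_sum e2
    _ = _ := by simp

section mom
variable {μ : Measure ℝ} [IsProbabilityMeasure μ] {J : Set ℝ} {τ τ' L : ℝ → ℝ} {n d : ℕ}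

lemma col_zero (l : Fin d) {f : (Fin n → ℝ) → ℝ} {R : (Fin d → Fin n → ℝ) → ℝ}
    (hI : Integrable (fun X => f (X l) * R X) (PP (Fin n) (Fin d) μ))
    (hR : ∀ X y, R (Function.update X l y) = R X) (hf : ∫ x, f x ∂(Measure.pi fun _ : Fin n => μ) = 0) :
    ∫ X, f (X l) * R X ∂(PP (Fin n) (Fin d) μ) = 0 := by
  have := integral_resample (fun _ : Fin d => Measure.pi fun _ : Fin n => μ) l (F := fun X => f (X l) * R X) hI
  refine this.trans ?_
  simp only [hR, Function.update_self, integral_mul_const, hf, zero_mul, integral_zero]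

lemma ent_zero (a : Fin n) {f : ℝ → ℝ} {R : (Fin n → ℝ) → ℝ}
    (hI : Integrable (fun x => f (x a) * R x) (Measure.pi fun _ : Fin n => μ))
    (hR : ∀ x t, R (Function.update x a t) = R x) (hf : ∫ t, f t ∂μ = 0) :
    ∫ x, f (x a) * R x ∂(Measure.pi fun _ : Fin n => μ) = 0 := by
  have := integral_resample (fun _ : Fin n => μ) a (F := fun x => f (x a) * R x) hI
  refine this.trans ?_
  simp only [hR, Function.update_self, integral_mul_const, hf, zero_mul, integral_zero]

/-- centred local covariance -/
def Kf (τ : ℝ → ℝ) (j a b : Fin n) (x : Fin n → ℝ) : ℝ :=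
  τ (x j) * Yv j x a * Yv j x b - (if a = b then (if a = j then 0 else 1) else 0)

def gf (j b : Fin n) (x : Fin n → ℝ) : ℝ := x j * Yv j x b

lemma Mx_Kf (hd : 0 < d) (j a b : Fin n) (X : Fin d → Fin n → ℝ) :
    (Mx τ j X - 1) a b = (∑ l, Kf τ j a b (X l)) / d := by
  have hd0 : (d : ℝ) ≠ 0 := by exact_mod_cast hd.ne'
  simp only [Matrix.sub_apply, Matrix.one_apply, Mx, Kf, Finset.sum_sub_distrib, Finset.sum_const,
    Finset.card_univ, Fintype.card_fin, nsmul_eq_mul]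
  by_cases h : a = b
  · by_cases h2 : a = j
    · have h3 : b = j := h.symm.trans h2
      simp [h2, h3, Yv]
    · simp only [h, if_true] at h2 ⊢
      simp only [h2, if_false]
      field_simp
      ring
  · simp [h]

lemma g1_x (H : SD μ J τ τ' L) (a : Fin n) : Gr (Lam1 L) 1 (fun x : Fin n → ℝ => x a) :=
  gr1 H measurable_id H.id_le a
lemma g1_τ (H : SD μ J τ τ' L) (a : Fin n) : Gr (Lam1 L) 1 (fun x : Fin n → ℝ => τ (x a)) :=
  gr1 H H.τ_meas H.abs_τ_le a
lemma g1_Y (H : SD μ J τ τ' L) (j a : Fin n) : Gr (Lam1 L) 1 (fun x : Fin n → ℝ => Yv j x a) := by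
  unfold Yv
  split_ifs
  · exact Gr.zero
  · exact g1_x H a
lemma g1_K (H : SD μ J τ τ' L) (j a b : Fin n) : Gr (Lam1 L) 3 (Kf τ j a b) :=
  (((g1_τ H j).mul' (g1_Y H j a) rfl).mul' (g1_Y H j b) rfl).sub
    (Gr.mono (wt1 H) (Gr.const _) (by norm_num))
lemma g1_g (H : SD μ J τ τ' L) (j b : Fin n) : Gr (Lam1 L) 2 (gf j b) :=
  (g1_x H j).mul' (g1_Y H j b) rfl

lemma Gr.col (H : SD μ J τ τ' L) {m : ℕ} {f : (Fin n → ℝ) → ℝ} (hf : Gr (Lam1 L) m f) (l : Fin d) :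
    Gr (Lam L) m (fun X : Fin d → Fin n → ℝ => f (X l)) := by
  obtain ⟨hm, C, hC, hb⟩ := hf
  refine ⟨hm.comp (measurable_pi_apply l), C, hC, fun X => (hb _).trans ?_⟩
  have h0 := one_le_Lam1 H (X l)
  have h1 := Lam1_le H X l
  gcongr

lemma Yv_update (j a b : Fin n) (hab : b ≠ a) (x : Fin n → ℝ) (t : ℝ) :
    Yv j (Function.update x a t) b = Yv j x b := by
  simp [Yv, hab]

lemma mean_gf (H : SD μ J τ τ' L) (j b : Fin n) :
    ∫ x, gf j b x ∂(Measure.pi fun _ : Fin n => μ) = 0 := by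
  by_cases hb : b = j
  · simp [gf, Yv, hb]
  · have e : ∀ x : Fin n → ℝ, gf j b x = (fun t => t) (x j) * Yv j x b := fun x => rfl
    simp only [e]
    refine ent_zero j ?_ (fun x t => Yv_update j j b hb x t) H.mean
    exact (g1_g H j b).integrable (wt1 H) (by norm_num)

lemma mean_gg (H : SD μ J τ τ' L) (j b b' : Fin n) (hbb : b ≠ b') :
    ∫ x, gf j b x * gf j b' x ∂(Measure.pi fun _ : Fin n => μ) = 0 := by
  by_cases hb : b = j
  · simp [gf, Yv, hb]
  · have hI := ((g1_g H j b).mul' (g1_g H j b') rfl).integrable (wt1 H) (by norm_num)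
    have e : ∀ x : Fin n → ℝ, gf j b x * gf j b' x = (fun t => t) (x b) * (x j * (x j * Yv j x b')) := fun x => by
      simp only [gf]
      have : Yv j x b = x b := by simp [Yv, hb]
      rw [this]; ring
    simp only [e] at hI ⊢
    refine ent_zero b hI (fun x t => ?_) H.mean
    rw [Yv_update j b b' (Ne.symm hbb)]
    simp [Ne.symm hb]

lemma mean_q (H : SD μ J τ τ' L) (j a b : Fin n) (hab : b ≠ a) :
    ∫ x, Kf τ j a b x * gf j b x ∂(Measure.pi fun _ : Fin n => μ) = 0 := by
  have hab' : a ≠ b := Ne.symm hab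
  by_cases ha : a = j
  · simp [Kf, Yv, ha]
  · have hI := ((g1_K H j a b).mul' (g1_g H j b) rfl).integrable (wt1 H) (by norm_num)
    have e : ∀ x : Fin n → ℝ, Kf τ j a b x * gf j b x =
        (fun t => t) (x a) * (τ (x j) * Yv j x b * (x j * Yv j x b)) := fun x => by
      simp only [gf, Kf, hab', if_false]
      have : Yv j x a = x a := by simp [Yv, ha]
      rw [this]; ring
    simp only [e] at hI ⊢
    refine ent_zero a hI (fun x t => ?_) H.mean
    rw [Yv_update j a b hab]
    simp [Ne.symm ha]

lemma mean_K (H : SD μ J τ τ' L) (j a b : Fin n) :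
    ∫ x, Kf τ j a b x ∂(Measure.pi fun _ : Fin n => μ) = 0 := by
  by_cases ha : a = j
  · have : ∀ x : Fin n → ℝ, Kf τ j a b x = 0 := fun x => by simp [Kf, Yv, ha]
    simp [this]
  by_cases hab : b = a
  · subst hab
    have h1 : Gr (Lam1 L) 3 (fun x : Fin n → ℝ => (fun t => t ^ 2 - 1) (x b) * τ (x j)) :=
      (((g1_x H b).sq (k := 2) rfl).sub (Gr.mono (wt1 H) (Gr.const 1) (by norm_num))).mul' (g1_τ H j) rfl
    have h2 : Gr (Lam1 L) 1 (fun x : Fin n → ℝ => (fun t => τ t - 1) (x j) * 1) := by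
      simp only [mul_one]
      exact (g1_τ H j).sub (Gr.mono (wt1 H) (Gr.const 1) (by norm_num))
    have i1 := h1.integrable (wt1 H) (by norm_num)
    have i2 := h2.integrable (wt1 H) (by norm_num)
    have e : ∀ x : Fin n → ℝ, Kf τ j b b x = (fun t => t ^ 2 - 1) (x b) * τ (x j) +
        (fun t => τ t - 1) (x j) * 1 := fun x => by
      simp only [Kf, if_true, ha, if_false]
      have : Yv j x b = x b := by simp [Yv, ha]
      rw [this]; ring
    simp only [e]
    have iL : Integrable L μ := by
      refine H.L_int.mono' H.L_meas.aestronglyMeasurable (Eventually.of_forall fun x => ?_)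
      have := H.one_le x
      rw [Real.norm_of_nonneg (by linarith)]
      exact le_self_pow₀ this (by norm_num)
    have iτ : Integrable τ μ := iL.mono' H.τ_meas.aestronglyMeasurable
      (Eventually.of_forall fun x => H.abs_τ_le x)
    have i2' : Integrable (fun t : ℝ => t ^ 2) μ := by
      refine H.L_int.mono' (by fun_prop) (Eventually.of_forall fun x => ?_)
      rw [Real.norm_of_nonneg (sq_nonneg _)]
      have := H.one_le x
      exact (abs_sq_le (H.id_le x)).trans (pow_le_pow_right₀ this (by norm_num))
    have z1 := ent_zero b (f := fun t => t ^ 2 - 1) (R := fun x => τ (x j)) i1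
      (fun x t => by simp [Ne.symm ha]) (by rw [integral_sub i2' (integrable_const 1), H.var]; simp)
    have z2 := ent_zero j (f := fun t => τ t - 1) (R := fun x => 1) i2
      (fun x t => rfl) (by rw [integral_sub iτ (integrable_const 1), H.τ_mean]; simp)
    rw [integral_add i1 i2, z1, z2, add_zero]
  · have hI := (g1_K H j a b).integrable (wt1 H) (by norm_num)
    have hab' : a ≠ b := Ne.symm hab
    have e : ∀ x : Fin n → ℝ, Kf τ j a b x =
        (fun t => t) (x a) * (τ (x j) * Yv j x b) := fun x => by
      simp only [Kf, hab', if_false]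
      have : Yv j x a = x a := by simp [Yv, ha]
      rw [this]; ring
    have e' : Kf τ j a b = fun x => (fun t => t) (x a) * (τ (x j) * Yv j x b) := funext e
    rw [e'] at hI ⊢
    refine ent_zero a hI (fun x t => ?_) H.mean
    rw [Yv_update j a b hab]
    simp [Ne.symm ha]

lemma K_abs (H : SD μ J τ τ' L) (j a b : Fin n) (x : Fin n → ℝ) {m : ℝ} (hm : 1 ≤ m)
    (h1 : L (x j) ≤ m) (h2 : L (x a) ≤ m) (h3 : L (x b) ≤ m) : |Kf τ j a b x| ≤ 2 * m ^ 3 := by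
  unfold Kf
  have t1 := (H.abs_τ_le _).trans h1
  have t2 := Yv_abs_le H j x a hm h2
  have t3 := Yv_abs_le H j x b hm h3
  have m3 : 1 ≤ m ^ 3 := one_le_pow₀ hm
  have e1 : |τ (x j) * Yv j x a * Yv j x b| ≤ m ^ 3 := by
    rw [abs_mul, abs_mul]
    calc _ ≤ m * m * m := by gcongr
      _ = _ := by ring
  have e2 : |(if a = b then (if a = j then (0:ℝ) else 1) else 0)| ≤ 1 := by split_ifs <;> simp
  have e3 := abs_sub (τ (x j) * Yv j x a * Yv j x b) (if a = b then (if a = j then (0:ℝ) else 1) else 0)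
  linarith

lemma g_abs (H : SD μ J τ τ' L) (j b : Fin n) (x : Fin n → ℝ) {m : ℝ} (hm : 1 ≤ m)
    (h1 : L (x j) ≤ m) (h3 : L (x b) ≤ m) : |gf j b x| ≤ m ^ 2 := by
  unfold gf
  have t1 := (H.id_le _).trans h1
  have t3 := Yv_abs_le H j x b hm h3
  rw [abs_mul, pow_two]
  gcongr

lemma E_K (H : SD μ J τ τ' L) (j a b : Fin n) (l : Fin d) :
    ∫ X, Kf τ j a b (X l) ^ 2 ∂(PP (Fin n) (Fin d) μ) ≤ 4 * (5 * ∫ x, L x ^ 24 ∂μ) := by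
  refine E5 H l l j a b j j (by norm_num) (fun X => sq_nonneg _) fun X m hm h1 h2 h3 _ _ => ?_
  calc _ ≤ (2 * m ^ 3) ^ 2 := abs_sq_le (K_abs H j a b (X l) hm h1 h2 h3)
    _ = 4 * m ^ 6 := by ring
    _ ≤ _ := by gcongr <;> norm_num [hm]

lemma E_Kg (H : SD μ J τ τ' L) (j a b : Fin n) (l l' : Fin d) :
    ∫ X, (Kf τ j a b (X l) * gf j b (X l')) ^ 2 ∂(PP (Fin n) (Fin d) μ) ≤
      4 * (5 * ∫ x, L x ^ 24 ∂μ) := by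
  refine E5 H l l' j a b j b (by norm_num) (fun X => sq_nonneg _) fun X m hm h1 h2 h3 h4 h5 => ?_
  have t1 := abs_sq_le (K_abs H j a b (X l) hm h1 h2 h3)
  have t2 := abs_sq_le (g_abs H j b (X l') hm h4 h5)
  rw [mul_pow]
  calc _ ≤ (2 * m ^ 3) ^ 2 * (m ^ 2) ^ 2 := by gcongr
    _ = 4 * m ^ 10 := by ring
    _ ≤ _ := by gcongr <;> norm_num [hm]

/-- orthogonality of centred columns -/
lemma cols (H : SD μ J τ τ' L) {f : (Fin n → ℝ) → ℝ} {m : ℕ} (hm : m + m ≤ 24) (hf : Gr (Lam1 L) m f)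
    (h0 : ∫ x, f x ∂(Measure.pi fun _ : Fin n => μ) = 0) {c : ℝ}
    (hc : ∀ l : Fin d, ∫ X, f (X l) ^ 2 ∂(PP (Fin n) (Fin d) μ) ≤ c) :
    ∫ X, (∑ l : Fin d, f (X l)) ^ 2 ∂(PP (Fin n) (Fin d) μ) ≤ d * c := by
  have hi : ∀ l l' : Fin d, Integrable (fun X : Fin d → Fin n → ℝ => f (X l) * f (X l')) (PP (Fin n) (Fin d) μ) :=
    fun l l' => ((Gr.col H hf l).mul (Gr.col H hf l')).integrable (wt H) hm
  have := orth (P := PP (Fin n) (Fin d) μ) Finset.univ (fun l X => f (X l)) hi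
    (fun l _ l' _ hll => col_zero l (R := fun X => f (X l')) (hi l l')
      (fun X y => by simp [Ne.symm hll]) h0) (fun l _ => hc l)
  simpa using this

lemma E_SS (H : SD μ J τ τ' L) (hd : 0 < d) :
    ∫ X, SS τ X ∂(PP (Fin n) (Fin d) μ) ≤ 20 * (∫ x, L x ^ 24 ∂μ) * ((n : ℝ) ^ 3 / d) := by
  have hd0 : (0 : ℝ) < d := by exact_mod_cast hd
  have hi : ∀ j a b, Integrable (fun X : Fin d → Fin n → ℝ => (Mx τ j X - 1) a b ^ 2)
      (PP (Fin n) (Fin d) μ) := fun j a b =>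
    ((gr_Mx H j a b).sq rfl).integrable (wt H) (by norm_num)
  have key : ∀ j a b, ∫ X : Fin d → Fin n → ℝ, (Mx τ j X - 1) a b ^ 2 ∂(PP (Fin n) (Fin d) μ) ≤
      20 * (∫ x, L x ^ 24 ∂μ) / d := fun j a b => by
    simp only [Mx_Kf hd, div_pow]
    rw [integral_div, div_le_div_iff₀ (by positivity) hd0]
    have := cols H (by norm_num) (g1_K H j a b) (mean_K H j a b) (fun l : Fin d => E_K H j a b l)
    nlinarith
  unfold SS
  rw [integral_finsetSum _ fun j _ => integrable_finsetSum _ fun a _ =>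
      integrable_finsetSum _ fun b _ => hi j a b]
  calc _ ≤ ∑ j : Fin n, ∑ a : Fin n, ∑ b : Fin n, 20 * (∫ x, L x ^ 24 ∂μ) / d := by
        refine Finset.sum_le_sum fun j _ => ?_
        rw [integral_finsetSum _ fun a _ => integrable_finsetSum _ fun b _ => hi j a b]
        refine Finset.sum_le_sum fun a _ => ?_
        rw [integral_finsetSum _ fun b _ => hi j a b]
        exact Finset.sum_le_sum fun b _ => key j a b
    _ = _ := by simp; ring

end mom

end WG


namespace WG

section mom
variable {μ : Measure ℝ} [IsProbabilityMeasure μ] {J : Set ℝ} {τ τ' L : ℝ → ℝ} {n d : ℕ}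

/-- bilinear pieces -/
def hh (τ : ℝ → ℝ) (j a : Fin n) (q : Fin d × Fin d) (X : Fin d → Fin n → ℝ) : ℝ :=
  ∑ b, Kf τ j a b (X q.1) * gf j b (X q.2)

lemma gr_Kg (H : SD μ J τ τ' L) (j a b : Fin n) (l l' : Fin d) :
    Gr (Lam L) 5 (fun X : Fin d → Fin n → ℝ => Kf τ j a b (X l) * gf j b (X l')) :=
  (Gr.col H (g1_K H j a b) l).mul' (Gr.col H (g1_g H j b) l') rfl

lemma gr_hh (H : SD μ J τ τ' L) (j a : Fin n) (q : Fin d × Fin d) :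
    Gr (Lam L) 5 (hh τ j a q) := Gr.sum fun b _ => gr_Kg H j a b q.1 q.2

lemma E_hh (H : SD μ J τ τ' L) (j a : Fin n) (q : Fin d × Fin d) (hq : q.1 ≠ q.2) :
    ∫ X, hh τ j a q X ^ 2 ∂(PP (Fin n) (Fin d) μ) ≤ n * (4 * (5 * ∫ x, L x ^ 24 ∂μ)) := by
  have hi : ∀ b b', Integrable (fun X : Fin d → Fin n → ℝ =>
      (Kf τ j a b (X q.1) * gf j b (X q.2)) * (Kf τ j a b' (X q.1) * gf j b' (X q.2)))
      (PP (Fin n) (Fin d) μ) := fun b b' =>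
    ((gr_Kg H j a b q.1 q.2).mul (gr_Kg H j a b' q.1 q.2)).integrable (wt H) (by norm_num)
  have := orth (P := PP (Fin n) (Fin d) μ) Finset.univ
    (fun b X => Kf τ j a b (X q.1) * gf j b (X q.2)) hi (fun b _ b' _ hbb => ?_)
    (fun b _ => E_Kg H j a b q.1 q.2)
  · simpa [hh] using this
  · have e : ∀ X : Fin d → Fin n → ℝ,
      (Kf τ j a b (X q.1) * gf j b (X q.2)) * (Kf τ j a b' (X q.1) * gf j b' (X q.2)) =
      (fun x => gf j b x * gf j b' x) (X q.2) * (Kf τ j a b (X q.1) * Kf τ j a b' (X q.1)) := fun X => by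
      ring
    have hI := hi b b'
    simp only [e] at hI ⊢
    exact col_zero q.2 (f := fun x => gf j b x * gf j b' x)
      (R := fun X => Kf τ j a b (X q.1) * Kf τ j a b' (X q.1)) hI
      (fun X y => by simp [hq]) (mean_gg H j b b' hbb)

lemma hh_orth (H : SD μ J τ τ' L) (j a : Fin n) (q r : Fin d × Fin d) (hq : q.1 ≠ q.2)
    (h : (q.1 ≠ r.1 ∧ q.1 ≠ r.2) ∨ (q.2 ≠ r.1 ∧ q.2 ≠ r.2)) :
    ∫ X, hh τ j a q X * hh τ j a r X ∂(PP (Fin n) (Fin d) μ) = 0 := by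
  have e0 : ∀ X : Fin d → Fin n → ℝ, hh τ j a q X * hh τ j a r X =
      ∑ b, ∑ b', (Kf τ j a b (X q.1) * gf j b (X q.2)) * (Kf τ j a b' (X r.1) * gf j b' (X r.2)) := fun X => by
    unfold hh; rw [Finset.sum_mul_sum]
  have hi : ∀ b b', Integrable (fun X : Fin d → Fin n → ℝ =>
      (Kf τ j a b (X q.1) * gf j b (X q.2)) * (Kf τ j a b' (X r.1) * gf j b' (X r.2)))
      (PP (Fin n) (Fin d) μ) := fun b b' =>
    ((gr_Kg H j a b q.1 q.2).mul (gr_Kg H j a b' r.1 r.2)).integrable (wt H) (by norm_num)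
  simp only [e0]
  rw [integral_finsetSum _ fun b _ => integrable_finsetSum _ fun b' _ => hi b b']
  refine Finset.sum_eq_zero fun b _ => ?_
  rw [integral_finsetSum _ fun b' _ => hi b b']
  refine Finset.sum_eq_zero fun b' _ => ?_
  have hI := hi b b'
  rcases h with ⟨h1, h2⟩ | ⟨h1, h2⟩
  · have e : ∀ X : Fin d → Fin n → ℝ,
      (Kf τ j a b (X q.1) * gf j b (X q.2)) * (Kf τ j a b' (X r.1) * gf j b' (X r.2)) =
      Kf τ j a b (X q.1) * (gf j b (X q.2) * (Kf τ j a b' (X r.1) * gf j b' (X r.2))) := fun X => by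
      ring
    simp only [e] at hI ⊢
    exact col_zero q.1 (f := Kf τ j a b)
      (R := fun X => gf j b (X q.2) * (Kf τ j a b' (X r.1) * gf j b' (X r.2))) hI
      (fun X y => by simp [hq.symm, h1.symm, h2.symm]) (mean_K H j a b)
  · have e : ∀ X : Fin d → Fin n → ℝ,
      (Kf τ j a b (X q.1) * gf j b (X q.2)) * (Kf τ j a b' (X r.1) * gf j b' (X r.2)) =
      gf j b (X q.2) * (Kf τ j a b (X q.1) * (Kf τ j a b' (X r.1) * gf j b' (X r.2))) := fun X => by
      ring
    simp only [e] at hI ⊢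
    exact col_zero q.2 (f := gf j b)
      (R := fun X => Kf τ j a b (X q.1) * (Kf τ j a b' (X r.1) * gf j b' (X r.2))) hI
      (fun X y => by simp [hq, h1.symm, h2.symm]) (mean_gf H j b)

lemma hh_part (H : SD μ J τ τ' L) (j a : Fin n) (s : Finset (Fin d × Fin d))
    (hs : (∀ q ∈ s, q.1 < q.2) ∨ (∀ q ∈ s, q.2 < q.1)) :
    ∫ X, (∑ q ∈ s, hh τ j a q X) ^ 2 ∂(PP (Fin n) (Fin d) μ) ≤
      (d : ℝ) ^ 2 * (n * (4 * (5 * ∫ x, L x ^ 24 ∂μ))) := by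
  have hi : ∀ q r, Integrable (fun X : Fin d → Fin n → ℝ => hh τ j a q X * hh τ j a r X)
      (PP (Fin n) (Fin d) μ) := fun q r =>
    ((gr_hh H j a q).mul (gr_hh H j a r)).integrable (wt H) (by norm_num)
  have hne : ∀ q ∈ s, q.1 ≠ q.2 := fun q hq => by
    rcases hs with h | h
    · exact (h q hq).ne
    · exact (h q hq).ne'
  have := orth (P := PP (Fin n) (Fin d) μ) s (hh τ j a) hi (fun q hq r hr hqr => ?_)
    (fun q hq => E_hh H j a q (hne q hq))
  · refine this.trans ?_
    have hc : (s.card : ℝ) ≤ (d : ℝ) ^ 2 := by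
      have := Finset.card_le_univ s
      simp only [Fintype.card_prod, Fintype.card_fin] at this
      rw [pow_two]; exact_mod_cast this
    have h0 : 0 ≤ ∫ x, L x ^ 24 ∂μ := integral_nonneg fun x => pow_nonneg (zero_le_one.trans (H.one_le x)) _
    gcongr
  · refine hh_orth H j a q r (hne q hq) ?_
    obtain ⟨q1, q2⟩ := q
    obtain ⟨r1, r2⟩ := r
    have hqr' : ¬ (q1 = r1 ∧ q2 = r2) := fun h => hqr (by rw [h.1, h.2])
    rcases hs with h | h
    · have h1 := h _ hq
      have h2 := h _ hr
      simp only at h1 h2 ⊢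
      simp only [Fin.ext_iff, Fin.lt_def, ne_eq] at *
      omega
    · have h1 := h _ hq
      have h2 := h _ hr
      simp only at h1 h2 ⊢
      simp only [Fin.ext_iff, Fin.lt_def, ne_eq] at *
      omega

lemma diag1 (H : SD μ J τ τ' L) (j a : Fin n) :
    ∫ X : Fin d → Fin n → ℝ, (∑ l, Kf τ j a a (X l) * gf j a (X l)) ^ 2 ∂(PP (Fin n) (Fin d) μ) ≤
      (d : ℝ) ^ 2 * (4 * (5 * ∫ x, L x ^ 24 ∂μ)) := by
  have hi : ∀ l : Fin d, Integrable (fun X : Fin d → Fin n → ℝ => (Kf τ j a a (X l) * gf j a (X l)) ^ 2)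
      (PP (Fin n) (Fin d) μ) := fun l => ((gr_Kg H j a a l l).sq rfl).integrable (wt H) (by norm_num)
  have h1 : ∀ X : Fin d → Fin n → ℝ, (∑ l, Kf τ j a a (X l) * gf j a (X l)) ^ 2 ≤
      d * ∑ l, (Kf τ j a a (X l) * gf j a (X l)) ^ 2 := fun X => by
    have := sq_sum_le_card_mul_sum_sq (s := Finset.univ) (f := fun l => Kf τ j a a (X l) * gf j a (X l))
    simpa using this
  refine (integral_mono_of_nonneg (Eventually.of_forall fun X => sq_nonneg _)
    ((integrable_finsetSum _ fun l _ => hi l).const_mul _) (Eventually.of_forall h1)).trans ?_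
  rw [integral_const_mul, integral_finsetSum _ fun l _ => hi l]
  have h2 : ∑ l : Fin d, ∫ X : Fin d → Fin n → ℝ, (Kf τ j a a (X l) * gf j a (X l)) ^ 2 ∂(PP (Fin n) (Fin d) μ)
      ≤ d * (4 * (5 * ∫ x, L x ^ 24 ∂μ)) := by
    refine (Finset.sum_le_sum fun l _ => E_Kg H j a a l l).trans ?_
    simp
  have d0 : (0:ℝ) ≤ d := Nat.cast_nonneg _
  nlinarith [mul_le_mul_of_nonneg_left h2 d0]

lemma diag2 (H : SD μ J τ τ' L) (j a : Fin n) :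
    ∫ X : Fin d → Fin n → ℝ, (∑ l, ∑ b ∈ Finset.univ.erase a, Kf τ j a b (X l) * gf j b (X l)) ^ 2
      ∂(PP (Fin n) (Fin d) μ) ≤ d * ((n : ℝ) ^ 2 * (4 * (5 * ∫ x, L x ^ 24 ∂μ))) := by
  have hg : ∀ b, Gr (Lam1 L) 5 (fun x : Fin n → ℝ => Kf τ j a b x * gf j b x) := fun b =>
    (g1_K H j a b).mul' (g1_g H j b) rfl
  have h0 : 0 ≤ ∫ x, L x ^ 24 ∂μ := integral_nonneg fun x => pow_nonneg (zero_le_one.trans (H.one_le x)) _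
  have hc : ((Finset.univ.erase a).card : ℝ) ≤ n := by
    have := Finset.card_le_univ (Finset.univ.erase a)
    simp only [Fintype.card_fin] at this
    exact_mod_cast this
  refine cols H (m := 5) (f := fun x => ∑ b ∈ Finset.univ.erase a, Kf τ j a b x * gf j b x) (by norm_num)
    (Gr.sum fun b _ => hg b) ?_ fun l => ?_
  · rw [integral_finsetSum _ fun b _ => (hg b).integrable (wt1 H) (by norm_num)]
    exact Finset.sum_eq_zero fun b hb => mean_q H j a b (Finset.ne_of_mem_erase hb)
  · have hi : ∀ b, Integrable (fun X : Fin d → Fin n → ℝ => (Kf τ j a b (X l) * gf j b (X l)) ^ 2)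
      (PP (Fin n) (Fin d) μ) := fun b => ((gr_Kg H j a b l l).sq rfl).integrable (wt H) (by norm_num)
    have h1 : ∀ X : Fin d → Fin n → ℝ, (∑ b ∈ Finset.univ.erase a, Kf τ j a b (X l) * gf j b (X l)) ^ 2 ≤
      n * ∑ b ∈ Finset.univ.erase a, (Kf τ j a b (X l) * gf j b (X l)) ^ 2 := fun X => by
      refine (sq_sum_le_card_mul_sum_sq (s := Finset.univ.erase a)
        (f := fun b => Kf τ j a b (X l) * gf j b (X l))).trans ?_
      exact mul_le_mul_of_nonneg_right hc (Finset.sum_nonneg fun _ _ => sq_nonneg _)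
    refine (integral_mono_of_nonneg (Eventually.of_forall fun X => sq_nonneg _)
      ((integrable_finsetSum _ fun b _ => hi b).const_mul _) (Eventually.of_forall h1)).trans ?_
    rw [integral_const_mul, integral_finsetSum _ fun b _ => hi b]
    have h2 : ∑ b ∈ Finset.univ.erase a, ∫ X : Fin d → Fin n → ℝ, (Kf τ j a b (X l) * gf j b (X l)) ^ 2
        ∂(PP (Fin n) (Fin d) μ) ≤ n * (4 * (5 * ∫ x, L x ^ 24 ∂μ)) := by
      refine (Finset.sum_le_sum fun b _ => E_Kg H j a b l l).trans ?_
      rw [Finset.sum_const, nsmul_eq_mul]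
      gcongr
    have d0 : (0:ℝ) ≤ n := Nat.cast_nonneg _
    nlinarith [mul_le_mul_of_nonneg_left h2 d0]

lemma Z_eq (hd : 0 < d) (j a : Fin n) (X : Fin d → Fin n → ℝ) :
    ((Mx τ j X - 1).mulVec (wv j X) a) ^ 2 = (∑ l, ∑ l', hh τ j a (l, l') X) ^ 2 / (d : ℝ) ^ 3 := by
  have hd0 : (0 : ℝ) < d := by exact_mod_cast hd
  have e1 : (Mx τ j X - 1).mulVec (wv j X) a = (∑ l, ∑ l', hh τ j a (l, l') X) / (d * √(d : ℝ)) := by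
    show ∑ b, (Mx τ j X - 1) a b * wv j X b = _
    simp only [Mx_Kf hd, wv, hh]
    have e2 : ∀ b, (∑ l, Kf τ j a b (X l)) / (d : ℝ) * ((∑ l, X l j * Yv j (X l) b) / √(d : ℝ)) =
        (∑ l, ∑ l', Kf τ j a b (X l) * gf j b (X l')) / (d * √(d : ℝ)) := fun b => by
      rw [div_mul_div_comm, Finset.sum_mul_sum]; rfl
    simp only [e2, ← Finset.sum_div]
    congr 1
    rw [Finset.sum_comm]
    exact Finset.sum_congr rfl fun l _ => Finset.sum_comm
  rw [e1, div_pow, mul_pow, Real.sq_sqrt hd0.le]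
  ring

lemma split_sum (j a : Fin n) (X : Fin d → Fin n → ℝ) :
    ∑ l, ∑ l', hh τ j a (l, l') X = ∑ l, Kf τ j a a (X l) * gf j a (X l) +
      ∑ l, ∑ b ∈ Finset.univ.erase a, Kf τ j a b (X l) * gf j b (X l) +
      ∑ q ∈ Finset.univ.filter (fun q : Fin d × Fin d => q.1 < q.2), hh τ j a q X +
      ∑ q ∈ Finset.univ.filter (fun q : Fin d × Fin d => q.2 < q.1), hh τ j a q X := by
  have e1 : ∑ l, Kf τ j a a (X l) * gf j a (X l) +
      ∑ l, ∑ b ∈ Finset.univ.erase a, Kf τ j a b (X l) * gf j b (X l) =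
      ∑ l, ∑ l', if l = l' then hh τ j a (l, l') X else 0 := by
    rw [← Finset.sum_add_distrib]
    refine Finset.sum_congr rfl fun l _ => ?_
    rw [Finset.add_sum_erase _ (fun b => Kf τ j a b (X l) * gf j b (X l)) (Finset.mem_univ a)]
    simp [hh]
  rw [e1, Finset.sum_filter, Finset.sum_filter, Fintype.sum_prod_type, Fintype.sum_prod_type,
    ← Finset.sum_add_distrib, ← Finset.sum_add_distrib]
  refine Finset.sum_congr rfl fun l _ => ?_
  rw [← Finset.sum_add_distrib, ← Finset.sum_add_distrib]
  refine Finset.sum_congr rfl fun l' _ => ?_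
  rcases lt_trichotomy l l' with h | h | h
  · simp [h, h.ne, h.not_gt]
  · simp [h]
  · simp [h, h.ne', h.not_gt]

lemma E_Za (H : SD μ J τ τ' L) (hd : 0 < d) (j a : Fin n) :
    ∫ X : Fin d → Fin n → ℝ, ((Mx τ j X - 1).mulVec (wv j X) a) ^ 2 ∂(PP (Fin n) (Fin d) μ) ≤
      80 * (∫ x, L x ^ 24 ∂μ) * (1 / d + (n : ℝ) ^ 2 / d ^ 2 + 2 * n / d) := by
  have hd0 : (0 : ℝ) < d := by exact_mod_cast hd
  simp only [Z_eq hd, split_sum]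
  set A : (Fin d → Fin n → ℝ) → ℝ := fun X => ∑ l, Kf τ j a a (X l) * gf j a (X l) with hA
  set B : (Fin d → Fin n → ℝ) → ℝ := fun X => ∑ l, ∑ b ∈ Finset.univ.erase a, Kf τ j a b (X l) * gf j b (X l) with hB
  set C : (Fin d → Fin n → ℝ) → ℝ := fun X =>
    ∑ q ∈ Finset.univ.filter (fun q : Fin d × Fin d => q.1 < q.2), hh τ j a q X with hC
  set D : (Fin d → Fin n → ℝ) → ℝ := fun X =>
    ∑ q ∈ Finset.univ.filter (fun q : Fin d × Fin d => q.2 < q.1), hh τ j a q X with hD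
  have gA : Gr (Lam L) 5 A := Gr.sum fun l _ => gr_Kg H j a a l l
  have gB : Gr (Lam L) 5 B := Gr.sum fun l _ => Gr.sum fun b _ => gr_Kg H j a b l l
  have gC : Gr (Lam L) 5 C := Gr.sum fun q _ => gr_hh H j a q
  have gD : Gr (Lam L) 5 D := Gr.sum fun q _ => gr_hh H j a q
  have iA := (gA.sq (k := 10) rfl).integrable (wt H) (by norm_num)
  have iB := (gB.sq (k := 10) rfl).integrable (wt H) (by norm_num)
  have iC := (gC.sq (k := 10) rfl).integrable (wt H) (by norm_num)
  have iD := (gD.sq (k := 10) rfl).integrable (wt H) (by norm_num)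
  have bA : ∫ X, A X ^ 2 ∂(PP (Fin n) (Fin d) μ) ≤ _ := diag1 H j a
  have bB : ∫ X, B X ^ 2 ∂(PP (Fin n) (Fin d) μ) ≤ _ := diag2 H j a
  have bC : ∫ X, C X ^ 2 ∂(PP (Fin n) (Fin d) μ) ≤ _ := hh_part H j a _ (Or.inl fun q hq => by simpa using hq)
  have bD : ∫ X, D X ^ 2 ∂(PP (Fin n) (Fin d) μ) ≤ _ := hh_part H j a _ (Or.inr fun q hq => by simpa using hq)
  have j1 := iA.fun_add iB
  have j2 := j1.fun_add iC
  have j3 := j2.fun_add iD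
  have pw : ∀ X, (A X + B X + C X + D X) ^ 2 ≤ 4 * (A X ^ 2 + B X ^ 2 + C X ^ 2 + D X ^ 2) := fun X => by
    nlinarith [sq_nonneg (A X - B X), sq_nonneg (A X - C X), sq_nonneg (A X - D X), sq_nonneg (B X - C X),
      sq_nonneg (B X - D X), sq_nonneg (C X - D X)]
  have step : ∫ X, (A X + B X + C X + D X) ^ 2 ∂(PP (Fin n) (Fin d) μ) ≤
      ∫ X, 4 * (A X ^ 2 + B X ^ 2 + C X ^ 2 + D X ^ 2) ∂(PP (Fin n) (Fin d) μ) :=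
    integral_mono_of_nonneg (Eventually.of_forall fun X => sq_nonneg _) (j3.const_mul 4)
      (Eventually.of_forall pw)
  rw [integral_const_mul, integral_add j2 iD, integral_add j1 iC, integral_add iA iB] at step
  rw [integral_div]
  set C0 := ∫ x, L x ^ 24 ∂μ
  have fin : ∫ X, (A X + B X + C X + D X) ^ 2 ∂(PP (Fin n) (Fin d) μ) ≤
      80 * C0 * ((d:ℝ) ^ 2 + d * n ^ 2 + 2 * n * d ^ 2) := by nlinarith
  calc _ ≤ 80 * C0 * ((d:ℝ) ^ 2 + d * n ^ 2 + 2 * n * d ^ 2) / (d : ℝ) ^ 3 := by gcongr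
    _ = _ := by field_simp

lemma E_V (H : SD μ J τ τ' L) (hd : 0 < d) :
    ∑ p : Fin n, ∑ i : Fin n, ∫ X : Fin d → Fin n → ℝ, Vv τ τ' p X i ^ 2 ∂(PP (Fin n) (Fin d) μ) ≤
      (∫ x, L x ^ 24 ∂μ) * (40800 * ((n : ℝ) ^ 3 / d) + 640 * (n : ℝ) ^ 4 / d ^ 2) := by
  have hd0 : (0 : ℝ) < d := by exact_mod_cast hd
  have h0 : 0 ≤ ∫ x, L x ^ 24 ∂μ := integral_nonneg fun x => pow_nonneg (zero_le_one.trans (H.one_le x)) _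
  set C0 := ∫ x, L x ^ 24 ∂μ with hC0
  have iV : ∀ p i, Integrable (fun X : Fin d → Fin n → ℝ => Vv τ τ' p X i ^ 2) (PP (Fin n) (Fin d) μ) :=
    fun p i => ((gr_Vv H p i).sq rfl).integrable (wt H) (by norm_num)
  have iZ : ∀ p a, Integrable (fun X : Fin d → Fin n → ℝ => ((Mx τ p X - 1).mulVec (wv p X) a) ^ 2)
      (PP (Fin n) (Fin d) μ) := fun p a => by
    refine Gr.integrable (wt H) (m := 10) (Gr.sq (m := 5) ?_ rfl) (by norm_num)
    show Gr (Lam L) 5 (fun X : Fin d → Fin n → ℝ => ∑ b, (Mx τ p X - 1) a b * wv p X b)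
    exact Gr.sum fun b _ => (gr_Mx H p a b).mul' (gr_w H p b) rfl
  have key : ∀ p : Fin n, ∑ i : Fin n, ∫ X : Fin d → Fin n → ℝ, Vv τ τ' p X i ^ 2 ∂(PP (Fin n) (Fin d) μ) ≤
      8 * (n * (80 * C0 * (1 / d + (n : ℝ) ^ 2 / d ^ 2 + 2 * n / d))) +
      12 * (d * (3240 * C0 * (n : ℝ) ^ 2 / d ^ 2)) := fun p => by
    rw [← integral_finsetSum _ fun i _ => iV p i]
    have iZs : Integrable (fun X : Fin d → Fin n → ℝ => Zs τ p X) (PP (Fin n) (Fin d) μ) :=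
      integrable_finsetSum _ fun a _ => iZ p a
    have iT : Integrable (fun X : Fin d → Fin n → ℝ => ∑ l, τ (X l p) *
      ((8 * τ' (X l p) ^ 2 * Qs p (X l) ^ 2 + 128 * Ks τ τ' p (X l)) / d ^ 2)) (PP (Fin n) (Fin d) μ) :=
      integrable_finsetSum _ fun l _ => (E_second H p l).1
    refine (integral_mono_of_nonneg
      (Eventually.of_forall fun X => Finset.sum_nonneg fun _ _ => sq_nonneg _)
      ((iZs.const_mul 8).add (iT.const_mul 12))
      (Eventually.of_forall fun X => V_sq hd H.τ_nonneg p X)).trans ?_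
    simp only [Pi.add_apply]
    rw [integral_add (iZs.const_mul 8) (iT.const_mul 12), integral_const_mul, integral_const_mul]
    have b1 : ∫ X : Fin d → Fin n → ℝ, Zs τ p X ∂(PP (Fin n) (Fin d) μ) ≤
        n * (80 * C0 * (1 / d + (n : ℝ) ^ 2 / d ^ 2 + 2 * n / d)) := by
      unfold Zs
      rw [integral_finsetSum _ fun a _ => iZ p a]
      refine (Finset.sum_le_sum fun a _ => E_Za H hd p a).trans ?_
      simp [← hC0]
    have b2 : ∫ X : Fin d → Fin n → ℝ, ∑ l, τ (X l p) *
      ((8 * τ' (X l p) ^ 2 * Qs p (X l) ^ 2 + 128 * Ks τ τ' p (X l)) / d ^ 2) ∂(PP (Fin n) (Fin d) μ) ≤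
        d * (3240 * C0 * (n : ℝ) ^ 2 / d ^ 2) := by
      rw [integral_finsetSum _ fun l _ => (E_second H p l).1]
      refine (Finset.sum_le_sum fun l _ => (E_second H p l).2).trans ?_
      simp [← hC0]
    linarith
  refine (Finset.sum_le_sum fun p _ => key p).trans ?_
  simp only [Finset.sum_const, Finset.card_univ, Fintype.card_fin, nsmul_eq_mul]
  have hn : (n : ℝ) ^ 2 ≤ (n : ℝ) ^ 3 := by
    rcases Nat.eq_zero_or_pos n with h | h
    · simp [h]
    · exact pow_le_pow_right₀ (by exact_mod_cast h) (by norm_num)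
  have hn2 : C0 * ((n : ℝ) ^ 2 / d) ≤ C0 * ((n : ℝ) ^ 3 / d) := by gcongr
  have e : (n : ℝ) * (8 * (n * (80 * C0 * (1 / d + (n : ℝ) ^ 2 / d ^ 2 + 2 * n / d))) +
      12 * (d * (3240 * C0 * (n : ℝ) ^ 2 / d ^ 2))) =
      640 * (C0 * ((n:ℝ) ^ 2 / d)) + C0 * (40160 * ((n:ℝ) ^ 3 / d) + 640 * (n : ℝ) ^ 4 / d ^ 2) := by
    field_simp; ring
  rw [e]
  linarith

end mom

end WG

namespace WG

section fin
variable {μ : Measure ℝ} [IsProbabilityMeasure μ] {J : Set ℝ} {τ τ' L : ℝ → ℝ} {n d : ℕ}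

/-- symmetric embedding -/
noncomputable def emb (n : ℕ) (u : {q : Fin n × Fin n // q.1 < q.2} → ℝ) : Fin n → Fin n → ℝ :=
  fun i j => if h : i < j then u ⟨(i, j), h⟩ else if h : j < i then u ⟨(j, i), h⟩ else 0

lemma meas_emb (n : ℕ) : Measurable (emb n) := by
  refine measurable_pi_lambda _ fun i => measurable_pi_lambda _ fun j => ?_
  unfold emb
  by_cases h : i < j
  · simp only [h, dite_true]; exact measurable_pi_apply _
  · by_cases h' : j < i
    · simp only [h, h', dite_true, dite_false]; exact measurable_pi_apply _
    · simp only [h, h', dite_false]; exact measurable_const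

lemma wishart_eq (H : SD μ J τ τ' L) :
    scaledWishartLaw μ n d = ((PP (Fin n) (Fin d) μ).map Ww).map (emb n) := by
  have h1 : scaledWishartLaw μ n d = Measure.map
    (fun X : Fin n → Fin d → ℝ => fun i j =>
      if i = j then 0 else (∑ k, X i k * X j k) / Real.sqrt d) (PP (Fin d) (Fin n) μ) := rfl
  rw [h1, ← PP_swap, Measure.map_map, Measure.map_map (meas_emb n) (meas_Ww H)]
  · congr 1
    funext X i j
    simp only [Function.comp, emb, Ww]
    rcases lt_trichotomy i j with h | h | h
    · simp [h, h.ne]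
    · subst h; simp
    · simp only [h, h.ne', not_lt.2 h.le, dite_true, dite_false, if_false]
      simp only [mul_comm]
  · refine measurable_pi_lambda _ fun i => measurable_pi_lambda _ fun j => ?_
    by_cases h : i = j
    · simp only [h, if_true]; exact measurable_const
    · simp only [h, if_false]; fun_prop
  · fun_prop

lemma tv_bound (H : SD μ J τ τ' L) (hd : 0 < d) :
    tvDist (scaledWishartLaw μ n d) (goeZeroDiagLaw n) ≤
      Real.pi / 2 * √((∫ x, L x ^ 24 ∂μ) * (40800 * ((n : ℝ) ^ 3 / d) + 640 * (n : ℝ) ^ 4 / d ^ 2))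
        + 160 * (∫ x, L x ^ 24 ∂μ) * ((n : ℝ) ^ 3 / d) := by
  have hne : Nonempty {A : Set (Fin n → Fin n → ℝ) // MeasurableSet A} := ⟨⟨∅, .empty⟩⟩
  refine ciSup_le fun A => ?_
  have hA := meas_emb n A.2
  have hg : goeZeroDiagLaw n = (gam {q : Fin n × Fin n // q.1 < q.2}).map (emb n) := rfl
  rw [wishart_eq H, hg, Measure.map_apply (meas_emb n) A.2, Measure.map_apply (meas_emb n) A.2]
  refine ((tvhyp H hd).tv hA).trans ?_
  refine add_le_add (mul_le_mul_of_nonneg_left (Real.sqrt_le_sqrt ?_) (by positivity)) ?_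
  · refine le_trans ?_ (E_V H hd)
    rw [← Finset.sum_product' (f := fun p i => ∫ X, Vv τ τ' p X i ^ 2 ∂(PP (Fin n) (Fin d) μ))]
    have hinj : Function.Injective (fun k : {q : Fin n × Fin n // q.1 < q.2} => (k.1.2, k.1.1)) := by
      rintro ⟨⟨a, b⟩, h⟩ ⟨⟨a', b'⟩, h'⟩ hh
      simp only [Prod.mk.injEq] at hh
      simp [hh.1, hh.2]
    rw [← Finset.sum_image (s := Finset.univ)
      (g := fun k : {q : Fin n × Fin n // q.1 < q.2} => (k.1.2, k.1.1))
      (f := fun x => ∫ X, Vv τ τ' x.1 X x.2 ^ 2 ∂(PP (Fin n) (Fin d) μ)) (fun _ _ _ _ h => hinj h)]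
    refine Finset.sum_le_sum_of_subset_of_nonneg (fun x _ => by simp) fun x _ _ =>
      integral_nonneg fun X => sq_nonneg _
  · have hi := Gr.integrable (wt H) (gr_SS (n := n) (d := d) H) (by norm_num)
    have hc := Gr.integrable (wt H) (gr_chi (n := n) (d := d) H) (by norm_num)
    calc ∫ X, (1 - chi τ X) ∂(PP (Fin n) (Fin d) μ) ≤ ∫ X, 8 * SS τ X ∂(PP (Fin n) (Fin d) μ) :=
          integral_mono ((integrable_const _).sub hc) (hi.const_mul 8) fun X => one_sub_chi_le τ X
      _ = 8 * ∫ X, SS τ X ∂(PP (Fin n) (Fin d) μ) := integral_const_mul _ _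
      _ ≤ _ := by linarith [E_SS (n := n) H hd]

end fin

lemma ratio_tendsto (d : ℕ → ℕ) (hd : ∀ n, 0 < d n)
    (hdim : Tendsto (fun n => (d n : ℝ) / ((n : ℝ) ^ 3 * Real.log (d n) ^ 2)) atTop atTop) :
    Tendsto (fun n : ℕ => (n : ℝ) ^ 3 / d n) atTop (𝓝 0) := by
  have h1 := (hdim.inv_tendsto_atTop).mul_const ((Real.log 2 ^ 2)⁻¹)
  rw [zero_mul] at h1
  refine squeeze_zero' (Eventually.of_forall fun n => by positivity) ?_ h1
  filter_upwards [hdim.eventually_ge_atTop 1, eventually_ge_atTop 1] with n hn hn1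
  have hd2 : 2 ≤ d n := by
    by_contra hlt
    have : d n = 1 := by have := hd n; omega
    rw [this] at hn
    norm_num at hn
  have hdR : (2 : ℝ) ≤ d n := by exact_mod_cast hd2
  have hl2 : 0 < Real.log 2 := Real.log_pos (by norm_num)
  have hl : Real.log 2 ≤ Real.log (d n) := Real.log_le_log (by norm_num) hdR
  have hn0 : (0 : ℝ) < n := by exact_mod_cast hn1
  simp only [Pi.inv_apply, inv_div]
  rw [div_mul_eq_mul_div, div_le_div_iff_of_pos_right (by linarith), mul_assoc]
  refine le_mul_of_one_le_right (by positivity) ?_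
  rw [← div_eq_mul_inv, one_le_div (by positivity)]
  exact pow_le_pow_left₀ hl2.le hl 2

end WG

/-- If `μ` is a log-concave probability measure on `ℝ` with mean 0 and variance 1, and
`d_n/(n³ (ln d_n)²) → ∞`, then `TV(𝒲_{n,d_n}, 𝒢_n) → 0`. Log-concavity is expressed by
`μ` having a density `f` with `f(tx+(1-t)y) ≥ f(x)^t f(y)^{1-t}`. -/
theorem tv_scaled_wishart_goe_tendsto_zero (μ : Measure ℝ) [IsProbabilityMeasure μ]
    (hmean : ∫ x, x ∂μ = 0) (hvar : ∫ x, x ^ 2 ∂μ = 1)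
    (hlc : ∃ f : ℝ → ℝ, (∀ x, 0 ≤ f x) ∧
      μ = volume.withDensity (fun x => ENNReal.ofReal (f x)) ∧
      ∀ x y : ℝ, ∀ t ∈ Set.Icc (0 : ℝ) 1,
        f x ^ t * f y ^ (1 - t) ≤ f (t * x + (1 - t) * y))
    (d : ℕ → ℕ) (hd : ∀ n, 0 < d n)
    (hdim : Tendsto (fun n => (d n : ℝ) / ((n : ℝ) ^ 3 * Real.log (d n) ^ 2)) atTop atTop) :
    Tendsto (fun n => tvDist (scaledWishartLaw μ n (d n)) (goeZeroDiagLaw n)) atTop (𝓝 0) := by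
  obtain ⟨f, hf0, hμ, hf⟩ := hlc
  obtain ⟨J, τ, τ', L, H⟩ := WG.exists_SD μ hmean hvar (f := f) ⟨hf0, hf⟩ hμ
  have hr := WG.ratio_tendsto d hd hdim
  set C := ∫ x, L x ^ 24 ∂μ with hC
  have hC0 : 0 ≤ C := integral_nonneg fun x => by positivity
  have hlim : Tendsto (fun n : ℕ => Real.pi / 2 * √(C * (40800 * ((n : ℝ) ^ 3 / d n)
      + 640 * ((n : ℝ) ^ 3 / d n) ^ 2)) + 160 * C * ((n : ℝ) ^ 3 / d n)) atTop (𝓝 0) := by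
    have hc : Continuous (fun r : ℝ => Real.pi / 2 * √(C * (40800 * r
      + 640 * r ^ 2)) + 160 * C * r) := by fun_prop
    have := (hc.tendsto 0).comp hr
    simpa [Function.comp_def] using this
  refine squeeze_zero' (Eventually.of_forall fun n => Real.iSup_nonneg fun A => abs_nonneg _) ?_ hlim
  filter_upwards [eventually_ge_atTop 1] with n hn
  refine (WG.tv_bound H (hd n)).trans ?_
  rw [← hC]
  have hn1 : (1 : ℝ) ≤ n := by exact_mod_cast hn
  have h46 : (n : ℝ) ^ 4 / (d n : ℝ) ^ 2 ≤ ((n : ℝ) ^ 3 / d n) ^ 2 := by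
    rw [div_pow, ← pow_mul]
    exact div_le_div_of_nonneg_right (pow_le_pow_right₀ hn1 (by norm_num)) (by positivity)
  gcongr
  rw [mul_div_assoc]
  gcongr
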